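/- arXiv:math/0405179 — 2 statements merged into one kernel-verified Lean document; each statement's English description precedes it below -/
import Mathlib

section
/- Let φ be an injective ℂ-algebra endomorphism of ℂ[x,y], and suppose that the image φ(ℂ[x,y]) contains no coordinate polynomial of ℂ[x,y]. Then φ^∞(ℂ[x,y]) = ℂ, where φ^∞(ℂ[x,y]) denotes the intersection over all k ≥ 1 of the images φ^k(ℂ[x,y]). -/
open MvPolynomial

/-- `ℂ[x,y]` as multivariate polynomials in two variables. -/
local notation "P" => MvPolynomial (Fin 2) ℂ

/-- A coordinate polynomial: one taken to `x` by some `ℂ`-algebra automorphism. -/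
def IsCoordinate (q : P) : Prop :=
  ∃ α : P ≃ₐ[ℂ] P, α q = X 0

/-- Evaluation of a polynomial in two variables: the inner variable goes to `p`, the outer one
to `q`. -/
noncomputable def bivEval {k S : Type*} [CommRing k] [CommRing S] [Algebra k S] (p q : S) :
    Polynomial (Polynomial k) →+* S :=
  Polynomial.eval₂RingHom (Polynomial.aeval p : Polynomial k →ₐ[k] S).toRingHom q

section bivEval

variable {k S T : Type*} [CommRing k] [CommRing S] [Algebra k S] [CommRing T] [Algebra k T]

@[simp]
lemma bivEval_C (p q : S) (f : Polynomial k) :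
    bivEval p q (Polynomial.C f) = Polynomial.aeval p f := by
  simp [bivEval]

@[simp]
lemma bivEval_X (p q : S) : bivEval (k := k) p q Polynomial.X = q := by
  simp [bivEval]

lemma bivEval_eq_sum (p q : S) (f : Polynomial (Polynomial k)) :
    bivEval p q f = ∑ i ∈ Finset.range (f.natDegree + 1),
      Polynomial.aeval p (f.coeff i) * q ^ i := by
  simp [bivEval, Polynomial.eval₂_eq_sum_range]

lemma map_bivEval (φ : S →ₐ[k] T) (p q : S) (f : Polynomial (Polynomial k)) :
    φ (bivEval p q f) = bivEval (φ p) (φ q) f := by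
  simp [bivEval_eq_sum, Polynomial.aeval_algHom_apply]

end bivEval

section Relations

variable {k : Type*} [Field k]

lemma eq_zero_of_coeff_eq_zero_of_totalDegree_le {n : ℕ} {f : MvPolynomial (Fin 2) k}
    (hf : f.totalDegree ≤ n)
    (h : ∀ e : Fin 2 → Fin (n + 1),
      f.coeff (Finsupp.equivFunOnFinite.symm fun i => (e i : ℕ)) = 0) : f = 0 := by
  ext m
  rw [coeff_zero]
  by_contra hm
  have hle : ∀ i, m i < n + 1 := fun i => by
    have h1 := le_totalDegree (mem_support_iff.2 hm)
    have h2 : m i ≤ m.sum fun _ e => e := by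
      exact Finsupp.le_degree i m
    omega
  apply hm
  convert h fun i => ⟨m i, hle i⟩ using 2
  ext i
  simp

/-- Any sufficiently large number (depending only on `p` and `q`) of polynomials in two variables
is linearly dependent over `k[p, q]`. -/
theorem exists_linear_relation (p q : MvPolynomial (Fin 2) k) :
    ∃ N : ℕ, ∀ u : Fin (N + 1) → MvPolynomial (Fin 2) k,
      ∃ c : Fin (N + 1) → Polynomial (Polynomial k),
        c ≠ 0 ∧ ∑ i, bivEval p q (c i) * u i = 0 := by
  set D := p.totalDegree + q.totalDegree with hD
  set N := (D + 1) ^ 2 with hN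
  refine ⟨N, fun u => ?_⟩
  set s := Finset.univ.sup fun i => (u i).totalDegree with hs
  set n := s * D + s with hn
  let L : (Fin (N + 1) × Fin (s + 1) × Fin (s + 1) → k) →ₗ[k] MvPolynomial (Fin 2) k :=
    Fintype.linearCombination k
      fun t : Fin (N + 1) × Fin (s + 1) × Fin (s + 1) =>
        p ^ (t.2.1 : ℕ) * q ^ (t.2.2 : ℕ) * u t.1
  let E : MvPolynomial (Fin 2) k →ₗ[k] ((Fin 2 → Fin (n + 1)) → k) :=
    LinearMap.pi fun e => lcoeff k (Finsupp.equivFunOnFinite.symm fun i => (e i : ℕ))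
  have hker : LinearMap.ker (E ∘ₗ L) ≠ ⊥ := by
    apply LinearMap.ker_ne_bot_of_finrank_lt
    simp only [Module.finrank_fintype_fun_eq_card, Fintype.card_prod, Fintype.card_fin,
      Fintype.card_fun]
    have h1 : n + 1 ≤ (s + 1) * (D + 1) := by rw [hn]; ring_nf; omega
    calc (n + 1) ^ 2 ≤ ((s + 1) * (D + 1)) ^ 2 := Nat.pow_le_pow_left h1 2
      _ = N * ((s + 1) * (s + 1)) := by simp only [N]; ring
      _ < (N + 1) * ((s + 1) * (s + 1)) := by gcongr; omega
  obtain ⟨v, hv, hv0⟩ := (Submodule.ne_bot_iff _).1 hker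
  have hLv : L v = 0 := by
    refine eq_zero_of_coeff_eq_zero_of_totalDegree_le (n := n) ?_ fun e => ?_
    · simp only [L, Fintype.linearCombination_apply]
      refine totalDegree_finsetSum_le fun t _ => ?_
      refine (totalDegree_smul_le _ _).trans ?_
      refine (totalDegree_mul _ _).trans (add_le_add ((totalDegree_mul _ _).trans ?_) ?_)
      · refine (add_le_add (totalDegree_pow _ _) (totalDegree_pow _ _)).trans ?_
        rw [hD, mul_add]
        exact add_le_add (Nat.mul_le_mul_right _ (by omega)) (Nat.mul_le_mul_right _ (by omega))
      · exact Finset.le_sup (f := fun i => (u i).totalDegree) (Finset.mem_univ t.1)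
    · exact congrFun (LinearMap.mem_ker.1 hv) e
  refine ⟨fun i => ∑ a : Fin (s + 1), ∑ b : Fin (s + 1),
    Polynomial.monomial (b : ℕ) (Polynomial.monomial (a : ℕ) (v (i, a, b))), ?_, ?_⟩
  · intro h0
    apply hv0
    ext ⟨i, a, b⟩
    have h1 := congrArg (fun f => (f.coeff (b : ℕ)).coeff (a : ℕ)) (congrFun h0 i)
    simpa [Polynomial.finsetSum_coeff, Polynomial.coeff_monomial, ← Fin.ext_iff,
      apply_ite (fun f : Polynomial k => f.coeff (a : ℕ))] using h1
  · rw [← hLv]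
    simp only [L, Fintype.linearCombination_apply, Fintype.sum_prod_type]
    refine Finset.sum_congr rfl fun i _ => ?_
    rw [map_sum, Finset.sum_mul]
    refine Finset.sum_congr rfl fun a _ => ?_
    rw [map_sum, Finset.sum_mul]
    refine Finset.sum_congr rfl fun b _ => ?_
    simp only [bivEval, Polynomial.coe_eval₂RingHom, Polynomial.eval₂_monomial,
      AlgHom.toRingHom_eq_coe, RingHom.coe_coe, Polynomial.aeval_monomial, Algebra.smul_def]
    ring

end Relations

section Algebraic

variable {k : Type*} [Field k]

theorem exists_polynomial_eval₂_bivEval_eq_zero (p q v : MvPolynomial (Fin 2) k) :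
    ∃ F : Polynomial (Polynomial (Polynomial k)), F ≠ 0 ∧ F.eval₂ (bivEval p q) v = 0 := by
  obtain ⟨N, hN⟩ := exists_linear_relation p q
  obtain ⟨c, hc, h⟩ := hN fun i => v ^ (i : ℕ)
  refine ⟨∑ i : Fin (N + 1), Polynomial.monomial (i : ℕ) (c i), fun h0 => hc ?_, ?_⟩
  · ext1 i
    have := congrArg (fun f => f.coeff (i : ℕ)) h0
    simpa [Polynomial.finsetSum_coeff, Polynomial.coeff_monomial, ← Fin.ext_iff] using this
  · simpa [Polynomial.eval₂_finsetSum, Polynomial.eval₂_monomial] using h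

/-- Any two polynomials in two variables satisfy a polynomial relation modulo a given nonzero
polynomial. -/
theorem exists_dvd_bivEval {z : MvPolynomial (Fin 2) k} (hz : z ≠ 0)
    (u v : MvPolynomial (Fin 2) k) :
    ∃ F : Polynomial (Polynomial k), F ≠ 0 ∧ z ∣ bivEval u v F := by
  obtain ⟨F, hF, h⟩ := exists_polynomial_eval₂_bivEval_eq_zero u v z
  obtain ⟨G, hFG, hG⟩ := Polynomial.exists_eq_pow_rootMultiplicity_mul_and_not_dvd F hF 0
  rw [map_zero, sub_zero] at hFG hG
  refine ⟨G.coeff 0, fun h0 => hG (Polynomial.X_dvd_iff.2 h0), ?_⟩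
  rw [hFG, Polynomial.eval₂_mul, Polynomial.eval₂_pow, Polynomial.eval₂_X] at h
  have h1 := (mul_eq_zero.1 h).resolve_left (pow_ne_zero _ hz)
  rw [← Polynomial.divX_mul_X_add G, Polynomial.eval₂_add, Polynomial.eval₂_mul,
    Polynomial.eval₂_X, Polynomial.eval₂_C] at h1
  exact ⟨-(G.divX.eval₂ (bivEval u v) z), by linear_combination h1⟩

end Algebraic

section Derivation

variable {k S R : Type*} [CommRing k] [CommRing S] [CommRing R] [Algebra k S] [Algebra k R]
  [Algebra S R]

lemma Derivation.map_eval_of_coeff (d : Derivation k S R) (v : S) {g : Polynomial S}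
    (hg : ∀ i, d (g.coeff i) = 0) : d (g.eval v) = g.derivative.eval v • d v := by
  rw [Polynomial.derivative_eval, Polynomial.sum_def, Polynomial.eval_eq_sum, Polynomial.sum_def,
    map_sum, Finset.sum_smul]
  refine Finset.sum_congr rfl fun i _ => ?_
  simp only [leibniz, leibniz_pow, hg, smul_zero, add_zero, smul_smul, ← Nat.cast_smul_eq_nsmul S]
  congr 1
  ring

lemma Derivation.bivEval_eq_zero (d : Derivation k S R) {p q : S} (hp : d p = 0) (hq : d q = 0)
    (f : Polynomial (Polynomial k)) : d (bivEval p q f) = 0 := by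
  simp [bivEval_eq_sum, Derivation.leibniz_pow, Derivation.map_aeval, hp, hq]

variable [IsDomain R] [CharZero R]

theorem Derivation.eq_zero_of_eval_eq_zero (d : Derivation k S R)
    (hd : ∀ s, algebraMap S R s = 0 → d s = 0) (v : S) {g : Polynomial S}
    (hg0 : g.map (algebraMap S R) ≠ 0) (hg : ∀ i, d (g.coeff i) = 0)
    (h : algebraMap S R (g.eval v) = 0) : d v = 0 := by
  induction hn : (g.map (algebraMap S R)).natDegree using Nat.strong_induction_on
    generalizing g with
  | _ n ih =>
    have hpos : (g.map (algebraMap S R)).natDegree ≠ 0 := by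
      intro h0
      rw [← Polynomial.eval₂_at_apply, ← Polynomial.eval_map,
        Polynomial.eq_C_of_natDegree_eq_zero h0, Polynomial.eval_C] at h
      rw [Polynomial.eq_C_of_natDegree_eq_zero h0, h, Polynomial.C_0] at hg0
      exact hg0 rfl
    have h1 := d.map_eval_of_coeff v hg
    rw [hd _ h, eq_comm, algebra_compatible_smul R, smul_eq_mul, mul_eq_zero] at h1
    refine h1.elim (fun h2 => ?_) id
    refine ih _ ?_ (g := g.derivative) (fun h0 => ?_) (fun i => ?_) h2 rfl
    · rw [← Polynomial.derivative_map, ← hn]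
      exact Polynomial.natDegree_derivative_lt hpos
    · rw [← Polynomial.derivative_map] at h0
      exact hpos (Polynomial.derivative_eq_zero.1 h0)
    · rw [Polynomial.coeff_derivative]
      simp [hg]

theorem Derivation.eq_zero_of_eval₂_eq_zero {S₀ : Type*} [CommRing S₀] (d : Derivation k S R)
    (hd : ∀ s, algebraMap S R s = 0 → d s = 0) {θ : S₀ →+* S}
    (hθ : ∀ s, algebraMap S R (θ s) = 0 → s = 0) (hdθ : ∀ s, d (θ s) = 0) {v : S}
    {F : Polynomial S₀} (hF : F ≠ 0) (h : algebraMap S R (F.eval₂ θ v) = 0) : d v = 0 := by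
  refine d.eq_zero_of_eval_eq_zero hd v (g := F.map θ) (fun h0 => hF ?_) (fun i => ?_)
    (by rwa [Polynomial.eval_map])
  · ext1 i
    refine hθ _ ?_
    simpa using congrArg (fun f => f.coeff i) h0
  · rw [Polynomial.coeff_map, hdθ]

end Derivation

section pderiv

variable {k : Type*} [Field k] [CharZero k]

lemma totalDegree_pderiv_lt {σ : Type*} {i : σ} {p : MvPolynomial σ k} (h : pderiv i p ≠ 0) :
    (pderiv i p).totalDegree < p.totalDegree := by
  classical
  have hpos : 0 < p.totalDegree := by
    by_contra h0
    apply h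
    rw [totalDegree_eq_zero_iff_eq_C.1 (Nat.eq_zero_of_not_pos h0), pderiv_C]
  suffices (pderiv i p).totalDegree ≤ p.totalDegree - 1 by omega
  conv_lhs => rw [p.as_sum, map_sum]
  refine totalDegree_finsetSum_le fun m hm => ?_
  rw [pderiv_monomial]
  by_cases hmi : m i = 0
  · simp [hmi]
  refine (totalDegree_monomial_le _ _).trans ?_
  change ((m - Finsupp.single i 1).sum fun _ e => e) ≤ _
  have h1 := le_totalDegree hm
  have h2 : m = (m - Finsupp.single i 1) + Finsupp.single i 1 := by
    rw [tsub_add_cancel_of_le]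
    simpa [Nat.one_le_iff_ne_zero] using hmi
  have h3 : (m.sum fun _ e => e) = ((m - Finsupp.single i 1).sum fun _ e => e) + 1 := by
    conv_lhs => rw [h2, Finsupp.sum_add_index' (fun _ => rfl) (fun _ _ _ => rfl)]
    simp
  omega

lemma eq_C_of_pderiv_eq_zero {σ : Type*} {p : MvPolynomial σ k} (h : ∀ i, pderiv i p = 0) :
    ∃ c, p = C c := by
  classical
  refine ⟨p.coeff 0, ?_⟩
  ext m
  rw [coeff_C]
  by_cases hm : 0 = m
  · rw [hm, if_pos rfl]
  have ⟨i, hi⟩ : ∃ i, m i ≠ 0 := by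
    by_contra! h0
    exact hm (Finsupp.ext fun i => (h0 i).symm)
  have h1 := congrArg (coeff (m - Finsupp.single i 1)) (h i)
  rw [coeff_zero, coeff_pderiv] at h1
  rw [tsub_add_cancel_of_le (by simpa [Nat.one_le_iff_ne_zero] using hi)] at h1
  rw [if_neg hm]
  exact (mul_eq_zero.1 h1).resolve_right ((Nat.cast_add_one_ne_zero _))

end pderiv

/-- The Jacobian derivation `u ↦ p_x u_y - p_y u_x`. -/
noncomputable def jac (p : P) : Derivation ℂ P P :=
  pderiv 0 p • pderiv 1 - pderiv 1 p • pderiv 0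

section jac

lemma jac_apply (p q : P) : jac p q = pderiv 0 p * pderiv 1 q - pderiv 1 p * pderiv 0 q := rfl

lemma jac_comm (p q : P) : jac p q = -jac q p := by
  simp only [jac_apply]; ring

@[simp]
lemma jac_self (p : P) : jac p p = 0 := by
  simp only [jac_apply]; ring

@[simp]
lemma jac_C (p : P) (c : ℂ) : jac p (C c) = 0 :=
  (jac p).map_algebraMap c

@[simp]
lemma jac_aeval_self (p : P) (h : Polynomial ℂ) : jac p (Polynomial.aeval p h) = 0 := by
  simp [Derivation.map_aeval]

lemma jac_sub_C_mul (p : P) (z : ℂ) (v : P) :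
    jac p ((p - C z) * v) = (p - C z) * jac p v := by
  simp [Derivation.leibniz, jac_self]

lemma jac_X_zero (p : P) : jac p (X 0) = -pderiv 1 p := by
  simp [jac_apply]

lemma jac_X_one (p : P) : jac p (X 1) = pderiv 0 p := by
  simp [jac_apply]

lemma eq_C_of_jac_X_eq_zero {p : P} (h : ∀ i, jac p (X i) = 0) : ∃ c, p = C c := by
  refine eq_C_of_pderiv_eq_zero fun i => ?_
  have h0 := h 0
  have h1 := h 1
  rw [jac_X_zero, neg_eq_zero] at h0
  rw [jac_X_one] at h1
  fin_cases i
  exacts [h1, h0]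

lemma pderiv_algHom (φ : P →ₐ[ℂ] P) (i : Fin 2) (u : P) :
    pderiv i (φ u) = φ (pderiv 0 u) * pderiv i (φ (X 0)) + φ (pderiv 1 u) * pderiv i (φ (X 1)) := by
  induction u using MvPolynomial.induction_on with
  | C c => simp [← MvPolynomial.algebraMap_eq]
  | add p q hp hq => simp only [map_add, hp, hq]; ring
  | mul_X p j hp =>
    simp only [map_mul, Derivation.leibniz, map_add, hp, smul_eq_mul]
    fin_cases j <;> simp <;> ring

theorem jac_algHom (φ : P →ₐ[ℂ] P) (u v : P) :
    jac (φ u) (φ v) = φ (jac u v) * jac (φ (X 0)) (φ (X 1)) := by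
  simp only [jac_apply, pderiv_algHom φ _ u, pderiv_algHom φ _ v, map_sub, map_mul]
  ring

lemma totalDegree_jac_lt {p q : P} (h : jac p q ≠ 0) :
    (jac p q).totalDegree + 2 ≤ p.totalDegree + q.totalDegree := by
  have key : ∀ i j, pderiv i p * pderiv j q ≠ 0 →
      (pderiv i p * pderiv j q).totalDegree + 2 ≤ p.totalDegree + q.totalDegree := by
    intro i j h
    have h1 := totalDegree_pderiv_lt (left_ne_zero_of_mul h)
    have h2 := totalDegree_pderiv_lt (right_ne_zero_of_mul h)
    have h3 := totalDegree_mul (pderiv i p) (pderiv j q)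
    omega
  rw [jac_apply] at h ⊢
  by_cases h1 : pderiv 0 p * pderiv 1 q = 0
  · rw [h1, zero_sub, neg_ne_zero] at h
    rw [h1, zero_sub, totalDegree_neg]
    exact key _ _ h
  by_cases h2 : pderiv 1 p * pderiv 0 q = 0
  · rw [h2, sub_zero]
    exact key _ _ h1
  have h3 := totalDegree_sub (pderiv 0 p * pderiv 1 q) (pderiv 1 p * pderiv 0 q)
  have h4 := key _ _ h1
  have h5 := key _ _ h2
  omega

/-- Proportionality of gradients is transitive through a nonconstant polynomial. -/
lemma jac_eq_zero_trans {u v w : P} (hw : ∀ c, w ≠ C c) (huw : jac u w = 0) (hwv : jac w v = 0) :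
    jac u v = 0 := by
  by_contra h
  have h0 : pderiv 0 w * jac u v = 0 := by
    simp only [jac_apply] at *
    linear_combination pderiv 0 v * huw + pderiv 0 u * hwv
  have h1 : pderiv 1 w * jac u v = 0 := by
    simp only [jac_apply] at *
    linear_combination pderiv 1 v * huw + pderiv 1 u * hwv
  obtain ⟨c, hc⟩ := eq_C_of_pderiv_eq_zero (p := w) fun i => by
    fin_cases i
    exacts [(mul_eq_zero.1 h0).resolve_right h, (mul_eq_zero.1 h1).resolve_right h]
  exact hw c hc

theorem bivEval_injective_of_jac_ne_zero {p q : P} (h : jac p q ≠ 0) :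
    Function.Injective (bivEval (k := ℂ) p q) := by
  have hp : ∀ f : Polynomial ℂ, Polynomial.aeval p f = 0 → f = 0 := by
    intro f hf
    by_contra hf0
    apply h
    rw [jac_comm, neg_eq_zero]
    refine (jac q).eq_zero_of_eval₂_eq_zero (θ := algebraMap ℂ P) (by simp) (by simp)
      (fun s => by simp) hf0 ?_
    simpa [Polynomial.aeval_def] using hf
  rw [injective_iff_map_eq_zero]
  intro F hF
  by_contra hF0
  refine h ((jac p).eq_zero_of_eval₂_eq_zero
    (θ := (Polynomial.aeval p : Polynomial ℂ →ₐ[ℂ] P).toRingHom) (by simp) ?_ ?_ hF0 hF)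
  · exact fun s hs => hp s hs
  · exact fun s => jac_aeval_self p s

theorem jac_ne_zero_of_bivEval_injective {p q : P}
    (h : Function.Injective (bivEval (k := ℂ) p q)) : jac p q ≠ 0 := by
  intro h0
  have hx : ∀ v, jac p v = 0 := by
    intro v
    obtain ⟨F, hF, hv⟩ := exists_polynomial_eval₂_bivEval_eq_zero p q v
    exact (jac p).eq_zero_of_eval₂_eq_zero (by simp)
      (fun s hs => (injective_iff_map_eq_zero _).1 h s hs)
      (fun s => (jac p).bivEval_eq_zero (jac_self p) h0 s) hF hv
  obtain ⟨c, rfl⟩ := eq_C_of_jac_X_eq_zero fun i => hx (X i)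
  refine Polynomial.X_sub_C_ne_zero c (Polynomial.C_injective ?_)
  rw [map_zero]
  exact h (by simp [MvPolynomial.algebraMap_eq])

lemma jac_X_ne_zero_of_injective {φ : P →ₐ[ℂ] P} (hφ : Function.Injective φ) :
    jac (φ (X 0)) (φ (X 1)) ≠ 0 := by
  apply jac_ne_zero_of_bivEval_injective
  have h : Function.Injective (bivEval (k := ℂ) (X 0 : P) (X 1)) :=
    bivEval_injective_of_jac_ne_zero (by simp [jac_apply])
  intro F G hFG
  rw [← map_bivEval, ← map_bivEval] at hFG
  exact h (hφ hFG)

end jac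

section Prime

lemma Prime.exists_dvd_sub_C_of_dvd_aeval {z u : P} (hz : Prime z) {h : Polynomial ℂ} (hh : h ≠ 0)
    (hd : z ∣ Polynomial.aeval u h) : ∃ c, z ∣ u - C c := by
  rw [(IsAlgClosed.splits h).eq_prod_roots, map_mul, Polynomial.aeval_C] at hd
  rcases hz.dvd_or_dvd hd with h1 | h1
  · refine absurd (isUnit_of_dvd_unit h1 ?_) hz.not_isUnit
    exact (IsUnit.mk0 _ (Polynomial.leadingCoeff_ne_zero.2 hh)).map (algebraMap ℂ P)
  · rw [map_multiset_prod, Multiset.map_map] at h1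
    obtain ⟨c, -, hc⟩ := hz.exists_mem_multiset_map_dvd h1
    exact ⟨c, by simpa [MvPolynomial.algebraMap_eq] using hc⟩

theorem Prime.exists_dvd_sub_C_of_dvd_jac {z u : P} (hz : Prime z) (hd : z ∣ jac u z) :
    ∃ c, z ∣ u - C c := by
  by_cases htr : ∃ h : Polynomial ℂ, h ≠ 0 ∧ z ∣ Polynomial.aeval u h
  · obtain ⟨h, hh, hd⟩ := htr
    exact hz.exists_dvd_sub_C_of_dvd_aeval hh hd
  exfalso
  push Not at htr
  let I : Ideal P := Ideal.span {z}
  have hI : I.IsPrime := (Ideal.span_singleton_prime hz.ne_zero).2 hz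
  have : IsDomain (P ⧸ I) := Ideal.Quotient.isDomain I
  have : CharZero (P ⧸ I) := algebraRat.charZero _
  have hmem : ∀ s : P, algebraMap P (P ⧸ I) s = 0 ↔ z ∣ s := fun s => by
    rw [Ideal.Quotient.algebraMap_eq, Ideal.Quotient.eq_zero_iff_mem, Ideal.mem_span_singleton]
  let d : Derivation ℂ P (P ⧸ I) := (Algebra.linearMap P (P ⧸ I)).compDer (jac z)
  have hdz : ∀ s, d s = algebraMap P (P ⧸ I) (jac z s) := fun s => rfl
  have hker : ∀ s, algebraMap P (P ⧸ I) s = 0 → d s = 0 := by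
    intro s hs
    obtain ⟨w, rfl⟩ := (hmem s).1 hs
    rw [hdz, hmem]
    simp
  have hdu : d u = 0 := by
    rw [hdz, hmem, jac_comm]
    exact hd.neg_right
  have hall : ∀ v, z ∣ jac z v := by
    intro v
    rw [← hmem, ← hdz]
    obtain ⟨F, hF, hv⟩ := exists_dvd_bivEval hz.ne_zero u v
    refine d.eq_zero_of_eval₂_eq_zero hker
      (θ := (Polynomial.aeval u : Polynomial ℂ →ₐ[ℂ] P).toRingHom) ?_ ?_ hF ((hmem _).2 hv)
    · intro s hs
      by_contra h0
      exact htr s h0 ((hmem _).1 hs)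
    · intro s
      change d (Polynomial.aeval u s) = 0
      rw [Derivation.map_aeval, hdu, smul_zero]
  have hzero : ∀ i, jac z (X i) = 0 := by
    intro i
    by_contra h0
    have h1 := totalDegree_jac_lt h0
    have h2 := totalDegree_le_of_dvd_of_isDomain (hall (X i)) h0
    rw [totalDegree_X] at h1
    omega
  obtain ⟨c, hc⟩ := eq_C_of_jac_X_eq_zero hzero
  apply hz.not_isUnit
  rw [hc]
  exact (IsUnit.mk0 c (fun h => hz.ne_zero (by rw [hc, h, C_0]))).map C

/-- An element `u` is algebraic modulo `(a, z)` when `z` is a prime not dividing `a`. -/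
lemma Prime.exists_aeval_mem_span_pair {z a : P} (hz : Prime z) (ha : ¬ z ∣ a) (u : P) :
    ∃ h : Polynomial ℂ, h ≠ 0 ∧ ∃ r s, Polynomial.aeval u h = r * a + s * z := by
  obtain ⟨F, hF, h⟩ := exists_dvd_bivEval hz.ne_zero u a
  obtain ⟨G, hFG, hG⟩ := Polynomial.exists_eq_pow_rootMultiplicity_mul_and_not_dvd F hF 0
  rw [map_zero, sub_zero] at hFG hG
  refine ⟨G.coeff 0, fun h0 => hG (Polynomial.X_dvd_iff.2 h0), ?_⟩
  rw [hFG, map_mul, map_pow, bivEval_X] at h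
  obtain ⟨s, hs⟩ := (hz.dvd_or_dvd h).resolve_left fun h1 => ha (hz.dvd_of_dvd_pow h1)
  rw [← Polynomial.divX_mul_X_add G, map_add, map_mul, bivEval_X, bivEval_C] at hs
  exact ⟨-bivEval u a G.divX, s, by linear_combination hs⟩

end Prime

section StableImage

variable {φ : P →ₐ[ℂ] P}

/-- The intersection of the images of all iterates of `φ`. -/
noncomputable def stableImage (φ : P →ₐ[ℂ] P) : Subalgebra ℂ P :=
  ⨅ k : ℕ, ((φ ^ (k + 1) : P →ₐ[ℂ] P).range : Subalgebra ℂ P)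

lemma mem_stableImage {b : P} : b ∈ stableImage φ ↔ ∀ k : ℕ, ∃ c, (φ ^ (k + 1)) c = b := by
  simp [stableImage, Algebra.mem_iInf]

lemma exists_of_mem_stableImage (hφ : Function.Injective φ) {b : P} (hb : b ∈ stableImage φ) :
    ∃ c ∈ stableImage φ, φ c = b := by
  rw [mem_stableImage] at hb
  obtain ⟨c, hc⟩ := hb 0
  rw [zero_add, pow_one] at hc
  refine ⟨c, mem_stableImage.2 fun k => ?_, hc⟩
  obtain ⟨a, ha⟩ := hb (k + 1)
  refine ⟨a, hφ ?_⟩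
  rw [hc, ← ha, pow_succ' φ (k + 1)]
  rfl

lemma algHom_map_C (φ : P →ₐ[ℂ] P) (c : ℂ) : φ (C c) = C c :=
  φ.commutes c

lemma algHom_ne_C (hφ : Function.Injective φ) {w : P} (hw : ∀ c, w ≠ C c) : ∀ c, φ w ≠ C c :=
  fun c h => hw c (hφ (h.trans (algHom_map_C φ c).symm))

lemma isUnit_iff_exists_eq_C {w : P} : IsUnit w ↔ ∃ c : ℂ, c ≠ 0 ∧ w = C c := by
  rw [MvPolynomial.isUnit_iff_eq_C_of_isReduced]
  simp only [isUnit_iff_ne_zero]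

lemma one_le_totalDegree {w : P} (hw : ∀ c, w ≠ C c) : 1 ≤ w.totalDegree := by
  by_contra h
  exact hw _ (totalDegree_eq_zero_iff_eq_C.1 (by omega))

lemma dvd_jac_of_dvd_sub_C {z u v : P} {a b : ℂ} (hu : z ∣ u - C a) (hv : z ∣ v - C b) :
    z ∣ jac u v := by
  obtain ⟨s, hs⟩ := hu
  obtain ⟨t, ht⟩ := hv
  rw [sub_eq_iff_eq_add'] at hs ht
  refine ⟨jac u t - t * jac z s, ?_⟩
  have h1 : jac u z = -(z * jac z s) := by
    rw [jac_comm, hs]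
    simp
  conv_lhs => rw [ht]
  simp only [map_add, jac_C, Derivation.leibniz, smul_eq_mul, h1]
  ring

lemma exists_multiset_prod_dvd_jac (hφ : Function.Injective φ)
    (hJ : ∀ c, jac (φ (X 0)) (φ (X 1)) ≠ C c) (k : ℕ) {b₀ b₁ : P} (h₀ : b₀ ∈ stableImage φ)
    (h₁ : b₁ ∈ stableImage φ) :
    ∃ s : Multiset P, s.card = k ∧ (∀ a ∈ s, ∀ c, a ≠ C c) ∧ s.prod ∣ jac b₀ b₁ := by
  induction k generalizing b₀ b₁ with
  | zero => exact ⟨0, by simp⟩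
  | succ k ih =>
    obtain ⟨c₀, hc₀, rfl⟩ := exists_of_mem_stableImage hφ h₀
    obtain ⟨c₁, hc₁, rfl⟩ := exists_of_mem_stableImage hφ h₁
    obtain ⟨s, hs, hs1, hs2⟩ := ih hc₀ hc₁
    refine ⟨jac (φ (X 0)) (φ (X 1)) ::ₘ s.map φ, by simp [hs], ?_, ?_⟩
    · intro a ha
      rcases Multiset.mem_cons.1 ha with rfl | ha
      · exact hJ
      · obtain ⟨a', ha', rfl⟩ := Multiset.mem_map.1 ha
        exact algHom_ne_C hφ (hs1 a' ha')
    · rw [jac_algHom φ c₀, Multiset.prod_cons, mul_comm, ← map_multiset_prod]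
      exact mul_dvd_mul_right (map_dvd φ hs2) _

lemma card_le_totalDegree_prod {s : Multiset P} (hs : ∀ a ∈ s, ∀ c, a ≠ C c) :
    s.card ≤ s.prod.totalDegree ∧ s.prod ≠ 0 := by
  induction s using Multiset.induction with
  | empty => simp
  | cons a s ih =>
    have ⟨h1, h2⟩ := ih fun b hb => hs b (Multiset.mem_cons_of_mem hb)
    have ha := hs a (Multiset.mem_cons_self a s)
    have ha0 : a ≠ 0 := by simpa using ha 0
    rw [Multiset.prod_cons, totalDegree_mul_of_isDomain ha0 h2, Multiset.card_cons]
    have := one_le_totalDegree ha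
    exact ⟨by omega, mul_ne_zero ha0 h2⟩

lemma exists_jac_eq_C (hφ : Function.Injective φ) {b₀ b₁ : P} (h₀ : b₀ ∈ stableImage φ)
    (h₁ : b₁ ∈ stableImage φ) (h : jac b₀ b₁ ≠ 0) :
    ∃ c, jac (φ (X 0)) (φ (X 1)) = C c := by
  by_contra! hJ
  obtain ⟨s, hs, hs1, hs2⟩ :=
    exists_multiset_prod_dvd_jac hφ hJ ((jac b₀ b₁).totalDegree + 1) h₀ h₁
  have h1 := (card_le_totalDegree_prod hs1).1
  have h2 := totalDegree_le_of_dvd_of_isDomain hs2 h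
  omega

/-- If the Jacobian of `φ` is constant, the image of `φ` contains every `v` lying in the fraction
field of the image. -/
lemma mem_range_of_algHom_mul_eq (hφ : Function.Injective φ) {c : ℂ}
    (hJ : jac (φ (X 0)) (φ (X 1)) = C c) {v b s : P} (hb : b ≠ 0) (h : φ b * v = φ s) :
    v ∈ φ.range := by
  induction hn : b.totalDegree using Nat.strong_induction_on generalizing b s with
  | _ n ih =>
    by_cases hbu : IsUnit b
    · obtain ⟨a, ha⟩ := hbu.exists_right_inv
      refine ⟨a * s, ?_⟩
      calc φ (a * s) = φ (b * a) * v := by rw [map_mul, ← h, map_mul]; ring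
        _ = v := by rw [ha, map_one, one_mul]
    obtain ⟨π, hπ, b', rfl⟩ := WfDvdMonoid.exists_irreducible_factor hbu hb
    have hπC : ∀ c, π ≠ C c := by
      rintro c rfl
      refine hπ.not_isUnit (isUnit_iff_exists_eq_C.2 ⟨c, ?_, rfl⟩)
      rintro rfl
      exact hπ.ne_zero C_0
    by_cases hs : π ∣ s
    · obtain ⟨s', rfl⟩ := hs
      refine ih _ ?_ (right_ne_zero_of_mul hb) (s := s') ?_ rfl
      · rw [← hn, totalDegree_mul_of_isDomain hπ.ne_zero (right_ne_zero_of_mul hb)]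
        have := one_le_totalDegree hπC
        omega
      · rw [map_mul, map_mul, mul_assoc] at h
        exact mul_left_cancel₀ ((map_ne_zero_iff φ hφ).2 hπ.ne_zero) h
    exfalso
    obtain ⟨ϖ, hϖ, hd⟩ := WfDvdMonoid.exists_irreducible_factor (a := φ π)
      (fun hu => by
        obtain ⟨c, -, hc⟩ := isUnit_iff_exists_eq_C.1 hu
        exact algHom_ne_C hφ hπC c hc)
      ((map_ne_zero_iff φ hφ).2 hπ.ne_zero)
    have hds : ϖ ∣ φ s := by
      rw [← h, map_mul, mul_assoc]
      exact hd.mul_right _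
    have key : ∀ i, ∃ a, ϖ ∣ φ (X i) - C a := by
      intro i
      obtain ⟨f, hf, r, t, hrt⟩ := hπ.prime.exists_aeval_mem_span_pair hs (X i)
      refine hϖ.prime.exists_dvd_sub_C_of_dvd_aeval hf ?_
      rw [Polynomial.aeval_algHom_apply, hrt, map_add, map_mul, map_mul]
      exact dvd_add (hds.mul_left _) (hd.mul_left _)
    obtain ⟨a₀, h₀⟩ := key 0
    obtain ⟨a₁, h₁⟩ := key 1
    have hdJ := dvd_jac_of_dvd_sub_C h₀ h₁
    have hJ0 := jac_X_ne_zero_of_injective hφ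
    refine hϖ.not_isUnit (isUnit_of_dvd_unit hdJ (isUnit_iff_exists_eq_C.2 ⟨c, ?_, hJ⟩))
    rintro rfl
    exact hJ0 (by rw [hJ, C_0])

lemma linearIndependent_algHom_comp (hφ : Function.Injective φ) {n : ℕ} {e : Fin n → P}
    (he : LinearIndependent (stableImage φ) e) :
    LinearIndependent (stableImage φ) fun i => φ (e i) := by
  rw [Fintype.linearIndependent_iff] at he ⊢
  intro g hg i
  choose c hc hcg using fun i => exists_of_mem_stableImage hφ (g i).2
  have h1 : ∑ i, (⟨c i, hc i⟩ : stableImage φ) • e i = 0 := by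
    apply hφ
    rw [map_sum, map_zero, ← hg]
    refine Finset.sum_congr rfl fun i _ => ?_
    simp only [Algebra.smul_def, map_mul]
    congr 1
    exact hcg i
  have h2 := congrArg Subtype.val (he _ h1 i)
  apply Subtype.ext
  rw [← hcg i, show c i = 0 from h2]
  simp

lemma exists_algHom_mul_eq (hφ : Function.Injective φ) {b₀ b₁ : P} (h₀ : b₀ ∈ stableImage φ)
    (h₁ : b₁ ∈ stableImage φ) (h : jac b₀ b₁ ≠ 0) (v : P) :
    ∃ b s, b ≠ 0 ∧ φ b * v = φ s := by
  classical
  have hinj := bivEval_injective_of_jac_ne_zero h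
  obtain ⟨N, hN⟩ := exists_linear_relation b₀ b₁
  have hmem : ∀ f : Polynomial (Polynomial ℂ), bivEval b₀ b₁ f ∈ stableImage φ := by
    intro f
    rw [bivEval_eq_sum]
    refine sum_mem fun i _ => mul_mem ?_ (pow_mem h₁ i)
    exact Algebra.adjoin_le (Set.singleton_subset_iff.2 h₀)
      (Polynomial.aeval_mem_adjoin_singleton _ _)
  have hbound : ∀ n, (∃ e : Fin n → P, LinearIndependent (stableImage φ) e) → n ≤ N := by
    rintro n ⟨e, he⟩
    by_contra! hlt
    have he' := he.comp (Fin.castLE hlt) (Fin.castLE_injective hlt)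
    obtain ⟨c, hc, hsum⟩ := hN (e ∘ Fin.castLE hlt)
    apply hc
    ext1 i
    apply hinj
    rw [Fintype.linearIndependent_iff] at he'
    have := he' (fun i => ⟨bivEval b₀ b₁ (c i), hmem _⟩) hsum i
    rw [Pi.zero_apply, map_zero]
    exact congrArg Subtype.val this
  set Q : ℕ → Prop := fun n => ∃ e : Fin n → P, LinearIndependent (stableImage φ) e
  obtain ⟨n, ⟨e, he⟩, hmax⟩ : ∃ n, Q n ∧ ∀ m, Q m → m ≤ n := by
    have h0 : Q 0 := ⟨Fin.elim0, linearIndependent_empty_type⟩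
    exact ⟨Nat.findGreatest Q N, Nat.findGreatest_spec (Nat.zero_le N) h0,
      fun m hm => Nat.le_findGreatest (hbound m hm) hm⟩
  have hφe := linearIndependent_algHom_comp hφ he
  have hdep : ¬ LinearIndependent (stableImage φ) (Fin.cons v fun i => φ (e i) : Fin (n + 1) → P) :=
    fun hli => absurd (hmax _ ⟨_, hli⟩) (by omega)
  rw [Fintype.not_linearIndependent_iff] at hdep
  obtain ⟨g, hg, i, hi⟩ := hdep
  rw [Fin.sum_univ_succ] at hg
  simp only [Fin.cons_zero, Fin.cons_succ] at hg
  have hg0 : g 0 ≠ 0 := by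
    intro h0
    rw [h0, zero_smul, zero_add] at hg
    have := Fintype.linearIndependent_iff.1 hφe _ hg
    exact hi (Fin.cases h0 this i)
  choose c hc hcg using fun i => exists_of_mem_stableImage hφ (g i).2
  refine ⟨c 0, -∑ i : Fin n, c i.succ * e i, fun h0 => hg0 ?_, ?_⟩
  · apply Subtype.ext
    rw [← hcg 0, h0]
    simp
  · rw [map_neg, map_sum, eq_neg_iff_add_eq_zero, ← hg]
    simp [hcg, Algebra.smul_def]

theorem X_mem_range_of_jac_ne_zero (hφ : Function.Injective φ) {b₀ b₁ : P}
    (h₀ : b₀ ∈ stableImage φ) (h₁ : b₁ ∈ stableImage φ) (h : jac b₀ b₁ ≠ 0) (i : Fin 2) :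
    X i ∈ φ.range := by
  obtain ⟨c, hc⟩ := exists_jac_eq_C hφ h₀ h₁ h
  obtain ⟨b, s, hb, hbs⟩ := exists_algHom_mul_eq hφ h₀ h₁ h (X i)
  exact mem_range_of_algHom_mul_eq hφ hc hb hbs

end StableImage

section Luroth

open Polynomial in
lemma Polynomial.Bivariate.coeff_coeff_swap {R : Type*} [CommRing R] (F : R[X][X]) (i j : ℕ) :
    ((Polynomial.Bivariate.swap F).coeff i).coeff j = (F.coeff j).coeff i := by
  induction F using Polynomial.induction_on' with
  | add F G hF hG => simp [hF, hG]
  | monomial m f =>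
    induction f using Polynomial.induction_on' with
    | add f g hf hg => simp only [map_add, Polynomial.coeff_add, hf, hg]
    | monomial n a =>
      rw [Polynomial.Bivariate.swap_monomial_monomial]
      simp only [Polynomial.coeff_monomial]
      split_ifs <;> simp_all [Polynomial.coeff_monomial]

variable {k : Type*} [Field k]

lemma Polynomial.eq_zero_of_aeval_eq_zero {a h : Polynomial k} (ha : a.natDegree ≠ 0)
    (h0 : Polynomial.aeval a h = 0) : h = 0 := by
  rw [← Polynomial.comp_eq_aeval, Polynomial.comp_eq_zero_iff] at h0
  refine h0.resolve_right fun h1 => ha ?_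
  rw [h1.2, Polynomial.natDegree_C]

variable [IsAlgClosed k]

/-- A divisor of `h(T) - h(t)` of maximal degree in `t` is a scalar multiple of it. -/
lemma Polynomial.exists_eq_C_C_of_mul_eq {h : Polynomial k} (hh : h.natDegree ≠ 0)
    {f g : Polynomial (Polynomial k)} (hfg : h.map Polynomial.C - Polynomial.C h = f * g) {i : ℕ}
    (hf : (f.coeff i).coeff h.natDegree ≠ 0) :
    ∃ c, c ≠ 0 ∧ g = Polynomial.C (Polynomial.C c) := by
  have hne : f * g ≠ 0 := by
    intro h0
    rw [← hfg] at h0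
    have := congrArg (fun f => (f.coeff 0).coeff h.natDegree) h0
    simp [Polynomial.coeff_C, hh] at this
    rw [this] at hh
    simp at hh
  have hs := congrArg Polynomial.Bivariate.swap hfg
  rw [map_sub, Polynomial.Bivariate.swap_C, Polynomial.Bivariate.swap_map_C, map_mul] at hs
  have hdeg := congrArg Polynomial.natDegree hs
  have hle : (Polynomial.C h - h.map Polynomial.C).natDegree ≤ h.natDegree :=
    (Polynomial.natDegree_sub_le _ _).trans (by simp)
  rw [Polynomial.natDegree_mul
    (by simpa using left_ne_zero_of_mul hne) (by simpa using right_ne_zero_of_mul hne)] at hdeg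
  have hfn : h.natDegree ≤ (Polynomial.Bivariate.swap f).natDegree := by
    apply Polynomial.le_natDegree_of_ne_zero
    intro h0
    apply hf
    rw [← Polynomial.Bivariate.coeff_coeff_swap, h0, Polynomial.coeff_zero]
  have hg0 : (Polynomial.Bivariate.swap g).natDegree = 0 := by omega
  obtain ⟨γ, hγ⟩ := Polynomial.natDegree_eq_zero.1 hg0
  have hg : g = γ.map Polynomial.C := by
    rw [← Polynomial.Bivariate.swap_swap_apply g, ← hγ, Polynomial.Bivariate.swap_C]
  by_cases hγ0 : γ.degree = 0
  · rw [Polynomial.eq_C_of_degree_eq_zero hγ0] at hg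
    rw [Polynomial.map_C] at hg
    refine ⟨_, fun h0 => ?_, hg⟩
    rw [h0] at hg
    simp [hg] at hne
  · exfalso
    obtain ⟨x, hx⟩ := IsAlgClosed.exists_root γ hγ0
    have := congrArg (Polynomial.eval (Polynomial.C x)) hfg
    rw [Polynomial.eval_mul, hg, Polynomial.eval_map, Polynomial.eval₂_at_apply, hx.eq_zero] at this
    simp only [Polynomial.eval_sub, Polynomial.eval_map, Polynomial.eval₂_at_apply,
      Polynomial.eval_C, Polynomial.C_0, mul_zero] at this
    apply hh
    rw [← sub_eq_zero.1 this, Polynomial.natDegree_C]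

lemma Polynomial.exists_forall_exists_eq_aeval {R : Type*} [CommRing R] [IsDomain R] [Algebra k R]
    [IsIntegrallyClosed R] {ρ : R →ₐ[k] Polynomial k} (hρ : Function.Injective ρ) {b : R}
    (hb : (ρ b).natDegree ≠ 0) :
    ∃ p : R, ∀ u : R, ∃ h : Polynomial k, u = Polynomial.aeval p h := by
  let _ : Algebra R (Polynomial k) := ρ.toRingHom.toAlgebra
  have hmap : ∀ r, algebraMap R (Polynomial k) r = ρ r := fun r => rfl
  have : Module.IsTorsionFree R (Polynomial k) :=
    Module.isTorsionFree_iff_algebraMap_injective.2 hρ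
  let t : Polynomial k := Polynomial.X
  have hcomp : (algebraMap R (Polynomial k)).comp (algebraMap k R) = Polynomial.C := by
    ext1 c
    exact ρ.commutes c
  have heval : ∀ u : R, Polynomial.aeval t ((ρ u).map (algebraMap k R) - Polynomial.C u) = 0 := by
    intro u
    rw [map_sub, Polynomial.aeval_C, Polynomial.aeval_def, Polynomial.eval₂_map, hcomp, hmap,
      sub_eq_zero]
    exact Polynomial.eval₂_C_X
  have hint : IsIntegral R t := by
    have hlc := Polynomial.leadingCoeff_ne_zero.2 (show ρ b ≠ 0 from fun h => by simp [h] at hb)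
    refine ⟨Polynomial.C (algebraMap k R (ρ b).leadingCoeff⁻¹) *
      ((ρ b).map (algebraMap k R) - Polynomial.C b), ?_, ?_⟩
    · apply Polynomial.monic_C_mul_of_mul_leadingCoeff_eq_one
      rw [Polynomial.leadingCoeff_sub_of_degree_lt, Polynomial.leadingCoeff_map, ← map_mul,
        inv_mul_cancel₀ hlc, map_one]
      rw [Polynomial.degree_map]
      exact Polynomial.degree_C_le.trans_lt
        (Polynomial.natDegree_pos_iff_degree_pos.1 (Nat.pos_of_ne_zero hb))
    · have := heval b
      rw [Polynomial.aeval_def] at this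
      rw [Polynomial.eval₂_mul, this, mul_zero]
  set f := minpoly R t with hf
  have hfm : f.Monic := minpoly.monic hint
  have hdvd : ∀ u, f ∣ (ρ u).map (algebraMap k R) - Polynomial.C u := fun u =>
    minpoly.isIntegrallyClosed_dvd hint (heval u)
  have hft : Polynomial.aeval t f = 0 := minpoly.aeval R t
  have hfpos : 0 < f.natDegree := minpoly.natDegree_pos hint
  obtain ⟨i, hi⟩ : ∃ i, (ρ (f.coeff i)).natDegree ≠ 0 := by
    by_contra! hall
    have h1 : f.map (algebraMap R (Polynomial k)) =
        (f.map (((Polynomial.evalRingHom (0 : k)).comp (algebraMap R (Polynomial k))))).map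
          Polynomial.C := by
      ext1 i
      rw [Polynomial.coeff_map, Polynomial.coeff_map, Polynomial.coeff_map, hmap,
        Polynomial.eq_C_of_natDegree_eq_zero (hall i)]
      simp [hmap, Polynomial.coeff_zero_eq_eval_zero]
    rw [Polynomial.aeval_def, ← Polynomial.eval_map, h1, Polynomial.eval_map,
      Polynomial.eval₂_C_X] at hft
    exact (hfm.map _).ne_zero hft
  set p := f.coeff i
  refine ⟨p, fun u => ?_⟩
  obtain ⟨g, hg⟩ := hdvd p
  obtain ⟨c, hc, hgc⟩ := Polynomial.exists_eq_C_C_of_mul_eq hi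
    (f := f.map (algebraMap R (Polynomial k))) (g := g.map (algebraMap R (Polynomial k)))
    (i := i) (by
      rw [← Polynomial.map_mul, ← hg, Polynomial.map_sub, Polynomial.map_map, hcomp,
        Polynomial.map_C, hmap])
    (by
      rw [Polynomial.coeff_map, hmap]
      exact Polynomial.leadingCoeff_ne_zero.2 (fun h => by simp [p, h] at hi))
  have hg' : g = Polynomial.C (algebraMap k R c) := by
    apply Polynomial.map_injective _ (show Function.Injective (algebraMap R (Polynomial k)) from hρ)
    rw [hgc, Polynomial.map_C, ← hcomp]
    rfl
  let F : Polynomial (Polynomial k) := Polynomial.C (Polynomial.C c⁻¹) *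
    ((ρ p).map Polynomial.C - Polynomial.C Polynomial.X)
  have hFf : F.map (Polynomial.aeval p : Polynomial k →ₐ[k] R).toRingHom = f := by
    have : (Polynomial.aeval p : Polynomial k →ₐ[k] R).toRingHom.comp Polynomial.C =
        algebraMap k R := by ext; simp
    simp only [F, Polynomial.map_mul, Polynomial.map_sub, Polynomial.map_C, Polynomial.map_map,
      this]
    simp only [AlgHom.toRingHom_eq_coe, RingHom.coe_coe, Polynomial.aeval_C, Polynomial.aeval_X]
    rw [hg, hg', mul_left_comm, ← Polynomial.C_mul, ← map_mul, inv_mul_cancel₀ hc]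
    simp
  have hFm : F.Monic := by
    refine Polynomial.monic_of_injective
      (f := (Polynomial.aeval p : Polynomial k →ₐ[k] R).toRingHom) ?_ (by rwa [hFf])
    refine (injective_iff_map_eq_zero _).2 fun s hs => Polynomial.eq_zero_of_aeval_eq_zero hi ?_
    rw [Polynomial.aeval_algHom_apply]
    exact (congrArg ρ hs).trans (map_zero ρ)
  obtain ⟨w, hw⟩ := hdvd u
  have hmod : (ρ u).map (algebraMap k R) %ₘ f = Polynomial.C u :=
    (Polynomial.div_modByMonic_unique w (Polynomial.C u) hfm
      ⟨by rw [← hw]; ring, Polynomial.degree_C_le.trans_lt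
        (by rwa [← Polynomial.natDegree_pos_iff_degree_pos])⟩).2
  refine ⟨((ρ u).map Polynomial.C %ₘ F).coeff 0, ?_⟩
  have h2 := Polynomial.map_modByMonic (p := (ρ u).map Polynomial.C)
    (Polynomial.aeval p : Polynomial k →ₐ[k] R).toRingHom hFm
  rw [hFf, Polynomial.map_map, show (Polynomial.aeval p : Polynomial k →ₐ[k] R).toRingHom.comp
    Polynomial.C = algebraMap k R by ext; simp, hmod] at h2
  have h3 := congrArg (fun f => f.coeff 0) h2
  simpa using h3.symm

end Luroth

section jacKer

/-- The kernel of the Jacobian derivation of `b`. -/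
noncomputable def jacKer (b : P) : Subalgebra ℂ P where
  carrier := {u | jac b u = 0}
  mul_mem' := fun {u v} hu hv => by simp_all
  add_mem' := fun {u v} hu hv => by simp_all
  algebraMap_mem' := fun c => jac_C b c

lemma mem_jacKer {b u : P} : u ∈ jacKer b ↔ jac b u = 0 := Iff.rfl

lemma mem_jacKer_of_mul_mem {b a u : P} (ha0 : a ≠ 0) (ha : a ∈ jacKer b)
    (hau : a * u ∈ jacKer b) : u ∈ jacKer b := by
  rw [mem_jacKer] at *
  rw [Derivation.leibniz, ha, smul_zero, add_zero] at hau
  exact (smul_eq_zero.1 hau).resolve_left ha0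

lemma IsIntegrallyClosed.of_exists_algebraMap_eq {R S : Type*} [CommRing R] [IsDomain R]
    [CommRing S] [IsDomain S] [Algebra R S] [FaithfulSMul R S] [IsIntegrallyClosed S]
    (h : ∀ (s a : R) (y : S), s ≠ 0 → algebraMap R S a = algebraMap R S s * y →
      ∃ r, algebraMap R S r = y) : IsIntegrallyClosed R := by
  let K := FractionRing R
  let L := FractionRing S
  let _ : Algebra K L := FractionRing.liftAlgebra R L
  rw [isIntegrallyClosed_iff K]
  intro x hx
  obtain ⟨a, s, hs, rfl⟩ := IsFractionRing.div_surjective (A := R) x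
  have hs0 : s ≠ 0 := nonZeroDivisors.ne_zero hs
  have h1 : IsIntegral S (algebraMap K L (algebraMap R K a / algebraMap R K s)) :=
    (hx.map (IsScalarTower.toAlgHom R K L)).tower_top
  obtain ⟨y, hy⟩ := IsIntegrallyClosed.isIntegral_iff.1 h1
  have hsK : algebraMap R K s ≠ 0 := by simpa using hs0
  have h2 : algebraMap R S a = algebraMap R S s * y := by
    apply IsFractionRing.injective S L
    rw [map_mul, hy, ← IsScalarTower.algebraMap_apply, ← IsScalarTower.algebraMap_apply,
      IsScalarTower.algebraMap_apply R K L a, IsScalarTower.algebraMap_apply R K L s, ← map_mul,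
      mul_div_cancel₀ _ hsK]
  obtain ⟨r, rfl⟩ := h s a y hs0 h2
  refine ⟨r, ?_⟩
  rw [eq_div_iff hsK, ← map_mul]
  congr 1
  apply FaithfulSMul.algebraMap_injective R S
  rw [h2, map_mul, mul_comm]

instance (b : P) : IsIntegrallyClosed (jacKer b) :=
  .of_exists_algebraMap_eq (S := P) fun s a y hs h =>
    ⟨⟨y, mem_jacKer_of_mul_mem (fun h0 => hs (Subtype.ext h0)) s.2 (h ▸ a.2)⟩, rfl⟩

/-- The kernel of the Jacobian derivation of a nonconstant polynomial is a polynomial ring in one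
variable. -/
theorem exists_jacKer_eq_aeval {b : P} (hb : ∀ c, b ≠ C c) :
    ∃ p : P, ∀ u, jac b u = 0 ↔ ∃ h : Polynomial ℂ, u = Polynomial.aeval p h := by
  obtain ⟨v, hv⟩ : ∃ v, eval v b ≠ eval 0 b := by
    by_contra! h
    exact hb (eval 0 b) (MvPolynomial.funext fun v => by rw [h, eval_C])
  let ρ : P →ₐ[ℂ] Polynomial ℂ := aeval fun i => Polynomial.C (v i) * Polynomial.X
  have hρb : (ρ b).natDegree ≠ 0 := by
    intro h
    have h1 : ∀ x, Polynomial.eval x (ρ b) = eval (x • v) b := by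
      intro x
      have : (Polynomial.aeval x).comp ρ = (aeval (x • v) : P →ₐ[ℂ] ℂ) := by
        ext i
        rw [AlgHom.comp_apply, aeval_X, aeval_X, map_mul, Polynomial.aeval_C, Polynomial.aeval_X]
        exact mul_comm _ _
      simpa [Polynomial.coe_aeval_eq_eval, MvPolynomial.coe_aeval_eq_eval] using
        DFunLike.congr_fun this b
    apply hv
    have h2 := h1 1
    rw [Polynomial.eq_C_of_natDegree_eq_zero h, Polynomial.eval_C] at h2
    have h3 := h1 0
    rw [Polynomial.eq_C_of_natDegree_eq_zero h, Polynomial.eval_C, h2] at h3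
    simpa using h3
  have hρ : Function.Injective (ρ.comp (jacKer b).val) := by
    rw [injective_iff_map_eq_zero]
    rintro ⟨u, hu⟩ hu0
    replace hu0 : ρ u = 0 := hu0
    by_contra hne
    replace hne : u ≠ 0 := fun h => hne (Subtype.ext h)
    have hninj : ¬ Function.Injective (bivEval (k := ℂ) b u) :=
      fun h => jac_ne_zero_of_bivEval_injective h hu
    rw [injective_iff_map_eq_zero] at hninj
    push Not at hninj
    obtain ⟨F, hF0, hF⟩ := hninj
    obtain ⟨G, hFG, hG⟩ := Polynomial.exists_eq_pow_rootMultiplicity_mul_and_not_dvd F hF 0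
    rw [map_zero, sub_zero] at hFG hG
    rw [hFG, map_mul, map_pow, bivEval_X] at hF0
    have h1 := congrArg ρ ((mul_eq_zero.1 hF0).resolve_left (pow_ne_zero _ hne))
    rw [map_bivEval, hu0, ← Polynomial.divX_mul_X_add G, map_add, map_mul, bivEval_X, bivEval_C,
      mul_zero, zero_add, map_zero] at h1
    exact hG (Polynomial.X_dvd_iff.2 (Polynomial.eq_zero_of_aeval_eq_zero hρb h1))
  obtain ⟨⟨p, hp⟩, hall⟩ := Polynomial.exists_forall_exists_eq_aeval hρ (b := ⟨b, jac_self b⟩) hρb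
  refine ⟨p, fun u => ⟨fun hu => ?_, ?_⟩⟩
  · obtain ⟨h, hh⟩ := hall ⟨u, hu⟩
    refine ⟨h, ?_⟩
    have := congrArg (jacKer b).val hh
    rwa [← Polynomial.aeval_algHom_apply] at this
  · rintro ⟨h, rfl⟩
    rw [Derivation.map_aeval, mem_jacKer.1 hp, smul_zero]

end jacKer

section Semiinvariant

variable {φ : P →ₐ[ℂ] P}

lemma exists_jac_ne_zero {p : P} (hp : ∀ c, p ≠ C c) : ∃ v, jac p v ≠ 0 := by
  by_contra! h
  obtain ⟨c, hc⟩ := eq_C_of_jac_X_eq_zero fun i => h (X i)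
  exact hp c hc

lemma eq_zero_of_aeval_eq_zero {p : P} (hp : ∀ c, p ≠ C c) {h : Polynomial ℂ}
    (h0 : Polynomial.aeval p h = 0) : h = 0 := by
  obtain ⟨v, hv⟩ := exists_jac_ne_zero hp
  have := (injective_iff_map_eq_zero _).1 (bivEval_injective_of_jac_ne_zero hv) (Polynomial.C h)
    (by rw [bivEval_C, h0])
  exact Polynomial.C_eq_zero.1 this

/-- If the stable image is nontrivial and consists of pairwise dependent polynomials, there is a
generator of the kernel of a Jacobian derivation on which `φ` acts as an affine substitution. -/
theorem exists_algHom_eq_affine (hφ : Function.Injective φ)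
    (hB : ∀ b ∈ stableImage φ, ∀ b' ∈ stableImage φ, jac b b' = 0) {b₀ : P}
    (hb₀ : b₀ ∈ stableImage φ) (hbC : ∀ c, b₀ ≠ C c) :
    ∃ p : P, (∀ c, p ≠ C c) ∧ (∀ u, jac p u = 0 → ∃ h : Polynomial ℂ, u = Polynomial.aeval p h) ∧
      ∃ a b : ℂ, a ≠ 0 ∧ φ p = C a * p + C b := by
  obtain ⟨p, hp⟩ := exists_jacKer_eq_aeval hbC
  have hbp : jac b₀ p = 0 := (hp p).2 ⟨Polynomial.X, by simp⟩
  have hpC : ∀ c, p ≠ C c := by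
    rintro c rfl
    obtain ⟨h, hh⟩ := (hp b₀).1 (jac_self b₀)
    refine hbC (h.eval c) ?_
    rw [hh, ← MvPolynomial.algebraMap_eq, Polynomial.aeval_algebraMap_apply,
      Polynomial.coe_aeval_eq_eval]
  refine ⟨p, hpC, fun u hu => (hp u).1 (jac_eq_zero_trans hpC hbp hu), ?_⟩
  obtain ⟨c₀, hc₀, hcb⟩ := exists_of_mem_stableImage hφ hb₀
  have hφp : jac b₀ (φ p) = 0 := by
    rw [← hcb, jac_algHom, jac_eq_zero_trans hbC (hB _ hc₀ _ hb₀) hbp, map_zero, zero_mul]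
  obtain ⟨u, hu⟩ := (hp _).1 hφp
  have hu0 : u.natDegree ≠ 0 := by
    intro h0
    rw [Polynomial.eq_C_of_natDegree_eq_zero h0, Polynomial.aeval_C] at hu
    exact algHom_ne_C hφ hpC _ hu
  have key : ∀ n, ∀ b ∈ stableImage φ, (∀ c, b ≠ C c) → ∀ h : Polynomial ℂ,
      b = Polynomial.aeval p h → h.natDegree = n → u.natDegree = 1 := by
    intro n
    induction n using Nat.strong_induction_on with
    | _ n ih =>
      rintro b hb hbC h hbh hn
      obtain ⟨c, hc, rfl⟩ := exists_of_mem_stableImage hφ hb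
      have hcC : ∀ x, c ≠ C x := fun x hx => hbC x (by rw [hx, algHom_map_C])
      obtain ⟨g, hg⟩ := (hp c).1 (hB _ hb₀ _ hc)
      have hcomp : h = g.comp u := by
        rw [← sub_eq_zero]
        apply eq_zero_of_aeval_eq_zero hpC
        rw [map_sub, Polynomial.aeval_comp, ← hbh, ← hu, hg, Polynomial.aeval_algHom_apply,
          sub_self]
      have hdeg : n = g.natDegree * u.natDegree := by
        rw [← hn, hcomp, Polynomial.natDegree_comp]
      have hg0 : g.natDegree ≠ 0 := by
        intro h0
        rw [Polynomial.eq_C_of_natDegree_eq_zero h0, Polynomial.aeval_C] at hg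
        exact hcC _ hg
      by_contra h1
      refine h1 (ih _ ?_ c hc hcC g hg rfl)
      rw [hdeg]
      exact lt_mul_of_one_lt_right (by omega) (by omega)
  obtain ⟨h, hh⟩ := (hp b₀).1 (jac_self b₀)
  have hu1 := key _ b₀ hb₀ hbC h hh rfl
  obtain ⟨a, ha, b, hab⟩ := Polynomial.natDegree_eq_one.1 hu1
  refine ⟨a, b, ha, ?_⟩
  rw [hu, ← hab]
  simp [MvPolynomial.algebraMap_eq]

lemma pow_succ_apply (φ : P →ₐ[ℂ] P) (k : ℕ) (u : P) : (φ ^ (k + 1)) u = φ ((φ ^ k) u) := by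
  rw [pow_succ']
  rfl

lemma injective_pow (hφ : Function.Injective φ) (k : ℕ) :
    Function.Injective (φ ^ k : P →ₐ[ℂ] P) := by
  induction k with
  | zero => exact fun _ _ h => h
  | succ k ih =>
    intro u v h
    rw [pow_succ_apply, pow_succ_apply] at h
    exact ih (hφ h)

lemma exists_pow_eq_affine {p : P} {a b : ℂ} (ha : a ≠ 0) (hp : φ p = C a * p + C b) (k : ℕ) :
    ∃ a b : ℂ, a ≠ 0 ∧ (φ ^ k) p = C a * p + C b := by
  induction k with
  | zero => exact ⟨1, 0, one_ne_zero, by simp⟩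
  | succ k ih =>
    obtain ⟨a', b', ha', h⟩ := ih
    refine ⟨a' * a, a' * b + b', mul_ne_zero ha' ha, ?_⟩
    rw [pow_succ_apply, h, map_add, map_mul, algHom_map_C, algHom_map_C, hp]
    simp only [map_mul, map_add]
    ring

lemma totalDegree_pow_jac_le (hφ : Function.Injective φ) {p : P} {a b : ℂ} (ha : a ≠ 0)
    (hp : φ p = C a * p + C b) (k : ℕ) (u : P) :
    ((φ ^ k) (jac p u)).totalDegree ≤ p.totalDegree + ((φ ^ k) u).totalDegree := by
  obtain ⟨a', b', ha', h⟩ := exists_pow_eq_affine ha hp k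
  have h1 := jac_algHom (φ ^ k) p u
  have h2 : jac (C a' * p + C b') ((φ ^ k) u) = C a' * jac p ((φ ^ k) u) := by
    rw [jac_comm, map_add, jac_C, Derivation.leibniz, jac_C, jac_comm p]
    simp
  rw [h, h2] at h1
  by_cases h0 : jac p u = 0
  · simp [h0]
  have h3 : (φ ^ k) (jac p u) ≠ 0 := (map_ne_zero_iff _ (injective_pow hφ k)).2 h0
  have h4 : jac ((φ ^ k) (X 0)) ((φ ^ k) (X 1)) ≠ 0 :=
    jac_X_ne_zero_of_injective (injective_pow hφ k)
  have h5 : jac p ((φ ^ k) u) ≠ 0 := by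
    intro h5
    rw [h5, mul_zero] at h1
    exact mul_ne_zero h3 h4 h1.symm
  have h6 := totalDegree_jac_lt h5
  have h7 := congrArg totalDegree h1
  rw [totalDegree_mul_of_isDomain h3 h4, totalDegree_mul_of_isDomain (by simpa using ha') h5,
    totalDegree_C] at h7
  omega

lemma totalDegree_algHom_le (ψ : P →ₐ[ℂ] P) (q : P) :
    (ψ q).totalDegree ≤ q.totalDegree * ((ψ (X 0)).totalDegree + (ψ (X 1)).totalDegree) := by
  conv_lhs => rw [q.as_sum, map_sum]
  refine totalDegree_finsetSum_le fun m hm => ?_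
  have h1 : ψ (monomial m (q.coeff m)) = C (q.coeff m) * (ψ (X 0) ^ m 0 * ψ (X 1) ^ m 1) := by
    rw [monomial_eq, map_mul, algHom_map_C, Finsupp.prod_fintype _ _ (by simp)]
    simp
  have h2 := le_totalDegree hm
  have h3 : (m.sum fun _ e => e) = m 0 + m 1 := by
    rw [Finsupp.sum_fintype _ _ (by simp)]
    simp
  rw [h3] at h2
  rw [h1]
  refine (totalDegree_mul _ _).trans ?_
  rw [totalDegree_C, zero_add]
  refine (totalDegree_mul _ _).trans ?_
  refine (add_le_add (totalDegree_pow _ _) (totalDegree_pow _ _)).trans ?_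
  nlinarith [Nat.zero_le (m 1 * (ψ (X 0)).totalDegree), Nat.zero_le (m 0 * (ψ (X 1)).totalDegree),
    Nat.mul_le_mul_right ((ψ (X 0)).totalDegree + (ψ (X 1)).totalDegree) h2]

/-- If the degrees of the iterates of `u` under `φ` are bounded, then `u` is in the image of `φ`. -/
lemma mem_range_of_totalDegree_pow_le (hφ : Function.Injective φ) {u : P} {n : ℕ}
    (h : ∀ k, ((φ ^ k) u).totalDegree ≤ n) : u ∈ φ.range := by
  let W : Submodule ℂ P := Submodule.span ℂ (Set.range fun k : ℕ => (φ ^ k) u)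
  have hW : W ≤ restrictTotalDegree (Fin 2) ℂ n := by
    refine Submodule.span_le.2 ?_
    rintro _ ⟨k, rfl⟩
    exact (mem_restrictTotalDegree _ _ _).2 (h k)
  have : Module.Finite ℂ W := Module.Finite.of_injective _ (Submodule.inclusion_injective hW)
  have hmaps : ∀ w ∈ W, φ.toLinearMap w ∈ W := by
    intro w hw
    refine Submodule.span_induction ?_ (by simp) (fun x y _ _ hx hy => ?_) (fun c x _ hx => ?_) hw
    · rintro _ ⟨k, rfl⟩
      exact Submodule.subset_span ⟨k + 1, pow_succ_apply φ k u⟩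
    · rw [map_add]; exact add_mem hx hy
    · rw [map_smul]; exact W.smul_mem c hx
  have hsurj : Function.Surjective (φ.toLinearMap.restrict hmaps) := by
    apply LinearMap.surjective_of_injective
    intro x y hxy
    exact Subtype.ext (hφ (congrArg Subtype.val hxy))
  obtain ⟨w, hw⟩ := hsurj ⟨u, Submodule.subset_span ⟨0, rfl⟩⟩
  exact ⟨w, congrArg Subtype.val hw⟩

end Semiinvariant

section DegreeLimit

open Filter Topology

/-- The properties of a limit of the normalized degrees `deg (φ ^ k u) / deg (φ ^ k)` for an
endomorphism `φ` which has `p` as a semi-invariant. -/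
structure IsDegreeLimit (p : P) (ν : P → ℝ) : Prop where
  nonneg : ∀ u, 0 ≤ ν u
  map_mul : ∀ u v, u ≠ 0 → v ≠ 0 → ν (u * v) = ν u + ν v
  map_add_le : ∀ u v, ν (u + v) ≤ max (ν u) (ν v)
  map_C : ∀ c, ν (C c) = 0
  map_self : ν p = 0
  exists_pos : ∃ i, 0 < ν (X i)
  map_jac_le : ∀ u, ν (jac p u) ≤ ν u

theorem exists_isDegreeLimit {φ : P →ₐ[ℂ] P} (hφ : Function.Injective φ) {p : P} {a b : ℂ}
    (ha : a ≠ 0) (hp : φ p = C a * p + C b) (hX : X 0 ∉ φ.range) :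
    ∃ ν : P → ℝ, IsDegreeLimit p ν := by
  set M : ℕ → ℕ := fun k => ((φ ^ k) (X 0)).totalDegree + ((φ ^ k) (X 1)).totalDegree with hM
  have hunb : ∀ n, ∃ k, n < M k := by
    intro n
    by_contra! h
    exact hX (mem_range_of_totalDegree_pow_le hφ (n := n) fun k =>
      (Nat.le_add_right _ _).trans (h k))
  have : (comap M atTop).NeBot := by
    refine comap_neBot fun t ht => ?_
    obtain ⟨n, hn⟩ := mem_atTop_sets.1 ht
    obtain ⟨k, hk⟩ := hunb n
    exact ⟨k, hn _ hk.le⟩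
  let U : Ultrafilter ℕ := Ultrafilter.of (comap M atTop)
  have hU : Tendsto M U atTop := tendsto_comap.mono_left (Ultrafilter.of_le _)
  have hUR : Tendsto (fun k => (M k : ℝ)) U atTop := tendsto_natCast_atTop_atTop.comp hU
  have hpos : ∀ᶠ k in (U : Filter ℕ), (0 : ℝ) < M k := hUR.eventually_gt_atTop 0
  have hex : ∀ q : P, ∃ x : ℝ,
      Tendsto (fun k => (((φ ^ k) q).totalDegree : ℝ) / M k) U (𝓝 x) := by
    intro q
    have hI : ∀ k, (((φ ^ k) q).totalDegree : ℝ) / M k ∈ Set.Icc (0 : ℝ) q.totalDegree := by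
      intro k
      refine ⟨by positivity, div_le_of_le_mul₀ (by positivity) (by positivity) ?_⟩
      exact_mod_cast totalDegree_algHom_le (φ ^ k) q
    obtain ⟨x, -, hx⟩ := isCompact_Icc.ultrafilter_le_nhds
      (U.map fun k => (((φ ^ k) q).totalDegree : ℝ) / M k)
      (le_principal_iff.2 (Ultrafilter.mem_map.2 (univ_mem' hI)))
    exact ⟨x, hx⟩
  choose ν hν using hex
  have hbdd : ∀ (q : P) (n : ℕ), (∀ k, ((φ ^ k) q).totalDegree ≤ n) → ν q = 0 := by
    intro q n h
    refine tendsto_nhds_unique (hν q) ?_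
    refine squeeze_zero (fun k => by positivity) (fun k => ?_)
      (hUR.const_div_atTop (n : ℝ))
    gcongr
    exact h k
  refine ⟨ν, ?_, ?_, ?_, ?_, ?_, ?_, ?_⟩
  · exact fun u => ge_of_tendsto' (hν u) fun k => by positivity
  · intro u v hu hv
    refine tendsto_nhds_unique (hν _) (((hν u).add (hν v)).congr fun k => ?_)
    have hk := injective_pow hφ k
    rw [map_mul, totalDegree_mul_of_isDomain ((map_ne_zero_iff _ hk).2 hu)
      ((map_ne_zero_iff _ hk).2 hv)]
    push_cast
    ring
  · intro u v
    refine le_of_tendsto_of_tendsto' (hν _) ((hν u).max (hν v)) fun k => ?_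
    rw [max_div_div_right (by positivity)]
    gcongr
    rw [map_add]
    exact_mod_cast totalDegree_add _ _
  · exact fun c => hbdd _ 0 fun k => by rw [algHom_map_C, totalDegree_C]
  · refine hbdd p p.totalDegree fun k => ?_
    obtain ⟨a', b', -, h⟩ := exists_pow_eq_affine ha hp k
    rw [h]
    refine (totalDegree_add _ _).trans (max_le ((totalDegree_mul _ _).trans ?_) ?_) <;> simp
  · have h1 : ν (X 0) + ν (X 1) = 1 := by
      refine tendsto_nhds_unique ((hν (X 0)).add (hν (X 1))) (tendsto_const_nhds.congr' ?_)
      filter_upwards [hpos] with k hk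
      rw [← add_div, eq_comm, div_eq_one_iff_eq hk.ne']
      simp [hM]
    by_contra! h
    linarith [h 0, h 1]
  · intro u
    have h0 := (hUR.const_div_atTop (p.totalDegree : ℝ)).add (hν u)
    rw [zero_add] at h0
    refine le_of_tendsto_of_tendsto' (hν _) h0 fun k => ?_
    rw [← add_div]
    gcongr
    exact_mod_cast totalDegree_pow_jac_le hφ ha hp k u

end DegreeLimit

section opEval

/-- The differential operator obtained from a polynomial by substituting `p` for the inner and the
derivation `jac p` for the outer variable. -/
noncomputable def opEval (p : P) : Polynomial (Polynomial ℂ) →+* Module.End ℂ P :=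
  Polynomial.eval₂RingHom'
    ((Algebra.lmul ℂ P).toRingHom.comp (Polynomial.aeval p : Polynomial ℂ →ₐ[ℂ] P).toRingHom)
    (jac p).toLinearMap fun h => LinearMap.ext fun u => by simp

variable {p : P}

@[simp]
lemma opEval_C_apply (h : Polynomial ℂ) (u : P) :
    opEval p (Polynomial.C h) u = Polynomial.aeval p h * u := by
  simp [opEval]

@[simp]
lemma opEval_X_apply (u : P) : opEval p Polynomial.X u = jac p u := by
  simp [opEval]

lemma opEval_X_pow_apply (n : ℕ) (u : P) : opEval p (Polynomial.X ^ n) u = (jac p)^[n] u := by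
  induction n with
  | zero => simp
  | succ n ih =>
    rw [pow_succ', map_mul, Module.End.mul_apply, ih, opEval_X_apply, Function.iterate_succ_apply']

lemma opEval_apply_eq_sum {g : Polynomial (Polynomial ℂ)} {n : ℕ} (hn : g.natDegree < n) (u : P) :
    opEval p g u = ∑ i ∈ Finset.range n, Polynomial.aeval p (g.coeff i) * (jac p)^[i] u := by
  conv_lhs => rw [g.as_sum_range_C_mul_X_pow' hn]
  simp [LinearMap.sum_apply, -map_pow, opEval_X_pow_apply]

lemma opEval_mul_apply (f g : Polynomial (Polynomial ℂ)) (u : P) :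
    opEval p (f * g) u = opEval p f (opEval p g u) := by
  rw [map_mul, Module.End.mul_apply]

end opEval

namespace IsDegreeLimit

variable {p : P} {ν : P → ℝ}

lemma map_zero (hν : IsDegreeLimit p ν) : ν 0 = 0 := by
  simpa using hν.map_C 0

lemma map_mul_le (hν : IsDegreeLimit p ν) (u v : P) : ν (u * v) ≤ ν u + ν v := by
  by_cases hu : u = 0
  · rw [hu, zero_mul]; linarith [hν.nonneg v]
  by_cases hv : v = 0
  · rw [hv, mul_zero]; linarith [hν.nonneg u]
  exact (hν.map_mul u v hu hv).le

lemma map_pow (hν : IsDegreeLimit p ν) {u : P} (hu : u ≠ 0) (n : ℕ) : ν (u ^ n) = n * ν u := by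
  induction n with
  | zero => simpa using hν.map_C 1
  | succ n ih =>
    rw [pow_succ, hν.map_mul _ _ (pow_ne_zero n hu) hu, ih]
    push_cast
    ring

lemma map_pow_le (hν : IsDegreeLimit p ν) (u : P) (n : ℕ) : ν (u ^ n) ≤ n * ν u := by
  induction n with
  | zero => simpa using (hν.map_C 1).le
  | succ n ih =>
    rw [pow_succ]
    push_cast
    linarith [hν.map_mul_le (u ^ n) u]

lemma map_neg (hν : IsDegreeLimit p ν) (u : P) : ν (-u) = ν u := by
  have h : ∀ u, ν (-u) ≤ ν u := fun u => by
    have := hν.map_mul_le (C (-1)) u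
    rw [hν.map_C] at this
    simpa using this
  exact le_antisymm (h u) (by simpa using h (-u))

lemma map_sum_le (hν : IsDegreeLimit p ν) {ι : Type*} (s : Finset ι) (f : ι → P) {x : ℝ}
    (hx : 0 ≤ x) (h : ∀ i ∈ s, ν (f i) ≤ x) : ν (∑ i ∈ s, f i) ≤ x := by
  classical
  induction s using Finset.induction_on with
  | empty => rwa [Finset.sum_empty, hν.map_zero]
  | insert i s hi ih =>
    rw [Finset.sum_insert hi]
    exact (hν.map_add_le _ _).trans (max_le (h i (Finset.mem_insert_self i s))
      (ih fun j hj => h j (Finset.mem_insert_of_mem hj)))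

lemma map_aeval (hν : IsDegreeLimit p ν) {u : P} (hu : ν u = 0) (h : Polynomial ℂ) :
    ν (Polynomial.aeval u h) = 0 := by
  refine le_antisymm ?_ (hν.nonneg _)
  rw [Polynomial.aeval_eq_sum_range]
  refine hν.map_sum_le _ _ le_rfl fun i _ => ?_
  rw [smul_eq_C_mul]
  refine (hν.map_mul_le _ _).trans ?_
  have := hν.map_pow_le u i
  rw [hu, mul_zero] at this
  rw [hν.map_C, zero_add]
  exact this

lemma map_bivEval (hν : IsDegreeLimit p ν) {u : P} (hu : ν u = 0)
    (h : Polynomial (Polynomial ℂ)) : ν (bivEval p u h) = 0 := by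
  refine le_antisymm ?_ (hν.nonneg _)
  rw [bivEval_eq_sum]
  refine hν.map_sum_le _ _ le_rfl fun i _ => ?_
  have h1 := hν.map_pow_le u i
  rw [hu, mul_zero] at h1
  have h2 := hν.map_mul_le (Polynomial.aeval p (h.coeff i)) (u ^ i)
  rw [hν.map_aeval hν.map_self] at h2
  linarith

/-- In a relation of the form `∑ θ ^ j * u j = 0`, the leading term cannot dominate. -/
lemma le_of_sum_eq_zero (hν : IsDegreeLimit p ν) {θ : P} (hθ : 0 < ν θ) {n : ℕ} {u : ℕ → P}
    (hsum : ∑ j ∈ Finset.range (n + 1), θ ^ j * u j = 0) (hu : u n ≠ 0) {x : ℝ} (hx : 0 ≤ x)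
    (hux : ∀ j, ν (u j) ≤ x) : ν (u n) ≤ x - ν θ := by
  have hθ0 : θ ≠ 0 := by
    rintro rfl
    exact hθ.ne' hν.map_zero
  rw [Finset.sum_range_succ, add_comm, add_eq_zero_iff_eq_neg] at hsum
  have h1 : ν (θ ^ n * u n) ≤ (n - 1) * ν θ + x := by
    rw [hsum, hν.map_neg]
    rcases Nat.eq_zero_or_pos n with rfl | hn
    · exfalso
      simp at hsum
      exact hu hsum
    have hn' : (1 : ℝ) ≤ n := by exact_mod_cast hn
    refine hν.map_sum_le _ _ ?_ fun j hj => ?_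
    · nlinarith
    refine (hν.map_mul_le _ _).trans (add_le_add ?_ (hux j))
    rw [hν.map_pow hθ0]
    have : (j : ℝ) ≤ n - 1 := by
      rw [le_sub_iff_add_le]
      exact_mod_cast Finset.mem_range.1 hj
    exact mul_le_mul_of_nonneg_right this hθ.le
  rw [hν.map_mul _ _ (pow_ne_zero _ hθ0) hu, hν.map_pow hθ0] at h1
  linarith

lemma jac_eq_zero (hν : IsDegreeLimit p ν) {u : P} (hu : ν u = 0) : jac p u = 0 := by
  by_contra h
  have hinj := bivEval_injective_of_jac_ne_zero h
  obtain ⟨i, hi⟩ := hν.exists_pos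
  obtain ⟨F, hF, h0⟩ := exists_polynomial_eval₂_bivEval_eq_zero p u (X i)
  rw [Polynomial.eval₂_eq_sum_range] at h0
  have h1 := hν.le_of_sum_eq_zero hi (u := fun j => bivEval p u (F.coeff j)) (x := 0)
    (by simpa only [mul_comm] using h0)
    ((map_ne_zero_iff _ hinj).2 (Polynomial.leadingCoeff_ne_zero.2 hF)) le_rfl
    fun j => (hν.map_bivEval hu _).le
  rw [hν.map_bivEval hu] at h1
  linarith

lemma map_iterate_jac_le (hν : IsDegreeLimit p ν) (u : P) (n : ℕ) : ν ((jac p)^[n] u) ≤ ν u := by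
  induction n with
  | zero => exact le_rfl
  | succ n ih =>
    rw [Function.iterate_succ_apply']
    exact (hν.map_jac_le _).trans ih

lemma map_opEval_le (hν : IsDegreeLimit p ν) (g : Polynomial (Polynomial ℂ)) (u : P) :
    ν (opEval p g u) ≤ ν u := by
  rw [opEval_apply_eq_sum (Nat.lt_succ_self _)]
  refine hν.map_sum_le _ _ (hν.nonneg u) fun i _ => (hν.map_mul_le _ _).trans ?_
  rw [hν.map_aeval hν.map_self, zero_add]
  exact hν.map_iterate_jac_le u i

/-- Every polynomial is annihilated by a nonzero differential operator. -/
theorem exists_opEval_eq_zero (hν : IsDegreeLimit p ν) (u : P) :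
    ∃ g, g ≠ 0 ∧ opEval p g u = 0 := by
  obtain ⟨i₀, hθ⟩ := hν.exists_pos
  set θ : P := X i₀
  obtain ⟨N, hN⟩ := exists_linear_relation p θ
  have key : ∀ u : P, ∃ g, g ≠ 0 ∧ (opEval p g u = 0 ∨ ν (opEval p g u) ≤ ν u - ν θ) := by
    intro u
    obtain ⟨c, hc, hsum⟩ := hN fun i => (jac p)^[i] u
    set G : Polynomial (Polynomial (Polynomial ℂ)) :=
      ∑ i, (c i).map Polynomial.C * Polynomial.C (Polynomial.X ^ (i : ℕ)) with hG
    have hcoeff : ∀ j, G.coeff j =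
        ∑ i, Polynomial.C ((c i).coeff j) * Polynomial.X ^ (i : ℕ) := by
      intro j
      simp only [hG, Polynomial.finsetSum_coeff, Polynomial.coeff_mul_C, Polynomial.coeff_map]
    have hcoeff2 : ∀ (j : ℕ) (i : Fin (N + 1)), (G.coeff j).coeff i = (c i).coeff j := by
      intro j i
      rw [hcoeff, Polynomial.finsetSum_coeff]
      simp only [Polynomial.coeff_C_mul_X_pow, Fin.val_inj]
      simp
    have hG0 : G ≠ 0 := by
      intro h
      apply hc
      ext i j : 2
      rw [← hcoeff2, h]
      simp
    have hdeg : ∀ i, (c i).natDegree < G.natDegree + 1 := by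
      intro i
      rw [Nat.lt_succ_iff, Polynomial.natDegree_le_iff_coeff_eq_zero]
      intro j hj
      rw [← hcoeff2, Polynomial.coeff_eq_zero_of_natDegree_lt hj, Polynomial.coeff_zero]
    have hrel : ∑ j ∈ Finset.range (G.natDegree + 1), θ ^ j * opEval p (G.coeff j) u = 0 := by
      rw [← hsum]
      have h1 : ∀ i, bivEval p θ (c i) = ∑ j ∈ Finset.range (G.natDegree + 1),
          Polynomial.aeval p ((c i).coeff j) * θ ^ j := by
        intro i
        conv_lhs => rw [(c i).as_sum_range_C_mul_X_pow' (hdeg i)]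
        simp
      simp only [h1, hcoeff, map_sum, LinearMap.sum_apply, opEval_mul_apply, opEval_C_apply,
        opEval_X_pow_apply, Finset.mul_sum, Finset.sum_mul]
      rw [Finset.sum_comm]
      exact Finset.sum_congr rfl fun i _ => Finset.sum_congr rfl fun j _ => by ring
    refine ⟨G.coeff G.natDegree, Polynomial.leadingCoeff_ne_zero.2 hG0, ?_⟩
    by_cases h0 : opEval p (G.coeff G.natDegree) u = 0
    · exact Or.inl h0
    · exact Or.inr (hν.le_of_sum_eq_zero hθ hrel h0 (hν.nonneg u) fun j => hν.map_opEval_le _ _)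
  have main : ∀ (m : ℕ) (u : P), ν u < m * ν θ → ∃ g, g ≠ 0 ∧ opEval p g u = 0 := by
    intro m
    induction m with
    | zero =>
      intro u hu
      rw [Nat.cast_zero, zero_mul] at hu
      exact absurd hu (hν.nonneg u).not_gt
    | succ m ih =>
      intro u hu
      obtain ⟨g, hg, h | h⟩ := key u
      · exact ⟨g, hg, h⟩
      · push_cast at hu
        obtain ⟨f, hf, h1⟩ := ih (opEval p g u) (by linarith)
        exact ⟨f * g, mul_ne_zero hf hg, by rw [opEval_mul_apply, h1]⟩
  obtain ⟨m, hm⟩ := exists_nat_gt (ν u / ν θ)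
  exact main m u ((div_lt_iff₀ hθ).1 hm)

end IsDegreeLimit

section Darboux

variable {p : P}

lemma IsDegreeLimit.prime_sub_C {ν : P → ℝ} (hν : IsDegreeLimit p ν) (hp : ∀ c, p ≠ C c)
    (hker : ∀ u, jac p u = 0 → ∃ h : Polynomial ℂ, u = Polynomial.aeval p h) (z : ℂ) :
    Prime (p - C z) := by
  have h0 : p - C z ≠ 0 := fun h => hp z (sub_eq_zero.1 h)
  rw [← UniqueFactorizationMonoid.irreducible_iff_prime]
  refine ⟨fun h => ?_, fun {a b} hab => ?_⟩
  · obtain ⟨c, -, hc⟩ := isUnit_iff_exists_eq_C.1 h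
    exact hp (c + z) (by rw [C_add, ← hc, sub_add_cancel])
  · have ha : a ≠ 0 := by rintro rfl; simp [h0] at hab
    have hb : b ≠ 0 := by rintro rfl; simp [h0] at hab
    have h1 : ν a + ν b ≤ 0 := by
      rw [← hν.map_mul a b ha hb, ← hab, sub_eq_add_neg, ← C_neg]
      refine (hν.map_add_le _ _).trans ?_
      rw [hν.map_self, hν.map_C, max_self]
    obtain ⟨f, rfl⟩ := hker a (hν.jac_eq_zero (by linarith [hν.nonneg a, hν.nonneg b]))
    obtain ⟨g, rfl⟩ := hker b (hν.jac_eq_zero (by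
      linarith [hν.nonneg b, hν.nonneg (Polynomial.aeval p f)]))
    have h2 : Polynomial.X - Polynomial.C z = f * g := by
      rw [← sub_eq_zero]
      refine eq_zero_of_aeval_eq_zero hp ?_
      rw [map_sub, _root_.map_mul, ← hab]
      simp
    exact ((Polynomial.irreducible_X_sub_C z).isUnit_or_isUnit h2).imp
      (fun h => h.map _) fun h => h.map _

lemma dvd_jac_of_mul_dvd_jac_mul {z b : P} (hz : z ≠ 0) (hpz : jac p z = 0)
    (h : z * b ∣ jac p (z * b)) : b ∣ jac p b := by
  rw [Derivation.leibniz, hpz, smul_zero, add_zero, smul_eq_mul] at h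
  exact (mul_dvd_mul_iff_left hz).1 h

lemma Prime.dvd_jac_of_dvd {π b : P} (hπ : Prime π) (hb : b ≠ 0) (h : π ∣ b)
    (hd : b ∣ jac p b) : π ∣ jac p π := by
  obtain ⟨n, c, hc, rfl⟩ := WfDvdMonoid.max_power_factor' hb hπ.not_isUnit
  obtain ⟨m, rfl⟩ : ∃ m, n = m + 1 := by
    refine Nat.exists_eq_succ_of_ne_zero ?_
    rintro rfl
    exact hc (by simpa using h)
  have h1 : π ^ m * π ∣ π ^ m * (((m + 1 : ℂ) • c) * jac p π) := by
    rw [← pow_succ]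
    have h2 := (Dvd.intro _ rfl : π ^ (m + 1) ∣ π ^ (m + 1) * c).trans hd
    rw [Derivation.leibniz, smul_eq_mul, Derivation.leibniz_pow] at h2
    rw [dvd_add_right (Dvd.intro _ rfl)] at h2
    convert h2 using 1
    simp only [smul_eq_mul, nsmul_eq_mul, smul_eq_C_mul, Nat.add_sub_cancel]
    push_cast
    rw [C_add, C_1, show (C (m : ℂ) : P) = m from map_natCast C m]
    ring
  rw [mul_dvd_mul_iff_left (pow_ne_zero _ hπ.ne_zero)] at h1
  refine (hπ.dvd_or_dvd h1).resolve_left fun h2 => hc ?_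
  rw [smul_eq_C_mul] at h2
  refine (hπ.dvd_or_dvd h2).resolve_left fun h3 => hπ.not_isUnit (isUnit_of_dvd_unit h3 ?_)
  exact (IsUnit.mk0 _ (Nat.cast_add_one_ne_zero m)).map C

/-- If all the fibres of `p` are irreducible, then the only Darboux polynomials of `jac p` are the
polynomials in `p`. -/
theorem exists_eq_aeval_of_dvd_jac (hprime : ∀ z, Prime (p - C z)) {b : P}
    (hd : b ∣ jac p b) : ∃ h : Polynomial ℂ, b = Polynomial.aeval p h := by
  induction hn : b.totalDegree using Nat.strong_induction_on generalizing b with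
  | _ n ih =>
    by_cases hbC : ∃ c, b = C c
    · obtain ⟨c, rfl⟩ := hbC
      exact ⟨Polynomial.C c, by simp⟩
    push Not at hbC
    have hb : b ≠ 0 := by simpa using hbC 0
    have hbu : ¬ IsUnit b := fun h => by
      obtain ⟨c, -, hc⟩ := isUnit_iff_exists_eq_C.1 h
      exact hbC c hc
    obtain ⟨π, hπ, hπb⟩ := WfDvdMonoid.exists_irreducible_factor hbu hb
    obtain ⟨c, hc⟩ := hπ.prime.exists_dvd_sub_C_of_dvd_jac (hπ.prime.dvd_jac_of_dvd hb hπb hd)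
    have hassoc : Associated π (p - C c) := hπ.associated_of_dvd (hprime c).irreducible hc
    obtain ⟨b', rfl⟩ := hassoc.symm.dvd.trans hπb
    have hz := (hprime c).ne_zero
    have hzd : 1 ≤ (p - C c).totalDegree := one_le_totalDegree fun x hx =>
      (hprime (c + x)).ne_zero (by rw [C_add, ← hx]; ring)
    rw [totalDegree_mul_of_isDomain hz (right_ne_zero_of_mul hb)] at hn
    obtain ⟨h, hh⟩ := ih _ (by omega) (dvd_jac_of_mul_dvd_jac_mul hz (by simp) hd) rfl
    refine ⟨(Polynomial.X - Polynomial.C c) * h, ?_⟩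
    rw [map_mul, ← hh]
    simp

lemma exists_mul_aeval_eq (hprime : ∀ z, Prime (p - C z)) {a b : P} (hb : b ≠ 0)
    (h : a * jac p b = b * jac p a) :
    ∃ f g : Polynomial ℂ, g ≠ 0 ∧ a * Polynomial.aeval p g = b * Polynomial.aeval p f := by
  obtain ⟨a', b', c, hrel, rfl, rfl⟩ := UniqueFactorizationMonoid.exists_reduced_factors' a b hb
  have hc := left_ne_zero_of_mul hb
  have hb' := right_ne_zero_of_mul hb
  have h1 : a' * jac p b' = b' * jac p a' := by
    refine mul_left_cancel₀ (mul_ne_zero hc hc) ?_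
    simp only [Derivation.leibniz, smul_eq_mul] at h
    linear_combination h
  obtain ⟨g, rfl⟩ := exists_eq_aeval_of_dvd_jac hprime
    (hrel.symm.dvd_of_dvd_mul_left (Dvd.intro _ h1.symm))
  obtain ⟨f, rfl⟩ := exists_eq_aeval_of_dvd_jac hprime
    (hrel.dvd_of_dvd_mul_left (Dvd.intro _ h1))
  exact ⟨f, g, by rintro rfl; simp at hb', by ring⟩

end Darboux

section RationalRatios

/-- If all conjugates of `μ` are rational multiples of `μ`, then `μ ^ 2` is in the base field. -/
lemma exists_algebraMap_eq_sq {K Ω : Type*} [Field K] [CharZero K] [Field Ω] [CharZero Ω]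
    [Algebra K Ω] [IsAlgClosed Ω] {μ : Ω} (hμ : IsIntegral K μ) (hμ0 : μ ≠ 0)
    (h : ∀ r : Ω, Polynomial.aeval r (minpoly K μ) = 0 → ∃ ρ : ℚ, r = ρ * μ) :
    ∃ Δ : K, algebraMap K Ω Δ = μ ^ 2 := by
  set f := minpoly K μ with hf
  have hf0 : f ≠ 0 := minpoly.ne_zero hμ
  have hn : 0 < f.natDegree := minpoly.natDegree_pos hμ
  have hsplit : (f.map (algebraMap K Ω)).Splits := IsAlgClosed.splits _
  have hmem : ∀ r ∈ f.aroots Ω, ∃ ρ : ℚ, r = ρ * μ := fun r hr => h r (Polynomial.mem_aroots.1 hr).2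
  have hcard : (f.aroots Ω).card = f.natDegree := by
    rw [Polynomial.aroots_def, ← hsplit.natDegree_eq_card_roots, Polynomial.natDegree_map]
  have hprod : ∃ x : K, algebraMap K Ω x = (f.aroots Ω).prod := by
    have h1 := hsplit.coeff_zero_eq_leadingCoeff_mul_prod_roots
    rw [Polynomial.leadingCoeff_map, (minpoly.monic hμ).leadingCoeff, map_one, mul_one,
      Polynomial.coeff_map] at h1
    refine ⟨(-1) ^ f.natDegree * f.coeff 0, ?_⟩
    rw [map_mul, h1, Polynomial.aroots_def, Polynomial.natDegree_map, ← mul_assoc,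
      map_pow, map_neg, map_one, ← mul_pow]
    simp
  have hprod2 : ∀ s : Multiset Ω, (∀ r ∈ s, r ≠ 0) → (∀ r ∈ s, ∃ ρ : ℚ, r = ρ * μ) →
      ∃ ρ : ℚ, ρ ≠ 0 ∧ s.prod = ρ * μ ^ s.card := by
    intro s
    induction s using Multiset.induction_on with
    | empty => exact fun _ _ => ⟨1, one_ne_zero, by simp⟩
    | cons a s ih =>
      intro h0 hs
      obtain ⟨ρ, hρ, h1⟩ := ih (fun r hr => h0 r (Multiset.mem_cons_of_mem hr))
        fun r hr => hs r (Multiset.mem_cons_of_mem hr)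
      obtain ⟨σ, hσ⟩ := hs a (Multiset.mem_cons_self a s)
      refine ⟨σ * ρ, mul_ne_zero ?_ hρ, ?_⟩
      · rintro rfl
        exact h0 a (Multiset.mem_cons_self a s) (by simpa using hσ)
      · rw [Multiset.prod_cons, h1, hσ, Multiset.card_cons]
        push_cast
        ring
  have hne : ∀ r ∈ f.aroots Ω, r ≠ 0 := by
    rintro r hr rfl
    have h1 := (Polynomial.mem_aroots.1 hr).2
    have h2 : f.coeff 0 = 0 := by
      have h3 : algebraMap K Ω (f.coeff 0) = 0 := by
        rwa [Polynomial.aeval_def, Polynomial.eval₂_at_zero] at h1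
      exact (map_eq_zero _).1 h3
    exact minpoly.coeff_zero_ne_zero hμ hμ0 h2
  obtain ⟨x, hx⟩ := hprod
  obtain ⟨ρ, hρ, hρx⟩ := hprod2 _ hne hmem
  rw [hcard] at hρx
  have hρ' : (ρ : Ω) ≠ 0 := by exact_mod_cast hρ
  obtain ⟨y, hy⟩ : ∃ y : K, algebraMap K Ω y = μ ^ f.natDegree := by
    refine ⟨(ρ : K)⁻¹ * x, ?_⟩
    rw [map_mul, map_inv₀, hx, hρx, map_ratCast]
    field_simp
  have hsq : ∀ r ∈ f.aroots Ω, r = μ ∨ r = -μ := by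
    intro r hr
    obtain ⟨σ, rfl⟩ := hmem r hr
    have hdvd : f ∣ Polynomial.X ^ f.natDegree - Polynomial.C y := minpoly.dvd K μ (by simp [hy])
    have h1 : Polynomial.aeval (σ * μ : Ω) (Polynomial.X ^ f.natDegree - Polynomial.C y) = 0 := by
      obtain ⟨g, hg⟩ := hdvd
      rw [hg, map_mul, (Polynomial.mem_aroots.1 hr).2, zero_mul]
    rw [map_sub, map_pow, Polynomial.aeval_X, Polynomial.aeval_C, hy, mul_pow, sub_eq_zero] at h1
    have h2 : (σ : Ω) ^ f.natDegree = 1 :=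
      mul_right_cancel₀ (pow_ne_zero _ hμ0) (by rw [h1, one_mul])
    have h3 : σ ^ f.natDegree = 1 := by exact_mod_cast h2
    have h4 := (pow_eq_one_iff_of_ne_zero hn.ne').1 h3
    rcases h4 with h4 | h4
    · left; simp [h4]
    · right; simp [h4.1]
  have hle : f.natDegree ≤ 2 := by
    classical
    have hnodup : (f.aroots Ω).Nodup :=
      Polynomial.nodup_aroots_iff_of_splits hf0 hsplit |>.2 (minpoly.irreducible hμ).separable
    rw [← hcard, ← Multiset.toFinset_card_of_nodup hnodup]
    refine (Finset.card_le_card (t := {μ, -μ}) fun r hr => ?_).trans Finset.card_le_two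
    simpa using hsq r (Multiset.mem_toFinset.1 hr)
  obtain h1 | h1 : f.natDegree = 1 ∨ f.natDegree = 2 := by omega
  · exact ⟨y ^ 2, by rw [map_pow, hy, h1, pow_one]⟩
  · exact ⟨y, by rw [hy, h1]⟩

end RationalRatios

section PowerSeriesDerivative

variable {Ω : Type*} [Field Ω] [CharZero Ω]

lemma PowerSeries.eq_zero_of_constantCoeff_iterate_derivative {f : PowerSeries Ω}
    (h : ∀ m, PowerSeries.constantCoeff ((PowerSeries.derivative Ω)^[m] f) = 0) : f = 0 := by
  ext m
  induction m generalizing f with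
  | zero => simpa using h 0
  | succ m ih =>
    have h1 := ih (f := PowerSeries.derivative Ω f) fun m => h (m + 1)
    rw [PowerSeries.coeff_derivative, map_zero] at h1
    rw [map_zero]
    exact (mul_eq_zero.1 h1).resolve_right (Nat.cast_add_one_ne_zero m)

/-- Two eigenvectors of the derivative satisfying a polynomial relation have eigenvalues whose
ratio is rational. -/
lemma PowerSeries.exists_rat_of_bivEval_eq_zero {w₁ w₂ : PowerSeries Ω} {μ₁ μ₂ : Ω}
    (h₁ : PowerSeries.derivative Ω w₁ = μ₁ • w₁) (h₂ : PowerSeries.derivative Ω w₂ = μ₂ • w₂)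
    (hw₁ : w₁ ≠ 0) (hw₂ : w₂ ≠ 0) (hμ₁ : μ₁ ≠ 0) {F : Polynomial (Polynomial Ω)} (hF : F ≠ 0)
    (h : bivEval w₁ w₂ F = 0) : ∃ ρ : ℚ, μ₂ = ρ * μ₁ := by
  by_contra! hρ
  set eig : ℕ × ℕ → Ω := fun e => e.1 * μ₁ + e.2 * μ₂ with heig
  set vec : ℕ × ℕ → PowerSeries Ω := fun e => w₁ ^ e.1 * w₂ ^ e.2 with hvec
  have hinj : Function.Injective eig := by
    rintro ⟨i, j⟩ ⟨i', j'⟩ hij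
    simp only [heig] at hij
    have hj : j = j' := by
      by_contra hj
      have hj' : ((j : Ω) - j') ≠ 0 := sub_ne_zero.2 (by exact_mod_cast hj)
      refine hρ (((i' : ℚ) - i) / (j - j')) ?_
      push_cast
      field_simp
      linear_combination hij
    subst hj
    have hi : (i : Ω) = i' := mul_right_cancel₀ hμ₁ (by linear_combination hij)
    rw [Nat.cast_inj.1 hi]
  have hpow : ∀ {w : PowerSeries Ω} {μ : Ω}, PowerSeries.derivative Ω w = μ • w → ∀ n : ℕ,
      PowerSeries.derivative Ω (w ^ n) = (n * μ) • w ^ n := by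
    intro w μ hw n
    induction n with
    | zero => simp
    | succ n ih =>
      rw [pow_succ, Derivation.leibniz, ih, hw]
      simp only [smul_eq_mul, PowerSeries.smul_eq_C_mul, map_mul, map_natCast]
      push_cast
      ring
  have hvecD : ∀ e, Module.End.HasEigenvector (PowerSeries.derivative Ω).toLinearMap (eig e)
      (vec e) := by
    intro e
    refine ⟨Module.End.mem_eigenspace_iff.2 ?_,
      mul_ne_zero (pow_ne_zero _ hw₁) (pow_ne_zero _ hw₂)⟩
    simp only [hvec, heig, Derivation.coeFn_coe, Derivation.leibniz, hpow h₁, hpow h₂, smul_eq_mul,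
      PowerSeries.smul_eq_C_mul, map_add, map_mul, map_natCast]
    ring
  have hli := Module.End.eigenvectors_linearIndependent' _ eig hinj vec hvecD
  apply hF
  ext j i
  rw [Polynomial.coeff_zero, Polynomial.coeff_zero]
  by_contra hij
  set n := F.natDegree + 1
  set d := (Finset.range n).sup fun j => (F.coeff j).natDegree
  have hsum : ∑ e ∈ Finset.range (d + 1) ×ˢ Finset.range n,
      (F.coeff e.2).coeff e.1 • vec e = 0 := by
    rw [← h, bivEval_eq_sum, Finset.sum_product_right]
    refine Finset.sum_congr rfl fun j hj => ?_
    rw [Polynomial.aeval_eq_sum_range' (n := d + 1)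
      (Nat.lt_succ_iff.2 (Finset.le_sup (f := fun j => (F.coeff j).natDegree) hj)), Finset.sum_mul]
    exact Finset.sum_congr rfl fun i _ => by simp [hvec]
  have hj : j < n := by
    by_contra hj
    rw [F.coeff_eq_zero_of_natDegree_lt (by omega), Polynomial.coeff_zero] at hij
    exact hij rfl
  have hi : i < d + 1 := by
    have := Finset.le_sup (f := fun j => (F.coeff j).natDegree) (Finset.mem_range.2 hj)
    exact Nat.lt_succ_iff.2 ((Polynomial.le_natDegree_of_ne_zero hij).trans this)
  exact hij (linearIndependent_iff'.1 hli _ _ hsum (i, j)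
    (Finset.mem_product.2 ⟨Finset.mem_range.2 hi, Finset.mem_range.2 hj⟩))

end PowerSeriesDerivative

section Taylor

variable (p : P) (Ω : Type*) [Field Ω] [Algebra P Ω]

/-- The derivative of power series as a linear endomorphism. -/
noncomputable abbrev powerSeriesD (Ω : Type*) [Field Ω] : Module.End Ω (PowerSeries Ω) :=
  (PowerSeries.derivative Ω).toLinearMap

/-- The Taylor expansion along the flow of the derivation `jac p`, as a function. -/
noncomputable def taylorFun (u : P) : PowerSeries Ω :=
  PowerSeries.mk fun n => algebraMap P Ω ((jac p)^[n] u) / n.factorial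

lemma constantCoeff_taylorFun (u : P) :
    PowerSeries.constantCoeff (taylorFun p Ω u) = algebraMap P Ω u := by
  rw [← PowerSeries.coeff_zero_eq_constantCoeff_apply, taylorFun, PowerSeries.coeff_mk]
  simp

lemma taylorFun_add (u v : P) : taylorFun p Ω (u + v) = taylorFun p Ω u + taylorFun p Ω v := by
  ext n
  simp [taylorFun, add_div, ← Derivation.coeFn_coe, ← Module.End.pow_apply]

/-- The evaluation of polynomials at `p`, with values in the field `Ω`. -/
noncomputable def evalField : Polynomial ℂ →+* Ω :=
  (algebraMap P Ω).comp (Polynomial.aeval p : Polynomial ℂ →ₐ[ℂ] P).toRingHom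

lemma evalField_apply (h : Polynomial ℂ) :
    evalField p Ω h = algebraMap P Ω (Polynomial.aeval p h) := rfl

variable [CharZero Ω]

lemma derivative_taylorFun (u : P) :
    powerSeriesD Ω (taylorFun p Ω u) = taylorFun p Ω (jac p u) := by
  ext n
  have h1 : ((n : Ω) + 1) ≠ 0 := Nat.cast_add_one_ne_zero n
  have h2 : (n.factorial : Ω) ≠ 0 := by exact_mod_cast n.factorial_ne_zero
  simp only [Derivation.coeFn_coe, PowerSeries.coeff_derivative, taylorFun, PowerSeries.coeff_mk,
    Function.iterate_succ_apply, Nat.factorial_succ]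
  push_cast
  field_simp

lemma taylorFun_mul (u v : P) : taylorFun p Ω (u * v) = taylorFun p Ω u * taylorFun p Ω v := by
  ext n
  induction n generalizing u v with
  | zero => simp [constantCoeff_taylorFun]
  | succ n ih =>
    refine mul_right_cancel₀ (Nat.cast_add_one_ne_zero n) ?_
    rw [← PowerSeries.coeff_derivative, ← PowerSeries.coeff_derivative, Derivation.leibniz]
    have h := derivative_taylorFun p Ω
    simp only [Derivation.coeFn_coe] at h
    rw [h, h, h, Derivation.leibniz]
    simp only [smul_eq_mul, taylorFun_add, map_add, ih]

/-- The Taylor expansion along the flow of the derivation `jac p`. -/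
noncomputable def taylor : P →+* PowerSeries Ω where
  toFun := taylorFun p Ω
  map_zero' := by ext n; simp [taylorFun]
  map_one' := by
    ext n
    rcases n with - | n
    · simp [taylorFun]
    · simp [taylorFun, Function.iterate_succ_apply, PowerSeries.coeff_one]
  map_add' := taylorFun_add p Ω
  map_mul' := taylorFun_mul p Ω

variable {p Ω}

lemma constantCoeff_taylor (u : P) :
    PowerSeries.constantCoeff (taylor p Ω u) = algebraMap P Ω u :=
  constantCoeff_taylorFun p Ω u

lemma derivative_taylor (u : P) : powerSeriesD Ω (taylor p Ω u) = taylor p Ω (jac p u) :=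
  derivative_taylorFun p Ω u

lemma pow_derivative_taylor (n : ℕ) (u : P) :
    (powerSeriesD Ω ^ n) (taylor p Ω u) = taylor p Ω ((jac p)^[n] u) := by
  induction n generalizing u with
  | zero => rfl
  | succ n ih => rw [pow_succ, Module.End.mul_apply, derivative_taylor, ih]; rfl

lemma taylor_eq_C {u : P} (h : jac p u = 0) :
    taylor p Ω u = PowerSeries.C (algebraMap P Ω u) := by
  refine PowerSeries.derivative.ext ?_ ?_
  · have := derivative_taylor (Ω := Ω) (p := p) u
    rw [h, map_zero] at this
    rw [PowerSeries.derivative_C]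
    exact this
  · rw [constantCoeff_taylor, PowerSeries.constantCoeff_C]

lemma aeval_derivative_taylor {g : Polynomial Ω} {n : ℕ} (hn : g.natDegree < n) (u : P) :
    Polynomial.aeval (powerSeriesD Ω) g (taylor p Ω u) =
      ∑ i ∈ Finset.range n, g.coeff i • taylor p Ω ((jac p)^[i] u) := by
  rw [Polynomial.aeval_eq_sum_range' hn, LinearMap.sum_apply]
  exact Finset.sum_congr rfl fun i _ => by rw [LinearMap.smul_apply, pow_derivative_taylor]

lemma aeval_derivative_taylor_eq_zero_iff {g : Polynomial Ω} {n : ℕ} (hn : g.natDegree < n)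
    (u : P) : Polynomial.aeval (powerSeriesD Ω) g (taylor p Ω u) = 0 ↔
      ∀ m, ∑ i ∈ Finset.range n, g.coeff i * algebraMap P Ω ((jac p)^[m + i] u) = 0 := by
  have key : ∀ m, PowerSeries.constantCoeff ((powerSeriesD Ω ^ m)
      (Polynomial.aeval (powerSeriesD Ω) g (taylor p Ω u))) =
      ∑ i ∈ Finset.range n, g.coeff i * algebraMap P Ω ((jac p)^[m + i] u) := by
    intro m
    rw [aeval_derivative_taylor hn, map_sum, map_sum]
    refine Finset.sum_congr rfl fun i _ => ?_
    rw [map_smul, pow_derivative_taylor, ← Function.iterate_add_apply, PowerSeries.smul_eq_C_mul,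
      map_mul, PowerSeries.constantCoeff_C, constantCoeff_taylor]
  refine ⟨fun h m => by rw [← key, h, map_zero, map_zero], fun h => ?_⟩
  refine PowerSeries.eq_zero_of_constantCoeff_iterate_derivative fun m => ?_
  have := key m
  rw [h m, Module.End.pow_apply] at this
  exact this

lemma aeval_map_derivative_taylor (g : Polynomial (Polynomial ℂ)) (u : P) :
    Polynomial.aeval (powerSeriesD Ω) (g.map (evalField p Ω)) (taylor p Ω u) =
      taylor p Ω (opEval p g u) := by
  rw [aeval_derivative_taylor (Nat.lt_succ_iff.2 Polynomial.natDegree_map_le),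
    opEval_apply_eq_sum (Nat.lt_succ_self _), map_sum]
  refine Finset.sum_congr rfl fun i _ => ?_
  rw [map_mul, taylor_eq_C (jac_aeval_self p _), Polynomial.coeff_map, PowerSeries.smul_eq_C_mul]
  rfl

end Taylor

section MinimalOperator

variable {p : P} {Ω : Type*} [Field Ω] [CharZero Ω] [Algebra P Ω]

variable (p) in
/-- A polynomial of minimal degree among those annihilating the Taylor expansion of `u`. -/
structure IsMinimalAnnihilator (u : P) (m : Polynomial Ω) : Prop where
  ne_zero : m ≠ 0
  aeval_eq_zero : Polynomial.aeval (powerSeriesD Ω) m (taylor p Ω u) = 0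
  eq_zero_of_degree_lt : ∀ g : Polynomial Ω, g.degree < m.degree →
    Polynomial.aeval (powerSeriesD Ω) g (taylor p Ω u) = 0 → g = 0

lemma exists_isMinimalAnnihilator {u : P} {g : Polynomial Ω} (hg : g ≠ 0)
    (h : Polynomial.aeval (powerSeriesD Ω) g (taylor p Ω u) = 0) :
    ∃ m : Polynomial Ω, IsMinimalAnnihilator p u m := by
  obtain ⟨m, ⟨hm0, hm⟩, hmin⟩ := WellFounded.has_min
    (InvImage.wf (Polynomial.degree (R := Ω)) wellFounded_lt)
    {g | g ≠ 0 ∧ Polynomial.aeval (powerSeriesD Ω) g (taylor p Ω u) = 0} ⟨g, hg, h⟩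
  refine ⟨m, hm0, hm, fun g hg h => ?_⟩
  by_contra h0
  exact hmin g ⟨h0, h⟩ hg

lemma exists_sum_mul_eq_zero [FaithfulSMul P Ω] {E : Type*} [Field E] [Algebra P E]
    [IsFractionRing P E] [Algebra E Ω] [IsScalarTower P E Ω] {n : ℕ} {c : ℕ → Ω} (hc : c n ≠ 0)
    {ι : Type*} {v : ι → ℕ → P}
    (h : ∀ m, ∑ i ∈ Finset.range (n + 1), c i * algebraMap P Ω (v m i) = 0) :
    ∃ a : ℕ → P, a n ≠ 0 ∧ ∀ m, ∑ i ∈ Finset.range (n + 1), a i * v m i = 0 := by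
  obtain ⟨l, hl⟩ := (Algebra.linearMap E Ω).exists_leftInverse_of_injective
    (LinearMap.ker_eq_bot.2 (algebraMap E Ω).injective)
  have hl1 : l 1 = 1 := by
    have := LinearMap.congr_fun hl 1
    simpa using this
  obtain ⟨b, hb⟩ := IsLocalization.exist_integer_multiples (nonZeroDivisors P)
    (Finset.range (n + 1)) fun i => l (c i / c n)
  have hb0 : (b : P) ≠ 0 := nonZeroDivisors.coe_ne_zero b
  have hb' : ∀ i, ∃ a : P, i ∈ Finset.range (n + 1) →
      algebraMap P E a = algebraMap P E b * l (c i / c n) := by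
    intro i
    by_cases hi : i ∈ Finset.range (n + 1)
    · obtain ⟨a, ha⟩ := hb i hi
      exact ⟨a, fun _ => by rw [ha, Algebra.smul_def]⟩
    · exact ⟨0, fun h => absurd h hi⟩
  choose a ha using hb'
  have hinj : Function.Injective (algebraMap P E) := IsFractionRing.injective P E
  refine ⟨a, fun h0 => ?_, fun m => ?_⟩
  · have h1 := ha n (Finset.self_mem_range_succ n)
    rw [h0, map_zero, div_self hc, hl1, mul_one] at h1
    exact hb0 ((map_eq_zero_iff _ hinj).1 h1.symm)
  · apply hinj
    rw [map_zero, map_sum]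
    have h1 : ∑ i ∈ Finset.range (n + 1), l (c i / c n) * algebraMap P E (v m i) = 0 := by
      have h2 : ∀ i, l (c i / c n) * algebraMap P E (v m i) =
          l (c i * algebraMap P Ω (v m i) / c n) := by
        intro i
        rw [mul_comm, ← smul_eq_mul, ← map_smul, Algebra.smul_def,
          ← IsScalarTower.algebraMap_apply P E Ω]
        congr 1
        ring
      simp only [h2]
      rw [← map_sum, ← Finset.sum_div, h m, zero_div, map_zero]
    rw [← mul_zero (algebraMap P E b), ← h1, Finset.mul_sum]
    refine Finset.sum_congr rfl fun i hi => ?_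
    rw [map_mul, ha i hi]
    ring

lemma exists_common_denominator (hprime : ∀ z, Prime (p - C z)) {a : ℕ → P} {b : P} (hb : b ≠ 0)
    (s : Finset ℕ) (h : ∀ i ∈ s, a i * jac p b = b * jac p (a i)) :
    ∃ g : Polynomial ℂ, g ≠ 0 ∧ ∀ i ∈ s, ∃ f : Polynomial ℂ,
      a i * Polynomial.aeval p g = b * Polynomial.aeval p f := by
  classical
  induction s using Finset.induction_on with
  | empty => exact ⟨1, one_ne_zero, by simp⟩
  | insert j s hj ih =>
    obtain ⟨g, hg, hs⟩ := ih fun i hi => h i (Finset.mem_insert_of_mem hi)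
    obtain ⟨f', g', hg', hfg⟩ := exists_mul_aeval_eq hprime hb (h j (Finset.mem_insert_self j s))
    refine ⟨g * g', mul_ne_zero hg hg', fun i hi => ?_⟩
    rcases Finset.mem_insert.1 hi with rfl | hi
    · exact ⟨g * f', by rw [map_mul, map_mul]; linear_combination Polynomial.aeval p g * hfg⟩
    · obtain ⟨f, hf⟩ := hs i hi
      exact ⟨f * g', by rw [map_mul, map_mul]; linear_combination Polynomial.aeval p g' * hf⟩

/-- The minimal annihilator is defined over the field of rational functions in `p`. -/
theorem IsMinimalAnnihilator.exists_opEval_eq_zero [FaithfulSMul P Ω] (E : Type*) [Field E]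
    [Algebra P E] [IsFractionRing P E] [Algebra E Ω] [IsScalarTower P E Ω]
    (hprime : ∀ z, Prime (p - C z)) {u : P} {m : Polynomial Ω} (hm : IsMinimalAnnihilator p u m) :
    ∃ A : Polynomial (Polynomial ℂ), A ≠ 0 ∧ A.degree ≤ m.degree ∧ opEval p A u = 0 := by
  set n := m.natDegree with hn
  have hdeg : m.degree = n := Polynomial.degree_eq_natDegree hm.ne_zero
  obtain ⟨a, han, ha⟩ := exists_sum_mul_eq_zero (E := E)
    (Polynomial.leadingCoeff_ne_zero.2 hm.ne_zero)
    ((aeval_derivative_taylor_eq_zero_iff (Nat.lt_succ_self _) u).1 hm.aeval_eq_zero)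
  rw [← hn] at han ha
  have hDa : ∀ k, ∑ i ∈ Finset.range (n + 1), jac p (a i) * (jac p)^[k + i] u = 0 := by
    intro k
    have h1 := congrArg (jac p) (ha k)
    have h2 := ha (k + 1)
    simp only [map_sum, Derivation.leibniz, map_zero, smul_eq_mul, Finset.sum_add_distrib,
      ← Function.iterate_succ_apply'] at h1
    simp only [Nat.add_right_comm k 1] at h2
    simp only [Nat.succ_eq_add_one] at h1
    rw [h2, zero_add] at h1
    rw [← h1]
    exact Finset.sum_congr rfl fun i _ => mul_comm _ _
  have hprop : ∀ i ∈ Finset.range (n + 1), a i * jac p (a n) = a n * jac p (a i) := by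
    let r : ℕ → P := fun i => a n * jac p (a i) - a i * jac p (a n)
    have hr : ∀ k, ∑ i ∈ Finset.range (n + 1), r i * (jac p)^[k + i] u = 0 := by
      intro k
      simp only [r, sub_mul, Finset.sum_sub_distrib, mul_assoc, ← Finset.mul_sum, hDa k]
      have : ∑ i ∈ Finset.range (n + 1), a i * (jac p (a n) * (jac p)^[k + i] u) =
          jac p (a n) * ∑ i ∈ Finset.range (n + 1), a i * (jac p)^[k + i] u := by
        rw [Finset.mul_sum]
        exact Finset.sum_congr rfl fun i _ => by ring
      rw [this, ha k]
      simp
    have hrn : r n = 0 := by simp [r]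
    let g : Polynomial Ω :=
      ∑ i ∈ Finset.range (n + 1), Polynomial.C (algebraMap P Ω (r i)) * Polynomial.X ^ i
    have hcoeff : ∀ i < n + 1, g.coeff i = algebraMap P Ω (r i) := by
      intro i hi
      simp only [g, Polynomial.finsetSum_coeff, Polynomial.coeff_C_mul_X_pow]
      simp [hi]
    have hgdeg : g.degree < m.degree := by
      rw [hdeg, Polynomial.degree_lt_iff_coeff_zero]
      intro i hi
      rcases hi.eq_or_lt with rfl | hi
      · rw [hcoeff _ (Nat.lt_succ_self _), hrn, map_zero]
      · simp only [g, Polynomial.finsetSum_coeff, Polynomial.coeff_C_mul_X_pow]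
        refine Finset.sum_eq_zero fun j hj => if_neg ?_
        have := Finset.mem_range.1 hj
        omega
    have hg0 : g = 0 := by
      refine hm.eq_zero_of_degree_lt g hgdeg ?_
      have hlt : g.natDegree < n + 1 := by
        have := Polynomial.natDegree_le_natDegree hgdeg.le
        omega
      rw [aeval_derivative_taylor_eq_zero_iff hlt]
      intro k
      rw [← map_zero (algebraMap P Ω), ← hr k, map_sum]
      refine Finset.sum_congr rfl fun i hi => ?_
      rw [hcoeff i (Finset.mem_range.1 hi), map_mul]
    intro i hi
    have h1 := hcoeff i (Finset.mem_range.1 hi)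
    rw [hg0, Polynomial.coeff_zero, eq_comm,
      map_eq_zero_iff _ (FaithfulSMul.algebraMap_injective P Ω)] at h1
    exact (sub_eq_zero.1 h1).symm
  obtain ⟨g, hg, hf⟩ := exists_common_denominator hprime han _ hprop
  choose! f hf using hf
  have hp0 : Polynomial.aeval p g ≠ 0 := by
    intro h0
    refine hg (eq_zero_of_aeval_eq_zero (fun c hc => (hprime c).ne_zero (sub_eq_zero.2 hc)) h0)
  let A : Polynomial (Polynomial ℂ) :=
    ∑ i ∈ Finset.range (n + 1), Polynomial.C (f i) * Polynomial.X ^ i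
  have hcoeff : ∀ i < n + 1, A.coeff i = f i := by
    intro i hi
    simp only [A, Polynomial.finsetSum_coeff, Polynomial.coeff_C_mul_X_pow]
    simp [hi]
  have hAdeg : A.degree < (n + 1 : ℕ) := by
    rw [Polynomial.degree_lt_iff_coeff_zero]
    intro i hi
    simp only [A, Polynomial.finsetSum_coeff, Polynomial.coeff_C_mul_X_pow]
    refine Finset.sum_eq_zero fun j hj => if_neg ?_
    have := Finset.mem_range.1 hj
    omega
  refine ⟨A, fun h0 => ?_, ?_, ?_⟩
  · have h1 := hcoeff n (Nat.lt_succ_self _)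
    have h2 := hf n (Finset.self_mem_range_succ n)
    rw [← h1, h0, Polynomial.coeff_zero, map_zero, mul_zero] at h2
    exact mul_ne_zero han hp0 h2
  · rw [hdeg]
    exact Order.le_of_lt_succ hAdeg
  · refine (mul_eq_zero.1 ?_).resolve_left han
    have hlt : A.natDegree < n + 1 := by
      rw [Nat.lt_succ_iff, Polynomial.natDegree_le_iff_degree_le]
      exact Order.le_of_lt_succ hAdeg
    rw [opEval_apply_eq_sum hlt, Finset.mul_sum]
    have h2 := ha 0
    rw [← mul_zero (Polynomial.aeval p g), ← h2, Finset.mul_sum]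
    refine Finset.sum_congr rfl fun i hi => ?_
    rw [hcoeff i (Finset.mem_range.1 hi), zero_add]
    linear_combination -(jac p)^[i] u * hf i hi

end MinimalOperator

section EigenvalueRatios

variable {p : P} {Ω : Type*} [Field Ω] [CharZero Ω] [Algebra P Ω]

variable (p Ω) in
/-- The extension of the Taylor expansion to polynomials with coefficients in `Ω`. -/
noncomputable def taylorExt : MvPolynomial (Fin 2) Ω →ₐ[Ω] PowerSeries Ω :=
  aeval fun i => taylor p Ω (X i)

lemma taylorExt_map (v : P) :
    taylorExt p Ω (map ((algebraMap P Ω).comp C) v) = taylor p Ω v := by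
  induction v using MvPolynomial.induction_on with
  | C c =>
    rw [taylor_eq_C (jac_C p c), map_C, taylorExt, aeval_C]
    rfl
  | add u v hu hv => simp only [map_add, hu, hv]
  | mul_X u i hu => rw [map_mul, map_mul, map_mul, hu, map_X, taylorExt, aeval_X]

lemma taylorExt_C (c : Ω) : taylorExt p Ω (C c) = PowerSeries.C c := by
  rw [taylorExt, aeval_C]
  rfl

lemma exists_taylorExt_eq (g : Polynomial Ω) (u : P) :
    ∃ W, taylorExt p Ω W = Polynomial.aeval (powerSeriesD Ω) g (taylor p Ω u) := by
  refine ⟨∑ i ∈ Finset.range (g.natDegree + 1),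
    C (g.coeff i) * map ((algebraMap P Ω).comp C) ((jac p)^[i] u), ?_⟩
  rw [aeval_derivative_taylor (Nat.lt_succ_self _), map_sum]
  refine Finset.sum_congr rfl fun i _ => ?_
  rw [map_mul, taylorExt_map, taylorExt_C, PowerSeries.smul_eq_C_mul]

lemma exists_ne_zero_taylorExt_eq_zero (hp : ∀ c, p ≠ C c) :
    ∃ z, z ≠ 0 ∧ taylorExt p Ω z = 0 := by
  refine ⟨map ((algebraMap P Ω).comp C) p - C (algebraMap P Ω p), fun h => ?_, ?_⟩
  · apply hp (p.coeff 0)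
    ext m
    rw [coeff_C]
    split_ifs with hm
    · rw [hm]
    · have h1 := congrArg (coeff m) h
      rw [coeff_sub, coeff_C, if_neg hm, sub_zero, coeff_map, coeff_zero] at h1
      exact (map_eq_zero _).1 h1
  · rw [map_sub, taylorExt_map, taylorExt_C, taylor_eq_C (jac_self p), sub_self]

/-- The eigenvalues of the derivation are rational multiples of each other. -/
theorem IsMinimalAnnihilator.exists_rat (hp : ∀ c, p ≠ C c) {u : P} {m : Polynomial Ω}
    (hm : IsMinimalAnnihilator p u m) {μ₁ μ₂ : Ω} (hμ : μ₁ ≠ 0) (h₁ : m.IsRoot μ₁)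
    (h₂ : m.IsRoot μ₂) : ∃ ρ : ℚ, μ₂ = ρ * μ₁ := by
  have key : ∀ μ, m.IsRoot μ → ∃ W, taylorExt p Ω W ≠ 0 ∧
      PowerSeries.derivative Ω (taylorExt p Ω W) = μ • taylorExt p Ω W := by
    intro μ h
    obtain ⟨g, hg⟩ := Polynomial.dvd_iff_isRoot.2 h
    have hg0 : g ≠ 0 := by
      rintro rfl
      exact hm.ne_zero (by rw [hg, mul_zero])
    obtain ⟨W, hW⟩ := exists_taylorExt_eq (p := p) g u
    refine ⟨W, fun h0 => hg0 ?_, ?_⟩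
    · refine hm.eq_zero_of_degree_lt g ?_ (hW.symm.trans h0)
      rw [hg, Polynomial.degree_mul, Polynomial.degree_X_sub_C,
        Polynomial.degree_eq_natDegree hg0]
      norm_cast
      omega
    · have h1 := hm.aeval_eq_zero
      rw [hg, map_mul, Module.End.mul_apply, ← hW] at h1
      simp only [map_sub, Polynomial.aeval_X, Polynomial.aeval_C, LinearMap.sub_apply,
        Module.algebraMap_end_apply, sub_eq_zero] at h1
      exact h1
  obtain ⟨W₁, h10, h11⟩ := key μ₁ h₁
  obtain ⟨W₂, h20, h22⟩ := key μ₂ h₂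
  obtain ⟨z, hz, hz0⟩ := exists_ne_zero_taylorExt_eq_zero (Ω := Ω) hp
  obtain ⟨F, hF, y, hy⟩ := exists_dvd_bivEval hz W₁ W₂
  refine PowerSeries.exists_rat_of_bivEval_eq_zero h11 h22 h10 h20 hμ hF ?_
  rw [← map_bivEval, hy, map_mul, hz0, zero_mul]

end EigenvalueRatios

section SquareEigenvector

variable {p : P} {Ω : Type*} [Field Ω] [Algebra P Ω] [FaithfulSMul P Ω]

lemma evalField_injective (hp : ∀ c, p ≠ C c) : Function.Injective (evalField p Ω) := by
  rw [injective_iff_map_eq_zero]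
  intro h hh
  rw [evalField_apply, map_eq_zero_iff _ (FaithfulSMul.algebraMap_injective P Ω)] at hh
  exact eq_zero_of_aeval_eq_zero hp hh

lemma exists_map_eq_C_mul {R K : Type*} [CommRing R] [IsDomain R] [Field K] [Algebra R K]
    [IsFractionRing R K] (f : Polynomial K) : ∃ (s : R) (g : Polynomial R), s ≠ 0 ∧
      g.map (algebraMap R K) = Polynomial.C (algebraMap R K s) * f := by
  obtain ⟨b, hbM, hb⟩ := IsLocalization.integerNormalization_spec (nonZeroDivisors R) f
  refine ⟨b, _, nonZeroDivisors.ne_zero hbM, hb.trans ?_⟩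
  ext i
  simp [Algebra.smul_def]

lemma exists_isRoot_map_evalField [IsAlgClosed Ω] (hp : ∀ c, p ≠ C c) {u : P}
    (hnil : ∀ n, (jac p)^[n] u ≠ 0) {A : Polynomial (Polynomial ℂ)} (hA : A ≠ 0)
    (hAu : opEval p A u = 0) : ∃ μ : Ω, μ ≠ 0 ∧ (A.map (evalField p Ω)).IsRoot μ := by
  have hθi : Function.Injective (evalField p Ω) := evalField_injective hp
  obtain ⟨G, hAG, hG⟩ := Polynomial.exists_eq_pow_rootMultiplicity_mul_and_not_dvd A hA 0
  rw [map_zero, sub_zero] at hAG hG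
  rw [Polynomial.X_dvd_iff] at hG
  by_cases hdeg : G.natDegree = 0
  · exfalso
    rw [Polynomial.eq_C_of_natDegree_eq_zero hdeg] at hAG
    rw [hAG, mul_comm, opEval_mul_apply, opEval_X_pow_apply, opEval_C_apply] at hAu
    exact mul_ne_zero (fun h0 => hG (eq_zero_of_aeval_eq_zero hp h0)) (hnil _) hAu
  · obtain ⟨μ, hμ⟩ := IsAlgClosed.exists_root (G.map (evalField p Ω)) (by
      rw [Polynomial.degree_map_eq_of_injective hθi]
      exact fun h => hdeg (Polynomial.natDegree_eq_of_degree_eq_some h))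
    refine ⟨μ, ?_, ?_⟩
    · rintro rfl
      rw [Polynomial.IsRoot, ← Polynomial.coeff_zero_eq_eval_zero, Polynomial.coeff_map,
        map_eq_zero_iff _ hθi] at hμ
      exact hG hμ
    · rw [hAG, Polynomial.map_mul]
      exact Polynomial.root_mul_left_of_isRoot _ hμ

variable [CharZero Ω]

lemma IsMinimalAnnihilator.exists_sq_eigenvector [IsAlgClosed Ω] (K : Type*) [Field K] [CharZero K]
    [Algebra (Polynomial ℂ) K] [IsFractionRing (Polynomial ℂ) K] [Algebra K Ω]
    (hκ : (algebraMap K Ω).comp (algebraMap (Polynomial ℂ) K) = evalField p Ω)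
    (hp : ∀ c, p ≠ C c) {u : P} {A : Polynomial (Polynomial ℂ)}
    (hAmin : IsMinimalAnnihilator p u (A.map (evalField p Ω))) (hA : A ≠ 0)
    (hu : opEval p A u = 0) {μ : Ω} (hμ0 : μ ≠ 0) (hμ : (A.map (evalField p Ω)).IsRoot μ) :
    ∃ (q : P) (M N : Polynomial ℂ), q ≠ 0 ∧ M ≠ 0 ∧ N ≠ 0 ∧
      Polynomial.aeval p M * jac p (jac p q) = Polynomial.aeval p N * q := by
  have hθi : Function.Injective (evalField p Ω) := evalField_injective hp
  have hmap : ∀ f : Polynomial (Polynomial ℂ),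
      (f.map (algebraMap (Polynomial ℂ) K)).map (algebraMap K Ω) = f.map (evalField p Ω) := by
    intro f
    rw [Polynomial.map_map, hκ]
  set AK := A.map (algebraMap (Polynomial ℂ) K) with hAK
  have hKi : Function.Injective (algebraMap (Polynomial ℂ) K) := IsFractionRing.injective _ _
  have hAK0 : AK ≠ 0 := (Polynomial.map_ne_zero_iff hKi).2 hA
  have hroot : ∀ r : Ω, (A.map (evalField p Ω)).IsRoot r ↔ Polynomial.aeval r AK = 0 := by
    intro r
    rw [Polynomial.IsRoot, ← hmap, Polynomial.eval_map_algebraMap]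
  have hint : IsIntegral K μ := IsAlgebraic.isIntegral ⟨AK, hAK0, (hroot μ).1 hμ⟩
  have hdvd : minpoly K μ ∣ AK := minpoly.dvd K μ ((hroot μ).1 hμ)
  obtain ⟨Δ, hΔ⟩ := exists_algebraMap_eq_sq hint hμ0 fun r hr =>
    hAmin.exists_rat hp hμ0 hμ ((hroot r).2 (by
      obtain ⟨f, hf⟩ := hdvd
      rw [hf, map_mul, hr, zero_mul]))
  obtain ⟨B, hB⟩ := hdvd
  obtain ⟨h, hh⟩ := minpoly.dvd K μ (p := Polynomial.X ^ 2 - Polynomial.C Δ) (by simp [hΔ])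
  obtain ⟨N, M, hM, hNM⟩ := IsFractionRing.div_surjective (A := Polynomial ℂ) Δ
  have hM0 : M ≠ 0 := nonZeroDivisors.ne_zero hM
  have hM0' : algebraMap (Polynomial ℂ) K M ≠ 0 := (map_ne_zero_iff _ hKi).2 hM0
  obtain ⟨b, B', hb, hB'⟩ := exists_map_eq_C_mul (R := Polynomial ℂ) B
  obtain ⟨s, h', hs, hh'⟩ := exists_map_eq_C_mul (R := Polynomial ℂ) h
  have hBK0 : B ≠ 0 := right_ne_zero_of_mul (hB ▸ hAK0)
  have hB'0 : B' ≠ 0 := by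
    rintro rfl
    rw [Polynomial.map_zero, eq_comm, mul_eq_zero, Polynomial.C_eq_zero,
      map_eq_zero_iff _ hKi] at hB'
    exact hB'.elim hb hBK0
  have hrel : Polynomial.C s * ((Polynomial.C M * Polynomial.X ^ 2 - Polynomial.C N) * B') =
      (Polynomial.C (M * b) * h') * A := by
    apply Polynomial.map_injective _ hKi
    simp only [Polynomial.map_mul, Polynomial.map_sub, Polynomial.map_C, Polynomial.map_pow,
      Polynomial.map_X, hB', hh', ← hAK, map_mul]
    have h1 : algebraMap (Polynomial ℂ) K N = algebraMap (Polynomial ℂ) K M * Δ := by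
      rw [← hNM]
      field_simp
    rw [h1, hB, map_mul Polynomial.C]
    linear_combination (Polynomial.C (algebraMap _ K s) * Polynomial.C (algebraMap _ K M) *
      Polynomial.C (algebraMap _ K b) * B) * hh
  refine ⟨opEval p B' u, M, N, fun h0 => ?_, hM0, ?_, ?_⟩
  · have h1 := hAmin.eq_zero_of_degree_lt (B'.map (evalField p Ω)) (by
      rw [Polynomial.degree_map_eq_of_injective hθi, Polynomial.degree_map_eq_of_injective hθi,
        ← Polynomial.degree_map_eq_of_injective hKi B', hB',
        ← Polynomial.degree_map_eq_of_injective hKi A, ← hAK, hB, Polynomial.degree_mul,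
        Polynomial.degree_mul, Polynomial.degree_C ((map_ne_zero_iff _ hKi).2 hb), zero_add,
        Polynomial.degree_eq_natDegree hBK0,
        Polynomial.degree_eq_natDegree (minpoly.ne_zero hint)]
      have := minpoly.natDegree_pos hint
      norm_cast
      omega) (by rw [aeval_map_derivative_taylor, h0, map_zero])
    exact (Polynomial.map_ne_zero_iff hθi).2 hB'0 h1
  · rintro rfl
    rw [map_zero, zero_div] at hNM
    rw [← hNM, map_zero] at hΔ
    exact pow_ne_zero 2 hμ0 hΔ.symm
  · have h1 := congrArg (fun f => opEval p f u) hrel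
    simp only [opEval_mul_apply _ A, hu, map_zero] at h1
    rw [opEval_mul_apply, opEval_C_apply] at h1
    have h2 := (mul_eq_zero.1 h1).resolve_left fun h0 => hs (eq_zero_of_aeval_eq_zero hp h0)
    rw [opEval_mul_apply, map_sub, LinearMap.sub_apply, sub_eq_zero, opEval_mul_apply,
      opEval_C_apply, opEval_C_apply, opEval_X_pow_apply] at h2
    exact h2

/-- If some polynomial is not killed by any power of the derivation, then there is an eigenvector
for its square. -/
theorem exists_sq_eigenvector (hp : ∀ c, p ≠ C c) (hprime : ∀ z, Prime (p - C z)) {u : P}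
    (hu : ∃ g, g ≠ 0 ∧ opEval p g u = 0) (hnil : ∀ n, (jac p)^[n] u ≠ 0) :
    ∃ (q : P) (M N : Polynomial ℂ), q ≠ 0 ∧ M ≠ 0 ∧ N ≠ 0 ∧
      Polynomial.aeval p M * jac p (jac p q) = Polynomial.aeval p N * q := by
  let Ω := AlgebraicClosure (FractionRing P)
  have hinj : Function.Injective (algebraMap P Ω) := by
    rw [IsScalarTower.algebraMap_eq P (FractionRing P) Ω]
    exact (algebraMap _ Ω).injective.comp (IsFractionRing.injective P (FractionRing P))
  have : FaithfulSMul P Ω := (faithfulSMul_iff_algebraMap_injective P Ω).2 hinj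
  have hθi : Function.Injective (evalField p Ω) := evalField_injective hp
  obtain ⟨g, hg, hgu⟩ := hu
  obtain ⟨m, hm⟩ := exists_isMinimalAnnihilator (p := p) (u := u) (g := g.map (evalField p Ω))
    ((Polynomial.map_ne_zero_iff hθi).2 hg) (by rw [aeval_map_derivative_taylor, hgu, map_zero])
  obtain ⟨A, hA, hAm, hAu⟩ := hm.exists_opEval_eq_zero (FractionRing P) hprime
  have hAmin : IsMinimalAnnihilator p u (A.map (evalField p Ω)) :=
    ⟨(Polynomial.map_ne_zero_iff hθi).2 hA, by rw [aeval_map_derivative_taylor, hAu, map_zero],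
      fun f hf => hm.eq_zero_of_degree_lt f (hf.trans_le (Polynomial.degree_map_le.trans hAm))⟩
  obtain ⟨μ, hμ0, hμ⟩ := exists_isRoot_map_evalField (Ω := Ω) hp hnil hA hAu
  let κ : FractionRing (Polynomial ℂ) →+* Ω := IsFractionRing.lift hθi
  let _ : Algebra (FractionRing (Polynomial ℂ)) Ω := κ.toAlgebra
  exact hAmin.exists_sq_eigenvector (FractionRing (Polynomial ℂ))
    (RingHom.ext fun h => IsFractionRing.lift_algebraMap hθi h) hp hA hAu hμ0 hμ

end SquareEigenvector

section SquareDescent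

variable {p : P}

lemma totalDegree_add_C (p : P) (c : ℂ) : (p + C c).totalDegree = p.totalDegree := by
  refine le_antisymm ?_ ?_
  · simpa using totalDegree_add p (C c)
  · have := totalDegree_sub_C_le (p + C c) c
    rwa [add_sub_cancel_right] at this

lemma totalDegree_sub_C (p : P) (c : ℂ) : (p - C c).totalDegree = p.totalDegree := by
  rw [sub_eq_add_neg, ← C_neg, totalDegree_add_C]

lemma jac_add_C (p : P) (c : ℂ) : jac (p + C c) = jac p := by
  ext i : 1
  simp [jac_apply]

lemma totalDegree_sub_C_mul (hp : ∀ c, p ≠ C c) (z : ℂ) {a : P} (ha : a ≠ 0) :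
    ((p - C z) * a).totalDegree = p.totalDegree + a.totalDegree := by
  rw [totalDegree_mul_of_isDomain (sub_ne_zero.2 (hp z)) ha, totalDegree_sub_C]

lemma sub_C_dvd_aeval_sub (p : P) (h : Polynomial ℂ) (z : ℂ) :
    p - C z ∣ Polynomial.aeval p h - C (h.eval z) := by
  obtain ⟨g, hg⟩ := Polynomial.X_sub_C_dvd_sub_C_eval (p := h) (a := z)
  refine ⟨Polynomial.aeval p g, ?_⟩
  have := congrArg (Polynomial.aeval p) hg
  simpa [algebraMap_eq] using this

lemma natDegree_mul_totalDegree_le (hp : ∀ c, p ≠ C c) {h : Polynomial ℂ} (hh : h ≠ 0) :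
    h.natDegree * p.totalDegree ≤ (Polynomial.aeval p h).totalDegree := by
  induction hn : h.natDegree generalizing h with
  | zero => simp
  | succ n ih =>
    obtain ⟨z, hz⟩ := IsAlgClosed.exists_root h (by
      rw [Polynomial.degree_eq_natDegree hh, hn]
      exact_mod_cast n.succ_ne_zero)
    obtain ⟨g, rfl⟩ := Polynomial.dvd_iff_isRoot.2 hz
    have hg := right_ne_zero_of_mul hh
    rw [Polynomial.natDegree_mul (Polynomial.X_sub_C_ne_zero z) hg,
      Polynomial.natDegree_X_sub_C] at hn
    have h1 := ih hg (by omega)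
    have h2 : Polynomial.aeval p (Polynomial.X - Polynomial.C z) = p - C z := by simp
    rw [map_mul, h2, totalDegree_sub_C_mul hp z fun h0 => hg (eq_zero_of_aeval_eq_zero hp h0)]
    linarith

lemma not_sub_C_dvd_C (hprime : ∀ z, Prime (p - C z)) (z : ℂ) {c : ℂ} (hc : c ≠ 0) :
    ¬ p - C z ∣ C c := fun h =>
  (hprime z).not_isUnit (isUnit_of_dvd_unit h ((isUnit_iff_ne_zero.2 hc).map C))

lemma exists_jac_jac_eq_aeval_mul (hp : ∀ c, p ≠ C c) (hprime : ∀ z, Prime (p - C z)) {q : P}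
    {M N : Polynomial ℂ} (hq : q ≠ 0) (hM : M ≠ 0) (hN : N ≠ 0)
    (h : Polynomial.aeval p M * jac p (jac p q) = Polynomial.aeval p N * q) :
    ∃ (q : P) (N : Polynomial ℂ), q ≠ 0 ∧ N ≠ 0 ∧
      jac p (jac p q) = Polynomial.aeval p N * q := by
  induction hn : M.natDegree + q.totalDegree using Nat.strong_induction_on
    generalizing M N q with
  | _ n ih =>
    by_cases hdeg : M.natDegree = 0
    · rw [Polynomial.eq_C_of_natDegree_eq_zero hdeg] at h hM
      have hm : M.coeff 0 ≠ 0 := fun h0 => hM (by rw [h0, Polynomial.C_0])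
      refine ⟨q, Polynomial.C (M.coeff 0)⁻¹ * N, hq,
        mul_ne_zero (Polynomial.C_ne_zero.2 (inv_ne_zero hm)) hN, ?_⟩
      rw [map_mul, mul_assoc, ← h]
      simp only [Polynomial.aeval_C, algebraMap_eq]
      rw [← mul_assoc, ← C_mul, inv_mul_cancel₀ hm, C_1, one_mul]
    · obtain ⟨z, hz⟩ := IsAlgClosed.exists_root M
        fun h0 => hdeg (Polynomial.natDegree_eq_of_degree_eq_some h0)
      obtain ⟨M', rfl⟩ := Polynomial.dvd_iff_isRoot.2 hz
      have hM' := right_ne_zero_of_mul hM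
      have h2 : Polynomial.aeval p (Polynomial.X - Polynomial.C z) = p - C z := by simp
      have hpz : p - C z ≠ 0 := (hprime z).ne_zero
      rw [Polynomial.natDegree_mul (Polynomial.X_sub_C_ne_zero z) hM',
        Polynomial.natDegree_X_sub_C] at hn
      rw [map_mul, h2] at h
      by_cases hNz : N.IsRoot z
      · obtain ⟨N', rfl⟩ := Polynomial.dvd_iff_isRoot.2 hNz
        rw [map_mul, h2, mul_assoc, mul_assoc] at h
        exact ih _ (by omega) hq hM' (right_ne_zero_of_mul hN) (mul_left_cancel₀ hpz h) rfl
      · have hdvd : p - C z ∣ Polynomial.aeval p N * q := by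
          rw [← h, mul_assoc]
          exact dvd_mul_right _ _
        rcases (hprime z).dvd_or_dvd hdvd with hd | ⟨q', rfl⟩
        · exact absurd ((dvd_sub_right hd).1 (sub_C_dvd_aeval_sub p N z))
            (not_sub_C_dvd_C hprime z hNz)
        · have hq' := right_ne_zero_of_mul hq
          rw [jac_sub_C_mul, jac_sub_C_mul] at h
          rw [totalDegree_sub_C_mul hp z hq'] at hn
          have hd := one_le_totalDegree hp
          refine ih _ ?_ hq' hM hN (mul_left_cancel₀ hpz ?_) rfl
          · rw [Polynomial.natDegree_mul (Polynomial.X_sub_C_ne_zero z) hM',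
              Polynomial.natDegree_X_sub_C]
            omega
          · rw [map_mul, h2]
            linear_combination h

lemma false_of_jac_jac_eq_C_mul (hprime : ∀ z, Prime (p - C z)) {q : P} (hq : q ≠ 0) {μ : ℂ}
    (hμ : μ ≠ 0) (h : jac p (jac p q) = C (μ ^ 2) * q) : False := by
  have key : ∀ ν : ℂ, ν ≠ 0 → ∀ z, jac p z = C ν * z → z = 0 := by
    intro ν hν z hz
    obtain ⟨f, rfl⟩ := exists_eq_aeval_of_dvd_jac hprime (Dvd.intro_left (C ν) hz.symm)
    rw [jac_aeval_self, eq_comm, mul_eq_zero, C_eq_zero] at hz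
    exact hz.resolve_left hν
  rw [C_pow] at h
  have h1 := key μ hμ (jac p q + C μ * q) (by
    simp only [map_add, h, Derivation.leibniz, jac_C, smul_eq_mul]
    ring)
  have h2 := key (-μ) (neg_ne_zero.2 hμ) (jac p q - C μ * q) (by
    simp only [map_sub, h, Derivation.leibniz, jac_C, smul_eq_mul, C_neg]
    ring)
  have h3 : C (2 * μ) * q = 0 := by
    rw [C_mul, map_ofNat]
    linear_combination h1 - h2
  rw [mul_eq_zero, C_eq_zero] at h3
  exact h3.elim (mul_ne_zero two_ne_zero hμ) hq

lemma exists_C_sq_mul_sq_of_mul_eq_sq {a b r : P} {c : ℂ} (hc : c ≠ 0) {f : P}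
    (hab : b - f * a = C c) (h : a * b = r ^ 2) : ∃ s t : P, a = s ^ 2 ∧ b = t ^ 2 := by
  let _ : GCDMonoid P := UniqueFactorizationMonoid.toGCDMonoid P
  have hsq : ∀ {a d : P}, Associated (d ^ 2) a → ∃ s, a = s ^ 2 := by
    rintro a d ⟨u, rfl⟩
    obtain ⟨e, -, he⟩ := isUnit_iff_exists_eq_C.1 u.isUnit
    obtain ⟨y, rfl⟩ := IsAlgClosed.exists_pow_nat_eq e two_pos
    exact ⟨d * C y, by rw [he, C_pow]; ring⟩
  have hu : IsUnit (gcd a b) := isUnit_of_dvd_unit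
    (hab ▸ dvd_sub (gcd_dvd_right a b) ((gcd_dvd_left a b).mul_left f))
    ((isUnit_iff_ne_zero.2 hc).map C)
  obtain ⟨d, hd⟩ := exists_associated_pow_of_mul_eq_pow hu h
  obtain ⟨e, he⟩ := exists_associated_pow_of_mul_eq_pow
    ((gcd_comm' a b).isUnit_iff.1 hu) (mul_comm a b ▸ h)
  obtain ⟨s, hs⟩ := hsq hd
  obtain ⟨t, ht⟩ := hsq he
  exact ⟨s, t, hs, ht⟩

end SquareDescent

section TwistedDescent

variable {p : P}

/-- The quantity decreasing along the descent. -/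
noncomputable def descentHeight (p q : P) : ℕ :=
  max (2 * q.totalDegree + p.totalDegree) (2 * (jac p q).totalDegree)

lemma totalDegree_C_mul_le (c : ℂ) (u : P) : (C c * u).totalDegree ≤ u.totalDegree := by
  simpa using totalDegree_mul (C c) u

lemma jac_jac_mul_self (p q : P) : jac p (p * q) = p * jac p q := by
  simp [Derivation.leibniz, jac_self]

/-- The descent step for the equation `D² q = c p q`. -/
lemma exists_descent_zero (hp : ∀ c, p ≠ C c)
    (hker : ∀ u, jac p u = 0 → ∃ h : Polynomial ℂ, u = Polynomial.aeval p h)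
    (hprime : ∀ z, Prime (p - C z)) {q : P} {c : ℂ} (hc : c ≠ 0) (hq : jac p q ≠ 0)
    (h : jac p (jac p q) = C c * p * q) :
    ∃ (q' : P) (h' : ℂ), jac p q' ≠ 0 ∧ jac p (jac p q') = C c * p * q' + C h' ∧
      descentHeight p q' < descentHeight p q := by
  have hq0 : q ≠ 0 := by
    rintro rfl
    exact hq (map_zero _)
  obtain ⟨κ, hκ⟩ := hker (jac p q ^ 2 - C c * p * q ^ 2) (by
    simp only [map_sub, Derivation.leibniz, Derivation.leibniz_pow, h, jac_C, jac_self,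
      smul_eq_mul, nsmul_eq_mul]
    push_cast
    ring)
  obtain ⟨w, hw⟩ := IsAlgClosed.exists_pow_nat_eq (κ.eval 0) two_pos
  have hpd : p ∣ (jac p q - C w) * (jac p q - C (-w)) := by
    obtain ⟨g, hg⟩ := sub_C_dvd_aeval_sub p κ 0
    refine ⟨C c * q ^ 2 + g, ?_⟩
    rw [← hκ, ← hw, C_0, C_pow] at hg
    rw [C_neg]
    linear_combination hg
  obtain ⟨w, r, hr⟩ : ∃ w r, jac p q - C w = p * r := by
    have hpp : Prime p := by simpa using hprime 0
    rcases hpp.dvd_or_dvd hpd with hd | hd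
    exacts [⟨w, hd⟩, ⟨-w, hd⟩]
  have hp0 : p ≠ 0 := by simpa using hp 0
  have hDr : jac p r = C c * q := by
    have h1 := congrArg (jac p) hr
    rw [map_sub, jac_C, sub_zero, h, jac_jac_mul_self] at h1
    refine mul_left_cancel₀ hp0 ?_
    linear_combination -h1
  have hr0 : jac p r ≠ 0 := by
    rw [hDr]
    exact mul_ne_zero (by simpa using hc) hq0
  refine ⟨r, c * w, hr0, ?_, ?_⟩
  · rw [hDr, Derivation.leibniz, jac_C, smul_zero, add_zero, smul_eq_mul, C_mul]
    linear_combination C c * hr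
  · have hdeg : p.totalDegree + r.totalDegree ≤ (jac p q).totalDegree := by
      rw [← totalDegree_mul_of_isDomain hp0 (fun h0 => hr0 (by rw [h0, map_zero])), ← hr]
      exact totalDegree_sub_C_le _ _
    have hdeg' : (jac p r).totalDegree ≤ q.totalDegree := hDr ▸ totalDegree_C_mul_le c q
    have := one_le_totalDegree hp
    rw [descentHeight, descentHeight]
    omega

/-- The descent step for `D² q = c p q + h` when `(D q)² = q (c p q + 2 h)`. -/
lemma exists_descent_sq {q : P} {c h : ℂ} (hc : c ≠ 0) (hh : h ≠ 0)
    (hq : jac p q ≠ 0) (hsq : jac p q ^ 2 = q * (C c * p * q + C (2 * h))) :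
    ∃ (q' : P) (c' : ℂ), c' ≠ 0 ∧ jac p q' ≠ 0 ∧ jac p (jac p q') = C c' * p * q' ∧
      descentHeight p q' < descentHeight p q := by
  have hqC : ∀ e, q ≠ C e := by
    rintro e rfl
    exact hq (jac_C p e)
  obtain ⟨s, t, hs, ht⟩ := exists_C_sq_mul_sq_of_mul_eq_sq (mul_ne_zero two_ne_zero hh)
    (f := C c * p) (add_sub_cancel_left (C c * p * q) _) hsq.symm
  obtain ⟨t, ht, hst⟩ : ∃ t, C c * p * q + C (2 * h) = t ^ 2 ∧ jac p q = s * t := by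
    have h1 : jac p q ^ 2 = (s * t) ^ 2 := by rw [hsq, ht, mul_pow, ← hs]
    rcases sq_eq_sq_iff_eq_or_eq_neg.1 h1 with h2 | h2
    · exact ⟨t, ht, h2⟩
    · exact ⟨-t, by rw [ht, neg_sq], by rw [h2, mul_neg]⟩
  have hs0 : s ≠ 0 := by
    rintro rfl
    exact hq (by rw [hst, zero_mul])
  have ht0 : t ≠ 0 := by
    rintro rfl
    exact hq (by rw [hst, mul_zero])
  have hDs : jac p s = C 2⁻¹ * t := by
    have h1 := hst
    rw [hs, Derivation.leibniz_pow] at h1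
    have h2 : C (2⁻¹ : ℂ) * 2 = (1 : P) := by
      rw [← map_ofNat C 2, ← C_mul, inv_mul_cancel₀ two_ne_zero, C_1]
    simp only [smul_eq_mul, nsmul_eq_mul] at h1
    push_cast at h1
    refine mul_left_cancel₀ hs0 ?_
    linear_combination C 2⁻¹ * h1 - s * jac p s * h2
  have hDt : jac p t = C 2⁻¹ * (C c * p * s) := by
    have h1 := congrArg (jac p) ht
    rw [map_add, jac_C, add_zero, mul_assoc, Derivation.leibniz, jac_C, smul_zero, add_zero,
      jac_jac_mul_self, hst, Derivation.leibniz_pow] at h1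
    have h2 : C (2⁻¹ : ℂ) * 2 = (1 : P) := by
      rw [← map_ofNat C 2, ← C_mul, inv_mul_cancel₀ two_ne_zero, C_1]
    simp only [smul_eq_mul, nsmul_eq_mul] at h1
    push_cast at h1
    refine mul_left_cancel₀ ht0 ?_
    linear_combination -C 2⁻¹ * h1 - t * jac p t * h2
  have h2 : (2⁻¹ : ℂ) ≠ 0 := inv_ne_zero two_ne_zero
  refine ⟨s, 2⁻¹ * (2⁻¹ * c), mul_ne_zero h2 (mul_ne_zero h2 hc), ?_, ?_, ?_⟩
  · rw [hDs]
    exact mul_ne_zero (by simp) ht0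
  · rw [hDs, Derivation.leibniz, jac_C, smul_zero, add_zero, hDt, smul_eq_mul, C_mul, C_mul]
    ring
  · have h3 : (jac p s).totalDegree ≤ t.totalDegree := hDs ▸ totalDegree_C_mul_le _ _
    have h4 : q.totalDegree = s.totalDegree + s.totalDegree := by
      rw [hs, sq, totalDegree_mul_of_isDomain hs0 hs0]
    have h5 : t.totalDegree + t.totalDegree ≤ p.totalDegree + q.totalDegree := by
      rw [← totalDegree_mul_of_isDomain ht0 ht0, ← sq, ← ht, totalDegree_add_C, mul_assoc]
      exact (totalDegree_C_mul_le _ _).trans (totalDegree_mul _ _)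
    have h6 := one_le_totalDegree hqC
    rw [descentHeight, descentHeight]
    omega

/-- The descent step for `D² q = c p q + h` when `(D q)² - c p q² - 2 h q` is nonzero. -/
lemma exists_descent_ne_zero (hp : ∀ c, p ≠ C c) (hprime : ∀ z, Prime (p - C z)) {q : P} {c h : ℂ}
    (hc : c ≠ 0) (hh : h ≠ 0) (hD : jac p (jac p q) = C c * p * q + C h) {κ : Polynomial ℂ}
    (hκ0 : κ ≠ 0) (hκ : jac p q ^ 2 - C c * p * q ^ 2 - C (2 * h) * q = Polynomial.aeval p κ) :
    ∃ (q' : P) (h' : ℂ), jac p q' ≠ 0 ∧ jac p (jac p q') = C c * p * q' + C h' ∧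
      descentHeight p q' < descentHeight p q := by
  let F : Polynomial ℂ := Polynomial.C (h ^ 2) - Polynomial.X * (Polynomial.C c * κ)
  have hF : F.degree ≠ 0 := by
    have h1 : 0 < (Polynomial.X * (Polynomial.C c * κ)).degree := by
      rw [Polynomial.degree_mul, Polynomial.degree_C_mul hc, Polynomial.degree_X,
        Polynomial.degree_eq_natDegree hκ0]
      norm_cast
      omega
    rw [Polynomial.degree_sub_eq_right_of_degree_lt (Polynomial.degree_C_le.trans_lt h1)]
    exact h1.ne'
  obtain ⟨z, hz⟩ := IsAlgClosed.exists_root F hF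
  have hFz : h ^ 2 = z * (c * κ.eval z) := by
    simpa [F, Polynomial.IsRoot, sub_eq_zero] using hz
  obtain ⟨w, hw⟩ := IsAlgClosed.exists_pow_nat_eq (c * z) two_pos
  obtain ⟨w, hw, q', hq'⟩ : ∃ w, w ^ 2 = c * z ∧
      p - C z ∣ C (c * z) * q + C h - C w * jac p q := by
    have hd : p - C z ∣ (C (c * z) * q + C h - C w * jac p q) *
        (C (c * z) * q + C h - C (-w) * jac p q) := by
      obtain ⟨g, hg⟩ := sub_C_dvd_aeval_sub p κ z
      have hw' : (C w : P) ^ 2 = C c * C z := by rw [← C_pow, hw, C_mul]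
      have hF' : (C h : P) ^ 2 = C z * (C c * C (κ.eval z)) := by rw [← C_pow, hFz, C_mul, C_mul]
      rw [← hκ, C_mul, map_ofNat] at hg
      refine ⟨-C c * C z * (C c * q ^ 2 + g), ?_⟩
      rw [C_neg, C_mul]
      linear_combination hF' - jac p q ^ 2 * hw' - C c * C z * hg
    rcases (hprime z).dvd_or_dvd hd with hd | hd
    exacts [⟨w, hw, hd⟩, ⟨-w, by rw [neg_sq, hw], hd⟩]
  have hpz : p - C z ≠ 0 := (hprime z).ne_zero
  have hD1 : (p - C z) * jac p q' = C (c * z) * jac p q - C w * (C c * p * q + C h) := by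
    rw [← jac_sub_C_mul, ← hq']
    simp only [map_sub, map_add, Derivation.leibniz, jac_C, hD, smul_eq_mul]
    ring
  have hD2 : jac p (jac p q') = C c * p * q' + C (-(c * h)) := by
    refine mul_left_cancel₀ hpz ?_
    rw [← jac_sub_C_mul, hD1]
    simp only [map_sub, map_add, Derivation.leibniz, jac_C, jac_self, hD, smul_eq_mul, C_mul, C_neg]
    rw [C_mul] at hq'
    linear_combination C c * p * hq'
  have hq0 : jac p q' ≠ 0 := by
    intro h0
    rw [h0, map_zero] at hD2
    refine not_sub_C_dvd_C hprime 0 hh ⟨q', mul_left_cancel₀ (C_ne_zero.2 hc) ?_⟩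
    rw [C_neg, C_mul] at hD2
    rw [C_0]
    linear_combination hD2
  refine ⟨q', _, hq0, hD2, ?_⟩
  have h1 := totalDegree_sub_C_mul hp z (a := q') fun h0 => hq0 (by rw [h0, map_zero])
  have h2 := totalDegree_sub_C_mul hp z hq0
  have h3 : (C (c * z) * q + C h - C w * jac p q).totalDegree ≤
      max q.totalDegree (jac p q).totalDegree := by
    refine (totalDegree_sub _ _).trans (max_le_max ?_ (totalDegree_C_mul_le _ _))
    rw [totalDegree_add_C]
    exact totalDegree_C_mul_le _ _
  have h4 : (C (c * z) * jac p q - C w * (C c * p * q + C h)).totalDegree ≤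
      max (jac p q).totalDegree (p.totalDegree + q.totalDegree) := by
    refine (totalDegree_sub _ _).trans (max_le_max (totalDegree_C_mul_le _ _) ?_)
    refine (totalDegree_C_mul_le _ _).trans ?_
    rw [totalDegree_add_C, mul_assoc]
    exact (totalDegree_C_mul_le _ _).trans (totalDegree_mul _ _)
  rw [← hq'] at h1
  rw [hD1] at h2
  have := one_le_totalDegree hp
  rw [descentHeight, descentHeight]
  omega

theorem jac_eq_zero_of_jac_jac_eq (hp : ∀ c, p ≠ C c)
    (hker : ∀ u, jac p u = 0 → ∃ h : Polynomial ℂ, u = Polynomial.aeval p h)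
    (hprime : ∀ z, Prime (p - C z)) {q : P} {c h : ℂ} (hc : c ≠ 0)
    (hD : jac p (jac p q) = C c * p * q + C h) : jac p q = 0 := by
  induction hn : descentHeight p q using Nat.strong_induction_on generalizing q c h with
  | _ n ih =>
    subst hn
    by_contra hq
    by_cases hh : h = 0
    · obtain ⟨q', h', hq', hD', hlt⟩ := exists_descent_zero hp hker hprime hc hq
        (by rw [hD, hh, C_0, add_zero])
      exact hq' (ih _ hlt hc hD' rfl)
    obtain ⟨κ, hκ⟩ := hker (jac p q ^ 2 - C c * p * q ^ 2 - C (2 * h) * q) (by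
      simp only [map_sub, Derivation.leibniz, Derivation.leibniz_pow, hD, jac_C, jac_self,
        smul_eq_mul, nsmul_eq_mul]
      rw [C_mul, map_ofNat]
      push_cast
      ring)
    by_cases hκ0 : κ = 0
    · rw [hκ0, map_zero] at hκ
      obtain ⟨q', c', hc', hq', hD', hlt⟩ := exists_descent_sq hc hh hq
        (by linear_combination hκ)
      exact hq' (ih _ hlt hc' (h := 0) (by rw [hD', C_0, add_zero]) rfl)
    · obtain ⟨q', h', hq', hD', hlt⟩ := exists_descent_ne_zero hp hprime hc hh hD hκ0 hκ
      exact hq' (ih _ hlt hc hD' rfl)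

/-- The derivation `jac p` is locally finite over `ℂ(p)` only if it is locally nilpotent. -/
theorem exists_iterate_jac_eq_zero (hp : ∀ c, p ≠ C c)
    (hker : ∀ u, jac p u = 0 → ∃ h : Polynomial ℂ, u = Polynomial.aeval p h)
    (hprime : ∀ z, Prime (p - C z)) {u : P} (hu : ∃ g, g ≠ 0 ∧ opEval p g u = 0) :
    ∃ n, (jac p)^[n] u = 0 := by
  by_contra! hnil
  obtain ⟨q, M, N, hq, hM, hN, h⟩ := exists_sq_eigenvector hp hprime hu hnil
  obtain ⟨q, N, hq, hN, h⟩ := exists_jac_jac_eq_aeval_mul hp hprime hq hM hN h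
  have hNp : Polynomial.aeval p N ≠ 0 := fun h0 => hN (eq_zero_of_aeval_eq_zero hp h0)
  have hDD : jac p (jac p q) ≠ 0 := by
    rw [h]
    exact mul_ne_zero hNp hq
  have hDq : jac p q ≠ 0 := by
    intro h0
    exact hDD (by rw [h0, map_zero])
  have hdeg : N.natDegree < 2 := by
    have h1 := totalDegree_jac_lt hDD
    have h2 := totalDegree_jac_lt hDq
    have h3 := natDegree_mul_totalDegree_le hp hN
    rw [h, totalDegree_mul_of_isDomain hNp hq] at h1
    by_contra! h4
    have h5 := Nat.mul_le_mul_right p.totalDegree h4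
    omega
  have hN' := Polynomial.eq_X_add_C_of_natDegree_le_one (Nat.lt_succ_iff.1 hdeg)
  set c := N.coeff 1
  set e := N.coeff 0
  by_cases hc : c = 0
  · rw [hc, Polynomial.C_0, zero_mul, zero_add] at hN'
    obtain ⟨μ, hμ⟩ := IsAlgClosed.exists_pow_nat_eq e two_pos
    rw [hN', ← hμ, Polynomial.aeval_C, algebraMap_eq] at h
    refine false_of_jac_jac_eq_C_mul hprime hq ?_ h
    rintro rfl
    rw [zero_pow two_ne_zero] at hμ
    exact hN (by rw [hN', ← hμ, Polynomial.C_0])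
  · have hshift : Polynomial.aeval p N = C c * (p + C (c⁻¹ * e)) := by
      rw [hN', mul_add, ← C_mul, mul_inv_cancel_left₀ hc]
      simp [algebraMap_eq]
    have hsub : ∀ z, p + C (c⁻¹ * e) - C z = p - C (z - c⁻¹ * e) := fun z => by
      rw [C_sub]
      ring
    have hp' : ∀ z, p + C (c⁻¹ * e) ≠ C z := fun z => by
      rw [← sub_ne_zero, hsub]
      exact (hprime _).ne_zero
    refine hDq ?_
    rw [← jac_add_C p (c⁻¹ * e)] at h ⊢
    refine jac_eq_zero_of_jac_jac_eq hp' (fun v hv => ?_) (fun z => hsub z ▸ hprime _) hc (h := 0)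
      (by rw [h, hshift, C_0, add_zero])
    rw [jac_add_C] at hv
    obtain ⟨f, rfl⟩ := hker v hv
    refine ⟨f.comp (Polynomial.X - Polynomial.C (c⁻¹ * e)), ?_⟩
    rw [Polynomial.aeval_comp]
    simp [algebraMap_eq]

end TwistedDescent

section Slice

variable {p : P}

lemma exists_jac_eq_aeval_of_isRoot (hprime : ∀ z, Prime (p - C z)) {q : P} {z : ℂ}
    {g : Polynomial ℂ} (hq : jac p q = (p - C z) * Polynomial.aeval p g) :
    ∃ q', jac p q' = Polynomial.aeval p g := by
  obtain ⟨c, q', hq'⟩ := (hprime z).exists_dvd_sub_C_of_dvd_jac (u := q)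
    ⟨-Polynomial.aeval p g, by rw [map_sub, jac_C, sub_zero, jac_comm, hq, mul_neg]⟩
  refine ⟨q', mul_left_cancel₀ (hprime z).ne_zero ?_⟩
  rw [← jac_sub_C_mul, ← hq', map_sub, jac_C, sub_zero, hq]

lemma exists_jac_eq_one_of_jac_eq_aeval (hprime : ∀ z, Prime (p - C z)) {q : P}
    {h : Polynomial ℂ} (hh : h ≠ 0) (hq : jac p q = Polynomial.aeval p h) :
    ∃ q, jac p q = 1 := by
  induction hn : h.natDegree generalizing q h with
  | zero =>
    rw [Polynomial.eq_C_of_natDegree_eq_zero hn] at hh hq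
    refine ⟨C (h.coeff 0)⁻¹ * q, ?_⟩
    rw [Derivation.leibniz, jac_C, hq, smul_zero, add_zero, Polynomial.aeval_C, algebraMap_eq,
      smul_eq_mul, ← C_mul, inv_mul_cancel₀ (Polynomial.C_ne_zero.1 hh), C_1]
  | succ n ih =>
    obtain ⟨z, hz⟩ := IsAlgClosed.exists_root h (by
      rw [Polynomial.degree_eq_natDegree hh, hn]
      exact_mod_cast n.succ_ne_zero)
    obtain ⟨g, rfl⟩ := Polynomial.dvd_iff_isRoot.2 hz
    have hg := right_ne_zero_of_mul hh
    rw [Polynomial.natDegree_mul (Polynomial.X_sub_C_ne_zero z) hg,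
      Polynomial.natDegree_X_sub_C] at hn
    have h2 : Polynomial.aeval p (Polynomial.X - Polynomial.C z) = p - C z := by simp
    rw [map_mul, h2] at hq
    obtain ⟨q', hq'⟩ := exists_jac_eq_aeval_of_isRoot hprime hq
    exact ih hg hq' (by omega)

lemma exists_jac_eq_one (hp : ∀ c, p ≠ C c)
    (hker : ∀ u, jac p u = 0 → ∃ h : Polynomial ℂ, u = Polynomial.aeval p h)
    (hprime : ∀ z, Prime (p - C z)) (hnil : ∀ u, ∃ n, (jac p)^[n] u = 0) :
    ∃ q, jac p q = 1 := by
  obtain ⟨v, hv⟩ : ∃ v, jac p v ≠ 0 := by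
    by_contra! h
    obtain ⟨c, hc⟩ := eq_C_of_jac_X_eq_zero fun i => h (X i)
    exact hp c hc
  obtain ⟨n, hn⟩ := hnil (jac p v)
  induction n generalizing v with
  | zero => exact absurd hn hv
  | succ n ih =>
    by_cases h0 : jac p (jac p v) = 0
    · obtain ⟨h, hh⟩ := hker _ h0
      refine exists_jac_eq_one_of_jac_eq_aeval hprime (h := h) ?_ hh
      rintro rfl
      exact hv (by rw [hh, map_zero])
    · exact ih (jac p v) h0 (by rwa [Function.iterate_succ_apply] at hn)

lemma iterate_jac_mul_pow {q : P} (hq : jac p q = 1) (n : ℕ) {w : P} (hw : jac p w = 0) :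
    (jac p)^[n] (w * q ^ n) = n.factorial * w := by
  induction n generalizing w with
  | zero => simp
  | succ n ih =>
    have h1 : jac p (w * q ^ (n + 1)) = ((n + 1 : ℕ) * w) * q ^ n := by
      rw [Derivation.leibniz, hw, Derivation.leibniz_pow, hq, smul_zero, add_zero,
        Nat.add_sub_cancel]
      simp only [smul_eq_mul, nsmul_eq_mul, mul_one]
      ring
    rw [Function.iterate_succ_apply, h1, ih (by
      rw [← nsmul_eq_mul, map_nsmul, hw, smul_zero]), Nat.factorial_succ]
    push_cast
    ring

/-- The characteristic-zero Jacobian criterion for injectivity. -/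
theorem injective_of_jac_ne_zero {φ : P →ₐ[ℂ] P} (h : jac (φ (X 0)) (φ (X 1)) ≠ 0) :
    Function.Injective φ := by
  rw [injective_iff_map_eq_zero]
  intro F hF
  induction hn : F.totalDegree using Nat.strong_induction_on generalizing F with
  | _ n ih =>
    have hd (v : P) : φ (jac F v) = 0 := by
      have h1 := jac_algHom φ F v
      rw [hF, jac_apply, map_zero, map_zero, zero_mul, zero_mul, sub_zero, eq_comm] at h1
      exact (mul_eq_zero.1 h1).resolve_right h
    have hp (i : Fin 2) : φ (pderiv i F) = 0 := by
      fin_cases i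
      · have h1 := hd (X 1)
        rwa [jac_X_one] at h1
      · have h1 := hd (X 0)
        rwa [jac_X_zero, map_neg, neg_eq_zero] at h1
    have hF0 (i : Fin 2) : pderiv i F = 0 := by
      by_contra h0
      exact h0 (ih _ (hn ▸ totalDegree_pderiv_lt h0) _ (hp i) rfl)
    obtain ⟨c, rfl⟩ := eq_C_of_pderiv_eq_zero hF0
    rwa [algHom_map_C] at hF

/-- If `jac p` is locally nilpotent and its kernel is generated by `p`, then `p` is a coordinate. -/
theorem isCoordinate_of_forall_exists_iterate_eq_zero (hp : ∀ c, p ≠ C c)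
    (hker : ∀ u, jac p u = 0 → ∃ h : Polynomial ℂ, u = Polynomial.aeval p h)
    (hprime : ∀ z, Prime (p - C z)) (hnil : ∀ u, ∃ n, (jac p)^[n] u = 0) : IsCoordinate p := by
  obtain ⟨q, hq⟩ := exists_jac_eq_one hp hker hprime hnil
  let ψ : P →ₐ[ℂ] P := aeval ![p, q]
  have hψp : p ∈ ψ.range := ⟨X 0, by simp [ψ]⟩
  have hψq : q ∈ ψ.range := ⟨X 1, by simp [ψ]⟩
  have hsurj : Function.Surjective ψ := by
    intro u
    obtain ⟨n, hn⟩ := hnil u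
    suffices h : u ∈ ψ.range from h
    induction n generalizing u with
    | zero =>
      rw [Function.iterate_zero_apply] at hn
      rw [hn]
      exact zero_mem _
    | succ n ih =>
      rw [Function.iterate_succ_apply'] at hn
      obtain ⟨f, hf⟩ := hker _ hn
      have hfψ : Polynomial.aeval p f ∈ ψ.range :=
        Algebra.adjoin_le (Set.singleton_subset_iff.2 hψp)
          (Polynomial.aeval_mem_adjoin_singleton ℂ p)
      have hn0 : (n.factorial : ℂ) ≠ 0 := by exact_mod_cast n.factorial_ne_zero
      set v := C (n.factorial : ℂ)⁻¹ * Polynomial.aeval p f with hv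
      have hvD : jac p v = 0 := by
        rw [hv, Derivation.leibniz, jac_C, jac_aeval_self, smul_zero, smul_zero, add_zero]
      have hvψ : v * q ^ n ∈ ψ.range :=
        mul_mem (mul_mem (algebraMap_mem ψ.range _) hfψ) (pow_mem hψq n)
      have h1 := ih (u - v * q ^ n) (by
        rw [iterate_map_sub, iterate_jac_mul_pow hq n hvD, hf, hv, ← mul_assoc,
          ← map_natCast C, ← C_mul, mul_inv_cancel₀ hn0, C_1, one_mul, sub_self])
      simpa using add_mem h1 hvψ
  have hinj : Function.Injective ψ :=
    injective_of_jac_ne_zero (by simp [ψ, hq])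
  let e : P ≃ₐ[ℂ] P := AlgEquiv.ofBijective ψ ⟨hinj, hsurj⟩
  refine ⟨e.symm, ?_⟩
  rw [AlgEquiv.symm_apply_eq]
  simp [e, ψ]

end Slice

/-- Let `φ` be an injective `ℂ`-algebra endomorphism of `ℂ[x,y]` whose image
contains no coordinate polynomial.  Then
`φ^∞(ℂ[x,y]) = ⋂_{k ≥ 1} φ^k(ℂ[x,y])` equals `ℂ` (the bottom subalgebra). -/
theorem stable_image_trivial (φ : P →ₐ[ℂ] P) (hinj : Function.Injective φ)
    (hnc : ¬∃ q : P, IsCoordinate q ∧ q ∈ φ.range) :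
    (⨅ k : ℕ, ((φ ^ (k + 1) : P →ₐ[ℂ] P).range : Subalgebra ℂ P)) = ⊥ := by
  have hX : X 0 ∉ φ.range := fun h => hnc ⟨X 0, ⟨AlgEquiv.refl, rfl⟩, h⟩
  rw [eq_bot_iff]
  intro b₀ hb₀
  rw [Algebra.mem_bot]
  by_contra hbC
  replace hbC : ∀ c, b₀ ≠ C c := fun c hc => hbC ⟨c, hc.symm⟩
  have hB : ∀ b ∈ stableImage φ, ∀ b' ∈ stableImage φ, jac b b' = 0 := by
    intro b hb b' hb'
    by_contra h
    exact hX (X_mem_range_of_jac_ne_zero hinj hb hb' h 0)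
  obtain ⟨p, hp, hker, a, b, ha, hφp⟩ := exists_algHom_eq_affine hinj hB hb₀ hbC
  obtain ⟨ν, hν⟩ := exists_isDegreeLimit hinj ha hφp hX
  have hprime := hν.prime_sub_C hp hker
  refine hnc ⟨p, isCoordinate_of_forall_exists_iterate_eq_zero hp hker hprime fun u =>
    exists_iterate_jac_eq_zero hp hker hprime (hν.exists_opEval_eq_zero u),
    C a⁻¹ * (p - C b), ?_⟩
  change φ (C a⁻¹ * (p - C b)) = p
  rw [map_mul, map_sub, algHom_map_C, algHom_map_C, hφp, add_sub_cancel_right, ← mul_assoc,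
    ← C_mul, inv_mul_cancel₀ ha, C_1, one_mul]
end

section
/- Let p, q ∈ ℂ[x,y] be algebraically independent polynomials such that the pair (p, q) is elementary reduced, with n = deg(p) < m = deg(q), m, n ≥ 2, and deg(D(p, q)) ≥ k, where D(p, q) is the Jacobian determinant of (p, q). Then every w ∈ ℂ[p, q] which is not a linear combination of p, q and 1 satisfies deg(w) > min(n, k). -/
open MvPolynomial

/-- `ℂ[x,y]` as multivariate polynomials in two variables. -/
local notation "P" => MvPolynomial (Fin 2) ℂ

/-- The Jacobian determinant `D(u,v) = ∂ₓu·∂ᵧv − ∂ᵧu·∂ₓv`. -/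
noncomputable def jacDet (u v : P) : P :=
  pderiv (0 : Fin 2) u * pderiv (1 : Fin 2) v -
    pderiv (1 : Fin 2) u * pderiv (0 : Fin 2) v

/-- A pair `(p, q)` is elementary reduced if the sum of degrees cannot be
decreased by a non-degenerate linear transformation of the pair, nor by a
transformation `(p, q) ↦ (p + μ·q^k, q)` or `(p, q) ↦ (p, q + μ·p^k)`
with `μ ∈ ℂ*`, `k ≥ 2`. -/
def ElementaryReduced (p q : P) : Prop :=
  (∀ a b c d : ℂ, a * d - b * c ≠ 0 →
      p.totalDegree + q.totalDegree ≤
        (C a * p + C b * q).totalDegree + (C c * p + C d * q).totalDegree) ∧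
  (∀ μ : ℂ, μ ≠ 0 → ∀ k : ℕ, 2 ≤ k →
      p.totalDegree + q.totalDegree ≤
        (p + C μ * q ^ k).totalDegree + q.totalDegree) ∧
  (∀ μ : ℂ, μ ≠ 0 → ∀ k : ℕ, 2 ≤ k →
      p.totalDegree + q.totalDegree ≤
        p.totalDegree + (q + C μ * p ^ k).totalDegree)

/-- `F` is the homogeneous component of degree `a` of `f`, and `f` has degree at most `a`.
The degree is an integer: for negative `a` the condition says `f = F = 0`. -/
def IsLead {σ R : Type*} [CommRing R] (a : ℤ) (f F : MvPolynomial σ R) : Prop :=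
  (∀ d, coeff d F ≠ 0 → (d.degree : ℤ) = a) ∧ ∀ d, coeff d (f - F) ≠ 0 → (d.degree : ℤ) < a

namespace IsLead

variable {σ R : Type*} [CommRing R] {a b : ℤ} {f F g G : MvPolynomial σ R}

theorem zero (a : ℤ) : IsLead a (0 : MvPolynomial σ R) 0 := by simp [IsLead]

theorem add (hf : IsLead a f F) (hg : IsLead a g G) : IsLead a (f + g) (F + G) := by
  refine ⟨fun d hd => ?_, fun d hd => ?_⟩
  · by_cases h : coeff d F = 0
    · exact hg.1 d fun h' => hd (by simp [h, h'])
    · exact hf.1 d h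
  · rw [add_sub_add_comm] at hd
    by_cases h : coeff d (f - F) = 0
    · exact hg.2 d fun h' => hd (by rw [coeff_add, h, h', add_zero])
    · exact hf.2 d h

theorem sum {ι : Type*} (s : Finset ι) {f F : ι → MvPolynomial σ R}
    (h : ∀ i ∈ s, IsLead a (f i) (F i)) : IsLead a (∑ i ∈ s, f i) (∑ i ∈ s, F i) := by
  classical
  induction s using Finset.induction_on with
  | empty => simpa using zero a
  | insert i s hi ih =>
    rw [Finset.sum_insert hi, Finset.sum_insert hi]
    exact (h i (by simp)).add (ih fun j hj => h j (by simp [hj]))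

theorem coeff_left (h : IsLead a f F) (d : σ →₀ ℕ) (hd : coeff d f ≠ 0) :
    (d.degree : ℤ) ≤ a := by
  by_cases hF : coeff d F = 0
  · exact (h.2 d (by rwa [coeff_sub, hF, sub_zero])).le
  · exact (h.1 d hF).le

theorem exists_of_coeff_mul_ne_zero {d : σ →₀ ℕ} (h : coeff d (f * g) ≠ 0) :
    ∃ x y, coeff x f ≠ 0 ∧ coeff y g ≠ 0 ∧ d.degree = x.degree + y.degree := by
  classical
  rw [coeff_mul] at h
  obtain ⟨⟨x, y⟩, hxy, hne⟩ := Finset.exists_ne_zero_of_sum_ne_zero h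
  refine ⟨x, y, left_ne_zero_of_mul hne, right_ne_zero_of_mul hne, ?_⟩
  rw [← Finset.HasAntidiagonal.mem_antidiagonal.1 hxy, map_add]

theorem mul (hf : IsLead a f F) (hg : IsLead b g G) : IsLead (a + b) (f * g) (F * G) := by
  refine ⟨fun d hd => ?_, fun d hd => ?_⟩
  · obtain ⟨x, y, hx, hy, h⟩ := exists_of_coeff_mul_ne_zero hd
    have := hf.1 x hx
    have := hg.1 y hy
    omega
  · rw [show f * g - F * G = (f - F) * g + F * (g - G) by ring, coeff_add] at hd
    by_cases h0 : coeff d ((f - F) * g) = 0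
    · obtain ⟨x, y, hx, hy, h⟩ :=
        exists_of_coeff_mul_ne_zero (fun h => hd (by rw [h0, h, add_zero]))
      have := hf.1 x hx
      have := hg.2 y hy
      omega
    · obtain ⟨x, y, hx, hy, h⟩ := exists_of_coeff_mul_ne_zero h0
      have := hf.2 x hx
      have := hg.coeff_left y hy
      omega

theorem const (c : R) : IsLead 0 (C c : MvPolynomial σ R) (C c) := by
  classical
  refine ⟨fun d hd => ?_, fun d hd => absurd (by simp) hd⟩
  rw [coeff_C] at hd
  have : d = 0 := by by_contra h; exact hd (if_neg (Ne.symm h))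
  simp [this]

theorem C_mul (hf : IsLead a f F) (c : R) : IsLead a (C c * f) (C c * F) := by
  simpa using (const c).mul hf

theorem pow (hf : IsLead a f F) (k : ℕ) : IsLead (k * a) (f ^ k) (F ^ k) := by
  induction k with
  | zero => simpa using const (σ := σ) (1 : R)
  | succ k ih =>
    rw [pow_succ, pow_succ]
    convert ih.mul hf using 1
    push_cast
    ring

theorem of_lt (hf : IsLead a f F) (hab : a < b) : IsLead b f 0 :=
  ⟨fun d hd => absurd (coeff_zero d) hd, fun d hd =>
    (hf.coeff_left d (by simpa using hd)).trans_lt hab⟩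

theorem coeff_ne_zero (hf : IsLead a f F) {d : σ →₀ ℕ} (hd : coeff d F ≠ 0) :
    coeff d f ≠ 0 := by
  intro h
  have := hf.1 d hd
  have := hf.2 d (by rw [coeff_sub, h, zero_sub]; exact neg_ne_zero.2 hd)
  omega

theorem ne_zero (hf : IsLead a f F) (hF : F ≠ 0) : f ≠ 0 := by
  obtain ⟨d, hd⟩ := ne_zero_iff.1 hF
  exact ne_zero_iff.2 ⟨d, hf.coeff_ne_zero hd⟩

theorem totalDegree_eq (hf : IsLead a f F) (hF : F ≠ 0) : (f.totalDegree : ℤ) = a := by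
  obtain ⟨d, hd⟩ := ne_zero_iff.1 hF
  have had := hf.1 d hd
  have h1 := le_totalDegree (mem_support_iff.2 (hf.coeff_ne_zero hd))
  have h2 : f.totalDegree ≤ a.toNat := by
    refine Finset.sup_le fun x hx => ?_
    have := hf.coeff_left x (mem_support_iff.1 hx)
    change x.degree ≤ _
    omega
  change d.degree ≤ _ at h1
  omega

theorem totalDegree_lt (hf : IsLead a f 0) (ha : 0 < a) : (f.totalDegree : ℤ) < a := by
  have h2 : f.totalDegree ≤ (a - 1).toNat := by
    refine Finset.sup_le fun x hx => ?_
    have := hf.2 x (by simpa using hx)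
    change x.degree ≤ _
    omega
  omega

theorem homogeneousComponent (f : MvPolynomial σ R) :
    IsLead f.totalDegree f (homogeneousComponent f.totalDegree f) := by
  refine ⟨fun d hd => ?_, fun d hd => ?_⟩
  · rw [coeff_homogeneousComponent] at hd
    by_contra h
    exact hd (if_neg (by exact_mod_cast h))
  · rw [coeff_sub, coeff_homogeneousComponent] at hd
    split_ifs at hd with h
    · simp at hd
    · have := le_totalDegree (mem_support_iff.2 (by simpa using hd))
      change d.degree ≤ _ at this
      omega

theorem homogeneousComponent_ne_zero (hf : f ≠ 0) :
    MvPolynomial.homogeneousComponent f.totalDegree f ≠ 0 := by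
  obtain ⟨d, hd, h⟩ := Finset.exists_mem_eq_sup f.support (support_nonempty.2 hf)
    (fun d => d.degree)
  refine ne_zero_iff.2 ⟨d, ?_⟩
  rw [coeff_homogeneousComponent, if_pos (show d.degree = f.totalDegree from h.symm)]
  exact mem_support_iff.1 hd

/-- Evaluation of a polynomial whose coefficients are controlled by `IsLead`, where the
variable has weight `b`. -/
theorem eval {u U : Polynomial (MvPolynomial σ R)}
    (h : ∀ j : ℕ, IsLead (a - j * b) (u.coeff j) (U.coeff j)) (hf : IsLead b f F) :
    IsLead a (u.eval f) (U.eval F) := by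
  rw [Polynomial.eval_eq_sum_range' (n := max u.natDegree U.natDegree + 1) (by omega),
    Polynomial.eval_eq_sum_range' (n := max u.natDegree U.natDegree + 1) (by omega)]
  refine sum _ fun j _ => ?_
  simpa using (h j).mul (hf.pow j)

theorem coeff_iterate_derivative {u U : Polynomial (MvPolynomial σ R)}
    (h : ∀ j : ℕ, IsLead (a - j * b) (u.coeff j) (U.coeff j)) (e j : ℕ) :
    IsLead (a - e * b - j * b) ((Polynomial.derivative^[e] u).coeff j)
      ((Polynomial.derivative^[e] U).coeff j) := by
  induction e generalizing j with
  | zero => simpa using h j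
  | succ e ih =>
    rw [Function.iterate_succ_apply', Function.iterate_succ_apply', Polynomial.coeff_derivative,
      Polynomial.coeff_derivative]
    have := (ih (j + 1)).C_mul ((j : R) + 1)
    rw [map_add, map_natCast, map_one] at this
    convert this using 1
    · push_cast
      ring
    · exact mul_comm _ _
    · exact mul_comm _ _

end IsLead

theorem totalDegree_pderiv_add_one_le {σ R : Type*} [CommSemiring R] {f : MvPolynomial σ R}
    {i : σ} (h : pderiv i f ≠ 0) : (pderiv i f).totalDegree + 1 ≤ f.totalDegree := by
  have key : ∀ d, coeff d (pderiv i f) ≠ 0 → d.degree + 1 ≤ f.totalDegree := by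
    intro d hd
    rw [coeff_pderiv] at hd
    have := le_totalDegree (mem_support_iff.2 (left_ne_zero_of_mul hd))
    change Finsupp.degree _ ≤ _ at this
    simpa using this
  obtain ⟨d, hd⟩ := ne_zero_iff.1 h
  have h1 : (pderiv i f).totalDegree ≤ f.totalDegree - 1 := by
    refine Finset.sup_le fun x hx => ?_
    have := key x (mem_support_iff.1 hx)
    change x.degree ≤ _
    omega
  have := key d hd
  omega

theorem totalDegree_jacDet_add_two_le {u v : MvPolynomial (Fin 2) ℂ} (h : jacDet u v ≠ 0) :
    (jacDet u v).totalDegree + 2 ≤ u.totalDegree + v.totalDegree := by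
  have hprod : ∀ i j : Fin 2, ∀ d, coeff d (pderiv i u * pderiv j v) ≠ 0 →
      d.degree + 2 ≤ u.totalDegree + v.totalDegree := by
    intro i j d hd
    have hne : pderiv i u * pderiv j v ≠ 0 := ne_zero_iff.2 ⟨d, hd⟩
    have h1 := totalDegree_pderiv_add_one_le (left_ne_zero_of_mul hne)
    have h2 := totalDegree_pderiv_add_one_le (right_ne_zero_of_mul hne)
    have h3 := (le_totalDegree (mem_support_iff.2 hd)).trans (totalDegree_mul _ _)
    change d.degree ≤ _ at h3
    omega
  obtain ⟨d, hd, hdeg⟩ := Finset.exists_mem_eq_sup (jacDet u v).support (support_nonempty.2 h)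
    (fun d => d.degree)
  replace hdeg : (jacDet u v).totalDegree = d.degree := hdeg
  rw [hdeg]
  rw [mem_support_iff, jacDet, coeff_sub] at hd
  by_cases h0 : coeff d (pderiv 0 u * pderiv 1 v) = 0
  · exact hprod 1 0 d fun h1 => hd (by rw [h0, h1, sub_zero])
  · exact hprod 0 1 d h0

/-- The derivation `v ↦ D(u, v)`. -/
noncomputable def jacDer (u : MvPolynomial (Fin 2) ℂ) :
    Derivation ℂ (MvPolynomial (Fin 2) ℂ) (MvPolynomial (Fin 2) ℂ) :=
  pderiv 0 u • pderiv 1 - pderiv 1 u • pderiv 0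

theorem jacDer_apply (u v : MvPolynomial (Fin 2) ℂ) : jacDer u v = jacDet u v := by
  simp [jacDer, jacDet]

theorem jacDer_self (u : MvPolynomial (Fin 2) ℂ) : jacDer u u = 0 := by
  rw [jacDer_apply, jacDet]
  ring

theorem derivation_eval {R A : Type*} [CommRing R] [CommRing A] [Algebra R A]
    (D : Derivation R A A) {g : Polynomial A} (hg : ∀ j, D (g.coeff j) = 0) (x : A) :
    D (g.eval x) = g.derivative.eval x * D x := by
  rw [Polynomial.eval_eq_sum, Polynomial.derivative_eval, Polynomial.sum, Polynomial.sum, map_sum,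
    Finset.sum_mul]
  refine Finset.sum_congr rfl fun j _ => ?_
  simp [hg, Derivation.leibniz, Derivation.leibniz_pow]
  ring

theorem derivation_coeff_iterate_derivative {R A : Type*} [CommRing R] [CommRing A] [Algebra R A]
    (D : Derivation R A A) {g : Polynomial A} (hg : ∀ j, D (g.coeff j) = 0) (e j : ℕ) :
    D ((Polynomial.derivative^[e] g).coeff j) = 0 := by
  induction e generalizing j with
  | zero => exact hg j
  | succ e ih =>
    rw [Function.iterate_succ_apply', Polynomial.coeff_derivative]
    simp [Derivation.leibniz, ih]

theorem totalDegree_eval_iterate_derivative {p q : MvPolynomial (Fin 2) ℂ}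
    (hD : jacDet p q ≠ 0) {g : Polynomial (MvPolynomial (Fin 2) ℂ)}
    (hg : ∀ j, jacDer p (g.coeff j) = 0) (e : ℕ)
    (he : (Polynomial.derivative^[e] g).eval q ≠ 0) :
    ((Polynomial.derivative^[e] g).eval q).totalDegree + e * ((jacDet p q).totalDegree + 2) ≤
      (g.eval q).totalDegree + e * p.totalDegree := by
  induction e with
  | zero => simp
  | succ e ih =>
    have hchain := derivation_eval (jacDer p) (derivation_coeff_iterate_derivative (jacDer p) hg e) q
    rw [← Function.iterate_succ_apply' Polynomial.derivative, jacDer_apply, jacDer_apply] at hchain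
    have hne : jacDet p ((Polynomial.derivative^[e] g).eval q) ≠ 0 :=
      hchain ▸ mul_ne_zero he hD
    have h1 := totalDegree_jacDet_add_two_le hne
    rw [hchain, totalDegree_mul_of_isDomain he hD] at h1
    have h2 := ih fun h => hne (by rw [h, ← jacDer_apply, map_zero])
    linarith

theorem two_mul_rootMultiplicity_le {A : Type*} [CommRing A] [IsDomain A] {f : Polynomial A}
    (hf : f ≠ 0) {x z : A} (hz : IsUnit z) (hne : z * x ≠ x) (r : ℕ)
    (hs : f.comp (Polynomial.C z * Polynomial.X) = Polynomial.C (z ^ r) * f) :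
    2 * f.rootMultiplicity x ≤ f.natDegree := by
  classical
  have h1 : f.rootMultiplicity (z * x) = f.rootMultiplicity x := by
    have h := Polynomial.rootMultiplicity_comp_C_mul_X_add_C f z 0 x hz
    rw [map_zero, add_zero, add_zero, hs] at h
    rw [← h, Polynomial.rootMultiplicity_mul (mul_ne_zero (by simpa using (hz.pow r).ne_zero) hf),
      Polynomial.rootMultiplicity_C, zero_add]
  have h2 : f.rootMultiplicity x • {x} + f.rootMultiplicity x • {z * x} ≤ f.roots := by
    rw [Multiset.le_iff_count]
    intro y
    simp only [Multiset.count_add, Multiset.count_nsmul, Multiset.count_singleton,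
      Polynomial.count_roots]
    by_cases hy : y = x
    · simp [hy, hne.symm]
    · by_cases hy' : y = z * x
      · simp [hy', hne, h1]
      · simp [hy, hy']
  have h3 := (Multiset.card_le_card h2).trans (Polynomial.card_roots' f)
  simp at h3
  omega

theorem exists_eq_algebraMap_mul_pow {k A ι : Type*} [Field k] [IsAlgClosed k] [CommRing A]
    [IsDomain A] [Algebra k A] {x y : A} (hx : x ≠ 0) {t M : ℕ} {T : Finset ι} (hT : T.Nonempty)
    {i j : ι → ℕ} {c : ι → k} (hij : ∀ s ∈ T, i s + t * j s = M)
    (hinj : ∀ s ∈ T, ∀ s' ∈ T, j s = j s' → s = s') (hc : ∀ s ∈ T, c s ≠ 0)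
    (hsum : ∑ s ∈ T, algebraMap k A (c s) * (x ^ i s * y ^ j s) = 0) :
    ∃ a : k, y = algebraMap k A a * x ^ t := by
  classical
  let K := FractionRing A
  have hdiv (u v y r : K) (hv : v ≠ 0) : u * v * (r * (y / v)) = r * (u * y) := by
    rw [show u * v * (r * (y / v)) = r * (u * (y / v * v)) by ring, div_mul_cancel₀ y hv]
  have hx' : algebraMap A K x ≠ 0 := by simpa using hx
  set τ : K := algebraMap A K y / algebraMap A K x ^ t with hτ
  let h : Polynomial k := ∑ s ∈ T, Polynomial.monomial (j s) (c s)
  have hne : h ≠ 0 := by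
    obtain ⟨s, hs⟩ := hT
    intro h0
    have h1 : h.coeff (j s) = c s := by
      simp only [h, Polynomial.finsetSum_coeff, Polynomial.coeff_monomial]
      rw [Finset.sum_eq_single s]
      · simp
      · intro s' hs' hss'
        rw [if_neg fun h' => hss' (hinj s' hs' s hs h')]
      · exact fun h' => absurd hs h'
    exact hc s hs (by rw [← h1, h0, Polynomial.coeff_zero])
  have haeval : Polynomial.aeval τ h = 0 := by
    have h1 : algebraMap A K x ^ M * Polynomial.aeval τ h = 0 := by
      rw [map_sum, Finset.mul_sum]
      have h2 := congrArg (algebraMap A K) hsum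
      rw [map_sum, map_zero] at h2
      rw [← h2]
      refine Finset.sum_congr rfl fun s hs => ?_
      rw [Polynomial.aeval_monomial, ← hij s hs, hτ, IsScalarTower.algebraMap_apply k A K]
      simp only [map_mul, map_pow]
      rw [div_pow, ← pow_mul, pow_add]
      exact hdiv _ _ _ _ (pow_ne_zero _ hx')
    exact (mul_eq_zero.1 h1).resolve_left (pow_ne_zero _ hx')
  have hint : IsIntegral k τ := isAlgebraic_iff_isIntegral.1 ⟨h, hne, haeval⟩
  obtain ⟨a, ha⟩ := minpoly.mem_range_of_degree_eq_one k τ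
    (IsAlgClosed.degree_eq_one_of_irreducible k (minpoly.irreducible hint))
  refine ⟨a, IsFractionRing.injective A K ?_⟩
  rw [map_mul, map_pow, ← IsScalarTower.algebraMap_apply k A K, ha, hτ,
    div_mul_cancel₀ _ (pow_ne_zero _ hx')]

/-- A sum of terms `c_s pⁱ Vʲ` with exponents `s = (i, j)`, as a polynomial in `V`. -/
noncomputable def sumTerms {R A : Type*} [CommRing R] [CommRing A] [Algebra R A]
    (c : (Fin 2 →₀ ℕ) → R) (T : Finset (Fin 2 →₀ ℕ)) (p : A) : Polynomial A :=
  ∑ s ∈ T, Polynomial.monomial (s 1) (algebraMap R A (c s) * p ^ s 0)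

section sumTerms

variable {R A : Type*} [CommRing R] [CommRing A] [Algebra R A]
  (c : (Fin 2 →₀ ℕ) → R) (T : Finset (Fin 2 →₀ ℕ)) (p : A)

theorem eval_sumTerms (q : A) :
    (sumTerms c T p).eval q = ∑ s ∈ T, algebraMap R A (c s) * (p ^ s 0 * q ^ s 1) := by
  simp [sumTerms, Polynomial.eval_finsetSum, mul_assoc]

theorem coeff_sumTerms (j : ℕ) :
    (sumTerms c T p).coeff j =
      ∑ s ∈ T, if s 1 = j then algebraMap R A (c s) * p ^ s 0 else 0 := by
  simp [sumTerms, Polynomial.coeff_monomial]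

theorem exists_of_coeff_sumTerms_ne_zero {j : ℕ} (h : (sumTerms c T p).coeff j ≠ 0) :
    ∃ s ∈ T, s 1 = j := by
  rw [coeff_sumTerms] at h
  obtain ⟨s, hs, hne⟩ := Finset.exists_ne_zero_of_sum_ne_zero h
  exact ⟨s, hs, by by_contra h'; exact hne (if_neg h')⟩

theorem sumTerms_ne_zero [IsDomain A] [FaithfulSMul R A] (hT : T.Nonempty)
    (hinj : ∀ s ∈ T, ∀ s' ∈ T, s 1 = s' 1 → s = s') (hc : ∀ s ∈ T, c s ≠ 0) (hp : p ≠ 0) :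
    sumTerms c T p ≠ 0 := by
  obtain ⟨s, hs⟩ := hT
  intro h0
  have h1 : (sumTerms c T p).coeff (s 1) = algebraMap R A (c s) * p ^ s 0 := by
    rw [coeff_sumTerms, Finset.sum_eq_single s]
    · simp
    · intro s' hs' hss'
      rw [if_neg fun h' => hss' (hinj s' hs' s hs h')]
    · exact fun h' => absurd hs h'
  rw [h0, Polynomial.coeff_zero] at h1
  refine mul_ne_zero ?_ (pow_ne_zero _ hp) h1.symm
  simpa using hc s hs

theorem derivation_coeff_sumTerms (D : Derivation R A A) (hp : D p = 0) (j : ℕ) :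
    D ((sumTerms c T p).coeff j) = 0 := by
  rw [coeff_sumTerms, map_sum]
  refine Finset.sum_eq_zero fun s _ => ?_
  split_ifs
  · simp [Derivation.leibniz, Derivation.leibniz_pow, hp]
  · exact map_zero D

end sumTerms

theorem IsLead.coeff_sumTerms {σ R : Type*} [CommRing R] {n m W : ℕ} {p p' : MvPolynomial σ R}
    (hp : IsLead n p p') (c : (Fin 2 →₀ ℕ) → R) {S : Finset (Fin 2 →₀ ℕ)}
    (hS : ∀ s ∈ S, n * s 0 + m * s 1 ≤ W) (j : ℕ) :
    IsLead (W - j * m) ((sumTerms c S p).coeff j)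
      ((sumTerms c (S.filter fun s => n * s 0 + m * s 1 = W) p').coeff j) := by
  rw [_root_.coeff_sumTerms, _root_.coeff_sumTerms, Finset.sum_filter]
  refine IsLead.sum _ fun s hs => ?_
  have hW := hS s hs
  by_cases hj : s 1 = j
  · have hterm := (hp.pow (s 0)).C_mul (c s)
    subst hj
    simp only [if_true]
    split_ifs with h
    · convert hterm using 1
      · rw [← h]
        push_cast
        ring
      · rw [algebraMap_eq]
      · rw [algebraMap_eq]
    · refine hterm.of_lt ?_
      have : n * s 0 + m * s 1 < W := lt_of_le_of_ne hW h
      zify at this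
      linarith
  · simpa [hj] using IsLead.zero _

theorem exists_sumTerms_of_mem_adjoin {R A : Type*} [CommRing R] [CommRing A] [Algebra R A]
    {p q w : A} (hw : w ∈ Algebra.adjoin R ({p, q} : Set A)) :
    ∃ (c : (Fin 2 →₀ ℕ) → R) (S : Finset (Fin 2 →₀ ℕ)), (∀ s ∈ S, c s ≠ 0) ∧
      w = (sumTerms c S p).eval q := by
  have hr : ({p, q} : Set A) = Set.range ![p, q] := by simp [Set.pair_comm]
  rw [hr, Algebra.adjoin_range_eq_range_aeval] at hw
  obtain ⟨G, rfl⟩ := hw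
  refine ⟨fun s => coeff s G, G.support, fun s hs => mem_support_iff.1 hs, ?_⟩
  rw [eval_sumTerms]
  change aeval _ G = _
  rw [aeval_def, eval₂_eq']
  simp [Fin.prod_univ_two]

theorem exists_pow_eq_one_ne_one {s : ℕ} (hs : 2 ≤ s) : ∃ z : ℂ, z ^ s = 1 ∧ z ≠ 1 :=
  have h := Complex.isPrimitiveRoot_exp s (by omega)
  ⟨_, h.pow_eq_one, h.ne_one (by omega)⟩

/-- The exponents of a weighted homogeneous form of weights `n`, `m` are constant modulo
`n / gcd(n, m)` in the second variable, so the form is semi-invariant under roots of unity. -/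
theorem sumTerms_comp_root {R A : Type*} [CommRing R] [CommRing A] [Algebra R A]
    (c : (Fin 2 →₀ ℕ) → R) {T : Finset (Fin 2 →₀ ℕ)} (hT : T.Nonempty) (p : A) {n m W : ℕ}
    (hn : 0 < n) (hW : ∀ s ∈ T, n * s 0 + m * s 1 = W) {z : A} (hz : z ^ (n / n.gcd m) = 1) :
    ∃ r, (sumTerms c T p).comp (Polynomial.C z * Polynomial.X) =
      Polynomial.C (z ^ r) * sumTerms c T p := by
  obtain ⟨s₀, hs₀⟩ := hT
  refine ⟨s₀ 1, Polynomial.ext fun j => ?_⟩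
  rw [Polynomial.comp_C_mul_X_coeff, Polynomial.coeff_C_mul, mul_comm]
  by_cases h : (sumTerms c T p).coeff j = 0
  · rw [h, mul_zero, mul_zero]
  obtain ⟨s, hs, rfl⟩ := exists_of_coeff_sumTerms_ne_zero c T p h
  congr 1
  have hmod : s 1 ≡ s₀ 1 [MOD n / n.gcd m] := by
    refine Nat.ModEq.cancel_left_div_gcd hn (c := m) ?_
    have h1 := (hW s hs).trans (hW s₀ hs₀).symm
    have h2 : n * s 0 + m * s 1 ≡ n * s₀ 0 + m * s₀ 1 [MOD n] := by rw [h1]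
    simpa [Nat.ModEq] using h2
  exact pow_eq_pow_of_modEq hmod hz

/-- Let `p, q` be algebraically independent polynomials with `(p, q)` elementary
reduced, `n = deg p < m = deg q`, `m, n ≥ 2`, and `deg D(p,q) ≥ k`.  Then every
`w ∈ ℂ[p,q]` which is not a linear combination of `p`, `q` and `1` satisfies
`deg w > min(n, k)`. -/
theorem degree_in_subalgebra (p q : P)
    (hind : AlgebraicIndependent ℂ ![p, q]) (hred : ElementaryReduced p q)
    (n m k : ℕ) (hn : n = p.totalDegree) (hm : m = q.totalDegree)
    (hnm : n < m) (hn2 : 2 ≤ n) (hm2 : 2 ≤ m)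
    (hk : k ≤ (jacDet p q).totalDegree)
    (w : P) (hw : w ∈ Algebra.adjoin ℂ ({p, q} : Set P))
    (hlin : ¬∃ a b c : ℂ, w = C a * p + C b * q + C c) :
    min n k < w.totalDegree := by
  subst hn hm
  by_cases hD : jacDet p q = 0
  · rw [hD, totalDegree_zero, Nat.le_zero] at hk
    rw [hk, Nat.min_zero, Nat.pos_iff_ne_zero]
    intro h0
    exact hlin ⟨0, 0, _, by simpa using totalDegree_eq_zero_iff_eq_C.1 h0⟩
  have hp0 : p ≠ 0 := fun h => by simp [h] at hn2
  have hq0 : q ≠ 0 := fun h => by simp [h] at hm2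
  have hp := IsLead.homogeneousComponent p
  have hq := IsLead.homogeneousComponent q
  have hp' := IsLead.homogeneousComponent_ne_zero hp0
  have hq' := IsLead.homogeneousComponent_ne_zero hq0
  set n := p.totalDegree with hn
  set m := q.totalDegree with hm
  set p' := homogeneousComponent n p
  set q' := homogeneousComponent m q
  obtain ⟨c, S, hc, hwS⟩ := exists_sumTerms_of_mem_adjoin hw
  have hSne : S.Nonempty := by
    rw [Finset.nonempty_iff_ne_empty]
    rintro rfl
    exact hlin ⟨0, 0, 0, by simp [hwS, sumTerms]⟩
  obtain ⟨W, hS, s₁, hs₁, hs₁W⟩ : ∃ W, (∀ s ∈ S, n * s 0 + m * s 1 ≤ W) ∧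
      ∃ s ∈ S, n * s 0 + m * s 1 = W := by
    obtain ⟨s, hs, h⟩ := Finset.exists_max_image S (fun s => n * s 0 + m * s 1) hSne
    exact ⟨_, h, s, hs, rfl⟩
  have hWn : n < W := by
    by_contra! hWn
    have hspan : w ∈ Submodule.span ℂ ({p, q, 1} : Set P) := by
      rw [hwS, eval_sumTerms]
      refine Submodule.sum_mem _ fun s hs => ?_
      rw [← Algebra.smul_def]
      refine Submodule.smul_mem _ _ (Submodule.subset_span ?_)
      have h := (hS s hs).trans hWn
      have h1 : s 1 = 0 := by
        by_contra h1
        have := Nat.le_mul_of_pos_right m (Nat.pos_of_ne_zero h1)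
        omega
      have h0 : s 0 ≤ 1 := by
        by_contra! h0
        have := Nat.mul_le_mul_left n h0
        omega
      interval_cases h2 : s 0 <;> simp [h1]
    obtain ⟨a, b, d, h⟩ := Submodule.mem_span_triple.1 hspan
    exact hlin ⟨a, b, d, by rw [← h, smul_eq_C_mul, smul_eq_C_mul, smul_eq_C_mul, mul_one]⟩
  let T := S.filter fun s => n * s 0 + m * s 1 = W
  have hT : T.Nonempty := ⟨s₁, Finset.mem_filter.2 ⟨hs₁, hs₁W⟩⟩
  have hTW : ∀ s ∈ T, n * s 0 + m * s 1 = W := fun s hs => (Finset.mem_filter.1 hs).2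
  have hTc : ∀ s ∈ T, c s ≠ 0 := fun s hs => hc s (Finset.mem_filter.1 hs).1
  have hinj : ∀ s ∈ T, ∀ s' ∈ T, s 1 = s' 1 → s = s' := by
    intro s hs s' hs' h
    have h1 := (hTW s hs).trans (hTW s' hs').symm
    rw [h] at h1
    have h2 : s 0 = s' 0 := Nat.eq_of_mul_eq_mul_left (by omega) (Nat.add_right_cancel h1)
    ext i
    fin_cases i
    · exact h2
    · exact h
  let f := sumTerms c T p'
  have hf : f ≠ 0 := sumTerms_ne_zero c T p' hT hinj hTc hp'
  set e := f.rootMultiplicity q' with he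
  have hfe : (Polynomial.derivative^[e] f).eval q' ≠ 0 := by
    rw [he, Polynomial.eval_iterate_derivative_rootMultiplicity, nsmul_eq_mul]
    exact mul_ne_zero (Nat.cast_ne_zero.2 (Nat.factorial_ne_zero _))
      (Polynomial.eval_divByMonic_pow_rootMultiplicity_ne_zero q' hf)
  have hlead : IsLead (W - e * m) ((Polynomial.derivative^[e] (sumTerms c S p)).eval q)
      ((Polynomial.derivative^[e] f).eval q') :=
    IsLead.eval (IsLead.coeff_iterate_derivative (hp.coeff_sumTerms c hS) e) hq
  have hdeg := hlead.totalDegree_eq hfe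
  have hchain := totalDegree_eval_iterate_derivative hD
    (derivation_coeff_sumTerms c S p (jacDer p) (jacDer_self p)) e
    (hlead.ne_zero hfe)
  rw [← hwS] at hchain
  rcases Nat.eq_zero_or_pos e with he0 | hepos
  · rw [he0] at hdeg
    simp only [Function.iterate_zero, id, ← hwS] at hdeg
    omega
  have hroot : f.eval q' = 0 := (Polynomial.rootMultiplicity_pos hf).1 hepos
  have hs2 : 2 ≤ n / n.gcd m := by
    by_contra! hlt
    have hdvd : n ∣ m := by
      have h1 : n / n.gcd m = 1 := by
        have := Nat.div_pos (Nat.gcd_le_left m (by omega : 0 < n))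
          (Nat.gcd_pos_of_pos_left m (by omega))
        omega
      have h2 := Nat.div_mul_cancel (Nat.gcd_dvd_left n m)
      rw [h1, one_mul] at h2
      exact Nat.gcd_eq_left_iff_dvd.1 h2
    obtain ⟨t, ht⟩ := hdvd
    have ht2 : 2 ≤ t := by
      by_contra! ht2
      interval_cases t <;> omega
    obtain ⟨a, ha⟩ := exists_eq_algebraMap_mul_pow (k := ℂ) hp' (t := t) (M := W / n) hT
      (i := fun s => s 0) (j := fun s => s 1) (c := c)
      (fun s hs => by
        rw [← hTW s hs, ht, mul_assoc, ← mul_add, Nat.mul_div_cancel_left _ (by omega)])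
      hinj hTc (by rw [← eval_sumTerms]; exact hroot)
    have ha0 : a ≠ 0 := by
      rintro rfl
      exact hq' (by rw [ha, map_zero, zero_mul])
    have hlt : IsLead (m : ℤ) (q + C (-a) * p ^ t) 0 := by
      have h1 := (hp.pow t).C_mul (-a)
      have h2 : ((t : ℤ) * n) = m := by rw [ht]; push_cast; ring
      rw [h2] at h1
      convert hq.add h1 using 1
      change 0 = q' + C (-a) * p' ^ t
      rw [ha, algebraMap_eq, C_neg]
      ring
    have h3 := hlt.totalDegree_lt (by omega)
    have h4 := hred.2.2 (-a) (neg_ne_zero.2 ha0) t ht2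
    omega
  obtain ⟨z, hz, hz1⟩ := exists_pow_eq_one_ne_one hs2
  have hzC : (C z : P) ^ (n / n.gcd m) = 1 := by rw [← C_pow, hz, C_1]
  obtain ⟨r, hr⟩ := sumTerms_comp_root c hT p' (by omega) hTW hzC
  have h2e := two_mul_rootMultiplicity_le hf (IsUnit.of_pow_eq_one hzC (by omega))
    (x := q')
    (fun h => hz1 (C_injective (Fin 2) ℂ (mul_right_cancel₀ hq' (by rw [h, C_1, one_mul])))) r hr
  obtain ⟨s, hs, hsdeg⟩ := exists_of_coeff_sumTerms_ne_zero c T p'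
    (Polynomial.leadingCoeff_ne_zero.2 hf)
  have hW2 : m * (2 * e) ≤ W := by
    rw [← hTW s hs, hsdeg]
    exact (Nat.mul_le_mul_left m h2e).trans (Nat.le_add_left _ _)
  refine (Nat.min_le_right n k).trans_lt ?_
  zify at *
  nlinarith
end
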